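/- arXiv:1807.05820 — 2 statements merged into one kernel-verified Lean document; each statement's English description precedes it below -/
import Mathlib

section
/- For every ε > 0 there exists a constant C > 0 such that for all real H ≥ 2 one has |E₃(H) − 8(π²/6 + 1/4)·H²| ≤ C·H^{3/2+ε}. -/
open Polynomial Real

/-- The monic cubic `X³ + aX² + bX + c` over `ℚ`. -/
noncomputable abbrev ratCubic (a b c : ℤ) : ℚ[X] :=
  X ^ 3 + C (a : ℚ) * X ^ 2 + C (b : ℚ) * X + C (c : ℚ)

lemma natDegree_ratCubic (a b c : ℤ) : (ratCubic a b c).natDegree = 3 := by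
  unfold ratCubic; compute_degree!

lemma monic_ratCubic (a b c : ℤ) : (ratCubic a b c).Monic := by
  unfold ratCubic; monicity!

section SplittingField

variable {K L : Type*} [Field K] [Field L] [Algebra K L]

/-- The action of the automorphisms of `L` over `K` on the roots in `L` of a polynomial over `K`. -/
def rootPermHom (L : Type*) [Field L] [Algebra K L] (p : K[X]) :
    (L ≃ₐ[K] L) →* Equiv.Perm (p.rootSet L) :=
  letI : MulAction (L ≃ₐ[K] L) (p.rootSet L) :=
    { smul := fun s => Set.MapsTo.restrict s _ _ <| rootSet_mapsTo s.toAlgHom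
      one_smul := fun _ => by ext; rfl
      mul_smul := fun _ _ _ => by ext; rfl }
  MulAction.toPermHom _ _

lemma rootPermHom_apply (p : K[X]) (s : L ≃ₐ[K] L) (x : p.rootSet L) :
    (rootPermHom L p s x : L) = s x := rfl

lemma rootPermHom_injective (p : K[X]) [hL : IsSplittingField K L p] :
    Function.Injective (rootPermHom L p) := by
  intro s t h
  have h1 : (s : L →ₐ[K] L) = t := by
    apply AlgHom.ext_of_adjoin_eq_top (IsSplittingField.adjoin_rootSet L p)
    intro x hx
    have := congrArg (fun q : Equiv.Perm (p.rootSet L) => (q ⟨x, hx⟩ : L)) h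
    exact this
  ext x
  exact congrArg (fun q : L →ₐ[K] L => q x) h1

lemma card_rootSet_le_natDegree (p : K[X]) : Nat.card (p.rootSet L) ≤ p.natDegree := by
  classical
  rw [Nat.card_coe_set_eq, rootSet, Set.ncard_coe_finset]
  exact ((Multiset.toFinset_card_le _).trans (card_roots' _)).trans natDegree_map_le

/-- If the automorphism group of the splitting field of a cubic has six elements, then it is the
full group of permutations of the three roots. -/
lemma rootPermHom_bijective_of_card (p : K[X]) [hL : IsSplittingField K L p]
    (hp : p.natDegree = 3) (h : Nat.card (L ≃ₐ[K] L) = 6) :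
    Function.Bijective (rootPermHom L p) ∧ Nat.card (p.rootSet L) = 3 := by
  have hinj := rootPermHom_injective (L := L) p
  have hle : Nat.card (p.rootSet L) ≤ 3 := hp ▸ card_rootSet_le_natDegree (L := L) p
  have h1 := Nat.card_le_card_of_injective _ hinj
  rw [h, Nat.card_perm] at h1
  have h3 : Nat.card (p.rootSet L) = 3 := by
    interval_cases h : Nat.card (p.rootSet L) <;> simp_all [Nat.factorial]
  refine ⟨?_, h3⟩
  rw [Nat.bijective_iff_injective_and_card]
  refine ⟨hinj, ?_⟩
  rw [h, Nat.card_perm, h3]; rfl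

lemma card_ne_six_of_isRoot (p : K[X]) [hL : IsSplittingField K L p]
    (hp : p.natDegree = 3) {r : K} (hr : p.IsRoot r) : Nat.card (L ≃ₐ[K] L) ≠ 6 := by
  intro hcard
  obtain ⟨hbij, h3⟩ := rootPermHom_bijective_of_card p hp hcard
  have hp0 : p ≠ 0 := by rintro rfl; simp at hp
  let x : p.rootSet L := ⟨algebraMap K L r, by
    rw [mem_rootSet]
    exact ⟨hp0, by rw [aeval_algebraMap_apply, coe_aeval_eq_eval, hr.eq_zero, map_zero]⟩⟩
  have : Nontrivial (p.rootSet L) := by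
    rw [← Finite.one_lt_card_iff_nontrivial, h3]; norm_num
  obtain ⟨y, hy⟩ := exists_ne x
  classical
  obtain ⟨s, hs⟩ := hbij.2 (Equiv.swap x y)
  have h1 : rootPermHom L p s x = y := by rw [hs, Equiv.swap_apply_left]
  apply hy
  rw [← h1]
  ext
  rw [rootPermHom_apply]
  exact s.commutes r

/-- If the automorphism group of the splitting field of a cubic has three elements, then the
discriminant of the cubic is a square. -/
lemma exists_sq_of_card_eq_three [CharZero K] {a b c : K} (p : K[X])
    (hpdef : p = X ^ 3 + C a * X ^ 2 + C b * X + C c) [hL : IsSplittingField K L p]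
    (hirr : Irreducible p) (hcard : Nat.card (L ≃ₐ[K] L) = 3) :
    ∃ y : K, a ^ 2 * b ^ 2 - 4 * b ^ 3 - 4 * a ^ 3 * c + 18 * a * b * c - 27 * c ^ 2 = y ^ 2 := by
  have hdeg : p.natDegree = 3 := by rw [hpdef]; compute_degree!
  have hmon : p.Monic := by rw [hpdef]; monicity!
  have hspl := IsSplittingField.splits L p
  obtain ⟨x₁, x₂, x₃, hx⟩ : ∃ x₁ x₂ x₃, (p.map (algebraMap K L)).roots = {x₁, x₂, x₃} := by
    rw [← Multiset.card_eq_three, splits_iff_card_roots.1 hspl, natDegree_map, hdeg]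
  have hfac : p.map (algebraMap K L) = (X - C x₁) * (X - C x₂) * (X - C x₃) := by
    rw [hspl.eq_prod_roots_of_monic (hmon.map _), hx]
    simp [mul_assoc]
  have hroot : ∀ (s : L ≃ₐ[K] L) x, (x - x₁) * (x - x₂) * (x - x₃) = 0 →
      (s x - x₁) * (s x - x₂) * (s x - x₃) = 0 := by
    intro s x h
    have e : ∀ z : L, (z - x₁) * (z - x₂) * (z - x₃) = aeval z p := by
      intro z
      rw [← eval_map_algebraMap, hfac]; simp
    rw [e] at h ⊢
    have : aeval (s x) p = s (aeval x p) := aeval_algHom_apply (s : L →ₐ[K] L) x p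
    rw [this, h, map_zero]
  have hcoef : ∀ z : L, (z - x₁) * (z - x₂) * (z - x₃) = z ^ 3 + algebraMap K L a * z ^ 2 +
      algebraMap K L b * z + algebraMap K L c := by
    intro z
    have : eval z (p.map (algebraMap K L)) = (z - x₁) * (z - x₂) * (z - x₃) := by rw [hfac]; simp
    rw [← this, hpdef]; simp
  have : CharZero L := charZero_of_injective_algebraMap (algebraMap K L).injective
  have : FiniteDimensional K L := IsSplittingField.finiteDimensional L p
  have : IsGalois K L := IsGalois.of_separable_splitting_field hirr.separable (p := p)
  have hc : algebraMap K L c = -(x₁ * x₂ * x₃) := by linear_combination -hcoef 0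
  have ha : algebraMap K L a = -(x₁ + x₂ + x₃) := by
    linear_combination (exp := 1) - (1 / 2 : L) * hcoef 1 - (1 / 2 : L) * hcoef (-1) + hcoef 0
  have hb : algebraMap K L b = x₁ * x₂ + x₁ * x₃ + x₂ * x₃ := by
    linear_combination (exp := 1) - (1 / 2 : L) * hcoef 1 + (1 / 2 : L) * hcoef (-1)
  set d := (x₁ - x₂) * (x₁ - x₃) * (x₂ - x₃) with hd
  have hd2 : d ^ 2 = algebraMap K L
      (a ^ 2 * b ^ 2 - 4 * b ^ 3 - 4 * a ^ 3 * c + 18 * a * b * c - 27 * c ^ 2) := by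
    simp only [map_add, map_sub, map_mul, map_pow, map_ofNat, ha, hb, hc, hd]
    ring
  have hfix : ∀ s : L ≃ₐ[K] L, s d = d := by
    intro s
    have h1 : s d = d ∨ s d = -d := by
      rw [← sq_eq_sq_iff_eq_or_eq_neg, ← map_pow, hd2, AlgEquiv.commutes]
    rcases h1 with h1 | h1
    · exact h1
    have h3 : s ^ 3 = 1 := hcard ▸ pow_card_eq_one'
    have h4 : (s ^ 3) d = s (s (s d)) := by simp [pow_succ]
    rw [h3, h1, map_neg, h1, neg_neg, h1] at h4
    rw [h1]; simpa using h4.symm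
  obtain ⟨y, hy⟩ := (IsGalois.mem_range_algebraMap_iff_fixed d).2 hfix
  refine ⟨y, (algebraMap K L).injective ?_⟩
  rw [← hd2, ← hy, map_pow]

/-- The Galois group of an irreducible cubic is `S₃` or has three elements. -/
lemma card_gal_eq_three [CharZero K] {p : K[X]} (hirr : Irreducible p) (hdeg : p.natDegree = 3)
    (h : ¬ Nonempty (p.Gal ≃* Equiv.Perm (Fin 3))) : Nat.card p.Gal = 3 := by
  have hinj := rootPermHom_injective (hL := IsSplittingField.splittingField p) p
  have hrc : Nat.card (p.rootSet p.SplittingField) = 3 := by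
    rw [Nat.card_eq_fintype_card]
    exact (card_rootSet_eq_natDegree hirr.separable (SplittingField.splits p)).trans hdeg
  have hd : Nat.card p.Gal ∣ _ := Subgroup.card_dvd_of_injective _ hinj
  rw [Nat.card_perm, hrc] at hd
  obtain ⟨k, hk⟩ : 3 ∣ Nat.card p.Gal :=
    hdeg ▸ Gal.prime_degree_dvd_card hirr (hdeg ▸ Nat.prime_three)
  have hne : Nat.card p.Gal ≠ 6 := by
    intro h6
    have e1 := MulEquiv.ofBijective _
      (rootPermHom_bijective_of_card (hL := IsSplittingField.splittingField p) p hdeg h6).1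
    have e2 : p.rootSet p.SplittingField ≃ Fin 3 := Finite.equivFinOfCardEq hrc
    exact h ⟨e1.trans e2.permCongrHom⟩
  have hk2 : k ∣ 2 := by
    rw [hk] at hd; exact Nat.dvd_of_mul_dvd_mul_left (k := 3) (by norm_num) hd
  have := Nat.le_of_dvd (by norm_num) hk2
  interval_cases k <;> omega

end SplittingField

/-- The Galois group of a cubic with an integer root is not `S₃`. -/
lemma not_nonempty_gal_equiv_of_root {a b c r : ℤ} (hr : r ^ 3 + a * r ^ 2 + b * r + c = 0) :
    ¬ Nonempty ((ratCubic a b c).Gal ≃* Equiv.Perm (Fin 3)) := by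
  rintro ⟨e⟩
  have hcard : Nat.card (ratCubic a b c).Gal = 6 := by
    rw [Nat.card_congr e.toEquiv, Nat.card_perm, Nat.card_fin]; rfl
  refine card_ne_six_of_isRoot (L := (ratCubic a b c).SplittingField) (ratCubic a b c)
    (natDegree_ratCubic a b c) (r := (r : ℚ)) ?_ hcard
  simp [IsRoot]
  exact_mod_cast hr

/-- The discriminant of the cubic `X³ + aX² + bX + c`. -/
def cubicDisc (a b c : ℤ) : ℤ :=
  a ^ 2 * b ^ 2 - 4 * b ^ 3 - 4 * a ^ 3 * c + 18 * a * b * c - 27 * c ^ 2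

/-- If the Galois group of an irreducible cubic is not `S₃`, the discriminant is a square. -/
lemma exists_cubicDisc_eq_sq {a b c : ℤ} (hroot : ∀ r : ℤ, r ^ 3 + a * r ^ 2 + b * r + c ≠ 0)
    (h : ¬ Nonempty ((ratCubic a b c).Gal ≃* Equiv.Perm (Fin 3))) :
    ∃ y : ℤ, cubicDisc a b c = y ^ 2 := by
  obtain ⟨p, hp⟩ : ∃ p, p = ratCubic a b c := ⟨_, rfl⟩
  rw [← hp] at h
  have hdeg : p.natDegree = 3 := hp ▸ natDegree_ratCubic a b c
  have hmon : p.Monic := hp ▸ monic_ratCubic a b c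
  have hp0 := hmon.ne_zero
  have hirr : Irreducible p := by
    rw [hmon.irreducible_iff_roots_eq_zero_of_degree_le_three (by omega) (by omega),
      Multiset.eq_zero_iff_forall_notMem]
    intro r hr
    rw [mem_roots hp0, IsRoot] at hr
    have hm : (X ^ 3 + C a * X ^ 2 + C b * X + C c : ℤ[X]).Monic := by monicity!
    have : aeval r (X ^ 3 + C a * X ^ 2 + C b * X + C c : ℤ[X]) = 0 := by
      simpa [hp, ratCubic] using hr
    obtain ⟨z, hz⟩ := isInteger_of_is_root_of_monic hm this
    have hz : (z : ℚ) = r := hz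
    apply hroot z
    rw [← hz] at hr
    simp [hp, ratCubic] at hr
    exact_mod_cast hr
  have hcard := card_gal_eq_three hirr hdeg h
  obtain ⟨y, hy⟩ :=
    exists_sq_of_card_eq_three (hL := IsSplittingField.splittingField p) p hp hirr hcard
  have hy' : ((cubicDisc a b c : ℤ) : ℚ) = y ^ 2 := by rw [← hy, cubicDisc]; push_cast; ring
  have hsq : IsSquare ((cubicDisc a b c : ℤ) : ℚ) := ⟨y, by rw [hy']; ring⟩
  rw [Rat.isSquare_intCast_iff] at hsq
  obtain ⟨z, hz⟩ := hsq
  exact ⟨z, by rw [hz]; ring⟩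

/-- The ring of Eisenstein integers `ℤ[ω]`, `ω² + ω + 1 = 0`. -/
abbrev Eisenstein : Type := QuadraticAlgebra ℤ (-1) (-1)

namespace Eisenstein

open QuadraticAlgebra

lemma norm_eq (z : Eisenstein) : norm z = z.re ^ 2 - z.re * z.im + z.im ^ 2 := by
  rw [norm_def]; ring

lemma norm_nonneg (z : Eisenstein) : 0 ≤ norm z := by
  rw [norm_eq]; nlinarith [sq_nonneg (z.re - z.im), sq_nonneg z.re, sq_nonneg z.im]

lemma norm_eq_zero {z : Eisenstein} : norm z = 0 ↔ z = 0 := by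
  constructor
  · intro h
    rw [norm_eq] at h
    have h1 : z.re = 0 := by
      nlinarith [sq_nonneg (2 * z.im - z.re), sq_nonneg z.re, sq_nonneg z.im]
    have h2 : z.im = 0 := by
      nlinarith [sq_nonneg (2 * z.re - z.im), sq_nonneg z.re, sq_nonneg z.im]
    ext <;> simp [h1, h2]
  · rintro rfl; simp

lemma norm_pos {z : Eisenstein} (hz : z ≠ 0) : 0 < norm z :=
  lt_of_le_of_ne (norm_nonneg z) fun h => hz (norm_eq_zero.1 h.symm)

instance : NoZeroDivisors Eisenstein where
  eq_zero_or_eq_zero_of_mul_eq_zero {x y} h := by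
    have : norm x * norm y = 0 := by rw [← map_mul, h, QuadraticAlgebra.norm_zero]
    simpa only [mul_eq_zero, norm_eq_zero] using this

instance : IsDomain Eisenstein := NoZeroDivisors.to_isDomain _

lemma coe_norm (z : Eisenstein) : ((norm z : ℤ) : Eisenstein) = z * star z := by
  rw [← algebraMap_norm_eq_mul_star]; rfl

/-- Every quotient can be rounded so that the remainder has smaller norm. -/
lemma exists_norm_sub_mul_lt (x y : Eisenstein) (hy : y ≠ 0) :
    ∃ q : Eisenstein, norm (x - y * q) < norm y := by
  have hN := norm_pos hy
  set w := x * star y with hw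
  set N := norm y with hNdef
  have hNQ : (0 : ℚ) < N := by exact_mod_cast hN
  set s := round ((w.re : ℚ) / N)
  set t := round ((w.im : ℚ) / N)
  refine ⟨⟨s, t⟩, ?_⟩
  have hs := abs_le.1 (abs_sub_round ((w.re : ℚ) / N))
  have ht := abs_le.1 (abs_sub_round ((w.im : ℚ) / N))
  have hs' : |w.re - N * s| * 2 ≤ N := by
    have h : |((w.re : ℚ) - N * s)| ≤ N / 2 := by
      have : (w.re : ℚ) - N * s = N * ((w.re : ℚ) / N - s) := by field_simp
      rw [this, abs_mul, abs_of_pos hNQ]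
      have := abs_sub_round ((w.re : ℚ) / N)
      nlinarith
    have h2 : |((w.re : ℚ) - N * s)| * 2 ≤ N := by linarith
    exact_mod_cast h2
  have ht' : |w.im - N * t| * 2 ≤ N := by
    have h : |((w.im : ℚ) - N * t)| ≤ N / 2 := by
      have : (w.im : ℚ) - N * t = N * ((w.im : ℚ) / N - t) := by field_simp
      rw [this, abs_mul, abs_of_pos hNQ]
      have := abs_sub_round ((w.im : ℚ) / N)
      nlinarith
    have h2 : |((w.im : ℚ) - N * t)| * 2 ≤ N := by linarith
    exact_mod_cast h2
  have key : norm (x - y * ⟨s, t⟩) * N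
      = (w.re - N * s) ^ 2 - (w.re - N * s) * (w.im - N * t) + (w.im - N * t) ^ 2 := by
    have h1 : (x - y * ⟨s, t⟩) * star y = w - (N : Eisenstein) * ⟨s, t⟩ := by
      rw [hNdef, coe_norm, hw]; ring
    rw [← norm_star y] at hNdef
    rw [hNdef, ← map_mul, h1, norm_eq]
    simp [← hNdef]
  set u := w.re - N * s
  set v := w.im - N * t
  have hu := abs_le.1 (by linarith [abs_mul_abs_self u] : |u| ≤ |u|)
  have : u ^ 2 - u * v + v ^ 2 < N * N := by
    have h1 : u ^ 2 = |u| ^ 2 := (sq_abs u).symm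
    have h2 : v ^ 2 = |v| ^ 2 := (sq_abs v).symm
    have h3 : -(u * v) ≤ |u| * |v| := by rw [← abs_mul]; exact neg_le_abs _
    nlinarith [abs_nonneg u, abs_nonneg v]
  nlinarith

noncomputable instance : EuclideanDomain Eisenstein where
  quotient x y := open Classical in
    if hy : y = 0 then 0 else (exists_norm_sub_mul_lt x y hy).choose
  quotient_zero x := by simp
  remainder x y := open Classical in
    x - y * (if hy : y = 0 then 0 else (exists_norm_sub_mul_lt x y hy).choose)
  quotient_mul_add_remainder_eq x y := by ring
  r x y := (norm x).natAbs < (norm y).natAbs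
  r_wellFounded := (measure fun x : Eisenstein => (norm x).natAbs).wf
  remainder_lt x y hy := by
    have := (exists_norm_sub_mul_lt x y hy).choose_spec
    simp only [hy, dite_false]
    exact Int.natAbs_lt_natAbs_of_nonneg_of_lt (norm_nonneg _) this
  mul_left_not_lt x y hy := by
    rw [map_mul, Int.natAbs_mul, not_lt]
    exact Nat.le_mul_of_pos_right _ (Int.natAbs_pos.2 (norm_pos hy).ne')

end Eisenstein

/-- If `p` is prime, `p ∣ a` and `a * star a` is the cube of a self-adjoint element, then `a` is
divisible by an element of the form `p³`, `p² * star p` or `p * (star p)²`. -/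
lemma Prime.dvd_of_mul_star_eq_cube {R : Type*} [CommRing R] [IsDomain R] [StarRing R]
    {p a n : R} (hp : Prime p) (ha : p ∣ a) (hn : star n = n) (h : a * star a = n ^ 3) :
    p ^ 3 ∣ a ∨ p ^ 2 * star p ∣ a ∨ p * star p ^ 2 ∣ a := by
  have hp0 := hp.ne_zero
  have hs : Prime (star p) := by
    have := (MulEquiv.prime_iff (starMulAut (R := R))).2 hp
    simpa using this
  have hs0 := hs.ne_zero
  have dvd_star : ∀ {x y : R}, x ∣ star y → star x ∣ y := by
    rintro x y ⟨z, hz⟩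
    exact ⟨star z, by rw [← star_star y, hz, star_mul']⟩
  have hpn : p ∣ n := hp.dvd_of_dvd_pow (h ▸ ha.mul_right _)
  have hsn : star p ∣ n := by
    apply dvd_star; rwa [hn]
  obtain ⟨a₁, rfl⟩ := ha
  by_cases hass : star p ∣ p
  · obtain ⟨u, hu⟩ := hs.associated_of_dvd hp hass
    have hu' : star p = p * ((u⁻¹ : Rˣ) : R) := by
      rw [Units.eq_mul_inv_iff_mul_eq]; exact hu
    set v : R := ((u⁻¹ : Rˣ) : R) with hv
    have hvu : ¬ p ∣ v := fun hd => hp.not_isUnit (isUnit_of_dvd_unit hd (u⁻¹).isUnit)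
    have dvd_of : ∀ {x}, p ∣ star x → p ∣ x := fun hx => by
      have := dvd_star hx
      rw [hu'] at this
      exact dvd_of_mul_right_dvd this
    obtain ⟨m, rfl⟩ := hpn
    left
    rw [star_mul', hu'] at h
    have h1 : v * (a₁ * star a₁) = p * m ^ 3 := by
      apply mul_left_cancel₀ (pow_ne_zero 2 hp0); linear_combination h
    have h2 : p ∣ a₁ := by
      have : p ∣ v * (a₁ * star a₁) := h1 ▸ Dvd.intro _ rfl
      rcases hp.dvd_or_dvd this with h | h
      · exact absurd h hvu
      rcases hp.dvd_or_dvd h with h | h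
      · exact h
      · exact dvd_of h
    obtain ⟨a₂, rfl⟩ := h2
    rw [star_mul', hu'] at h1
    have h3 : v ^ 2 * (p * (a₂ * star a₂)) = m ^ 3 := by
      apply mul_left_cancel₀ hp0; linear_combination h1
    have h4 : p ∣ m := hp.dvd_of_dvd_pow (n := 3) ⟨v ^ 2 * (a₂ * star a₂), by rw [← h3]; ring⟩
    obtain ⟨k, rfl⟩ := h4
    have h5 : v ^ 2 * (a₂ * star a₂) = p * (p * k ^ 3) := by
      apply mul_left_cancel₀ hp0; linear_combination h3
    have h6 : p ∣ a₂ := by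
      have : p ∣ v ^ 2 * (a₂ * star a₂) := h5 ▸ Dvd.intro _ rfl
      rcases hp.dvd_or_dvd this with h | h
      · exact absurd (hp.dvd_of_dvd_pow h) hvu
      rcases hp.dvd_or_dvd h with h | h
      · exact h
      · exact dvd_of h
    obtain ⟨a₃, rfl⟩ := h6
    exact ⟨a₃, by ring⟩
  · obtain ⟨k, rfl⟩ := hpn
    obtain ⟨m, rfl⟩ := (hs.dvd_or_dvd hsn).resolve_left hass
    have h1 : a₁ * star a₁ = p ^ 2 * star p ^ 2 * m ^ 3 := by
      apply mul_left_cancel₀ (mul_ne_zero hp0 hs0)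
      rw [star_mul'] at h
      linear_combination h
    have h2 : p ∣ a₁ * star a₁ := h1 ▸ ⟨p * star p ^ 2 * m ^ 3, by ring⟩
    rcases hp.dvd_or_dvd h2 with ⟨a₂, rfl⟩ | h2
    · rw [star_mul'] at h1
      have h3 : a₂ * star a₂ = p * star p * m ^ 3 := by
        apply mul_left_cancel₀ (mul_ne_zero hp0 hs0)
        linear_combination h1
      have h4 : p ∣ a₂ * star a₂ := h3 ▸ ⟨star p * m ^ 3, by ring⟩
      rcases hp.dvd_or_dvd h4 with ⟨a₃, rfl⟩ | h4
      · exact Or.inl ⟨a₃, by ring⟩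
      · obtain ⟨a₃, rfl⟩ := dvd_star h4
        exact Or.inr (Or.inl ⟨a₃, by ring⟩)
    · obtain ⟨b, rfl⟩ := dvd_star h2
      rw [star_mul', star_star] at h1
      have h3 : b * star b = p * star p * m ^ 3 := by
        apply mul_left_cancel₀ (mul_ne_zero hp0 hs0)
        linear_combination h1
      have h4 : p ∣ b * star b := h3 ▸ ⟨star p * m ^ 3, by ring⟩
      rcases hp.dvd_or_dvd h4 with ⟨c, rfl⟩ | h4
      · exact Or.inr (Or.inl ⟨c, by ring⟩)
      · obtain ⟨c, rfl⟩ := dvd_star h4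
        exact Or.inr (Or.inr ⟨c, by ring⟩)

namespace Eisenstein

open QuadraticAlgebra

/-- An Eisenstein integer whose norm is a cube has the form `μ² * star μ * γ³`. -/
lemma exists_eq_of_norm_eq_cube (x : Eisenstein) (hx : x ≠ 0) (n : ℤ) (h : norm x = n ^ 3) :
    ∃ m g : Eisenstein, x = m ^ 2 * star m * g ^ 3 := by
  induction hk : (norm x).natAbs using Nat.strong_induction_on generalizing x n with
  | _ k ih =>
  by_cases hu : IsUnit x
  · refine ⟨x, 1, ?_⟩
    have h1 : norm x = 1 := by
      have := (isUnit_iff_norm_isUnit.1 hu)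
      rcases Int.isUnit_iff.1 this with h | h
      · exact h
      · have := norm_nonneg x; omega
    have h2 : x * star x = 1 := by rw [← coe_norm, h1]; rfl
    linear_combination (-x) * h2
  obtain ⟨p, hp, hpx⟩ := WfDvdMonoid.exists_irreducible_factor hu hx
  have hp := hp.prime
  have hp0 := hp.ne_zero
  have hN : 1 < norm p := by
    have h0 := norm_pos hp0
    rcases (by omega : norm p = 1 ∨ 1 < norm p) with h | h
    · exact absurd (isUnit_iff_norm_isUnit.2 (by rw [h]; exact isUnit_one)) hp.not_isUnit
    · exact h
  have hcube : x * star x = (n : Eisenstein) ^ 3 := by rw [← coe_norm, h]; push_cast; rfl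
  -- removing a factor of norm `(norm p)³`
  have step : ∀ d y : Eisenstein, norm d = norm p ^ 3 → x = d * y →
      ∃ m g : Eisenstein, y = m ^ 2 * star m * g ^ 3 := by
    intro d y hd hxy
    have hy : y ≠ 0 := by rintro rfl; simp [hxy] at hx
    have h1 : norm p ^ 3 * norm y = n ^ 3 := by rw [← h, hxy, map_mul, hd]
    have h2 : norm p ∣ n := (Int.pow_dvd_pow_iff (by norm_num)).1 (Dvd.intro _ h1)
    obtain ⟨m, rfl⟩ := h2
    have h3 : norm y = m ^ 3 := by
      apply mul_left_cancel₀ (pow_ne_zero 3 (by omega : norm p ≠ 0)); linear_combination h1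
    refine ih _ ?_ y hy m h3 rfl
    rw [← hk, hxy, map_mul, hd, Int.natAbs_mul]
    apply lt_mul_of_one_lt_left (Int.natAbs_pos.2 (norm_pos hy).ne')
    have : 1 < norm p ^ 3 := one_lt_pow₀ hN (by norm_num)
    omega
  have hstar : star (n : Eisenstein) = n := star_intCast n
  rcases hp.dvd_of_mul_star_eq_cube hpx hstar hcube with ⟨y, hy⟩ | ⟨y, hy⟩ | ⟨y, hy⟩
  · obtain ⟨m, g, rfl⟩ := step _ y (by simp) hy
    exact ⟨m, p * g, by rw [hy]; ring⟩
  · obtain ⟨m, g, rfl⟩ := step _ y (by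
      simp only [map_mul, map_pow, QuadraticAlgebra.norm_star]; ring) hy
    exact ⟨p * m, g, by rw [hy, star_mul']; ring⟩
  · obtain ⟨m, g, rfl⟩ := step _ y (by
      simp only [map_mul, map_pow, QuadraticAlgebra.norm_star]; ring) hy
    exact ⟨star p * m, g, by rw [hy, star_mul', star_star]; ring⟩

end Eisenstein

section Counting

lemma Finset.card_int_le_of_sub_le (S : Finset ℤ) {L : ℝ} (hL : 0 ≤ L)
    (h : ∀ x ∈ S, ∀ y ∈ S, ((x - y : ℤ) : ℝ) ≤ L) : (S.card : ℝ) ≤ L + 1 := by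
  rcases S.eq_empty_or_nonempty with rfl | hne
  · simp; linarith
  have hsub : S ⊆ Finset.Icc (S.min' hne) (S.max' hne) := fun x hx =>
    Finset.mem_Icc.2 ⟨S.min'_le x hx, S.le_max' x hx⟩
  have h1 := Finset.card_le_card hsub
  rw [Int.card_Icc] at h1
  have h2 := h _ (S.max'_mem hne) _ (S.min'_mem hne)
  have h3 : S.min' hne ≤ S.max' hne := S.min'_le _ (S.max'_mem hne)
  have h4 : (S.card : ℤ) ≤ S.max' hne - S.min' hne + 1 := by omega
  have h5 : (S.card : ℝ) ≤ ((S.max' hne - S.min' hne : ℤ) : ℝ) + 1 := by exact_mod_cast h4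
  linarith

lemma Finset.card_le_mul_card_image_real {α β : Type*} [DecidableEq β] (f : α → β) (s : Finset α)
    {B : ℝ} (h : ∀ b ∈ s.image f, ((s.filter (f · = b)).card : ℝ) ≤ B) :
    (s.card : ℝ) ≤ B * (s.image f).card := by
  rw [Finset.card_eq_sum_card_image f s, Nat.cast_sum, mul_comm, ← nsmul_eq_mul]
  exact Finset.sum_le_card_nsmul _ _ _ h

/-- A family of integer points with one coordinate in an interval of length `L₂` and the other,
once the first one is fixed, in an interval of length `L₁`. -/
lemma Finset.card_le_of_fiber_le {α : Type*} (S : Finset α) (f g : α → ℤ)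
    (hfg : ∀ x ∈ S, ∀ y ∈ S, f x = f y → g x = g y → x = y) {L₁ L₂ : ℝ} (hL₁ : 0 ≤ L₁)
    (hL₂ : 0 ≤ L₂)
    (h₁ : ∀ x ∈ S, ∀ y ∈ S, f x = f y → ((g x - g y : ℤ) : ℝ) ≤ L₁)
    (h₂ : ∀ x ∈ S, ∀ y ∈ S, ((f x - f y : ℤ) : ℝ) ≤ L₂) :
    (S.card : ℝ) ≤ (L₁ + 1) * (L₂ + 1) := by
  classical
  have hfib : ∀ b ∈ S.image f, ((S.filter (f · = b)).card : ℝ) ≤ L₁ + 1 := by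
    intro b _
    have : (S.filter (f · = b)).card = ((S.filter (f · = b)).image g).card := by
      rw [Finset.card_image_of_injOn]
      intro x hx y hy hxy
      simp only [Finset.coe_filter, Set.mem_ofPred_eq] at hx hy
      exact hfg x hx.1 y hy.1 (hx.2.trans hy.2.symm) hxy
    rw [this]
    apply Finset.card_int_le_of_sub_le _ hL₁
    simp only [Finset.mem_image, Finset.mem_filter]
    rintro _ ⟨x, hx, rfl⟩ _ ⟨y, hy, rfl⟩
    exact h₁ x hx.1 y hy.1 (hx.2.trans hy.2.symm)
  refine (Finset.card_le_mul_card_image_real f S hfib).trans ?_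
  apply mul_le_mul_of_nonneg_left _ (by linarith)
  apply Finset.card_int_le_of_sub_le _ hL₂
  simp only [Finset.mem_image]
  rintro _ ⟨x, hx, rfl⟩ _ ⟨y, hy, rfl⟩
  exact h₂ x hx y hy

end Counting

namespace Eisenstein

open QuadraticAlgebra

lemma abs_re_le {z : Eisenstein} {R : ℝ} (hR : 0 ≤ R) (h : ((norm z : ℤ) : ℝ) ≤ R ^ 2) :
    |(z.re : ℝ)| ≤ 2 * R := by
  rw [norm_eq] at h; push_cast at h
  apply abs_le_of_sq_le_sq _ (by linarith)
  nlinarith [sq_nonneg (2 * (z.im : ℝ) - z.re)]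

lemma abs_im_le {z : Eisenstein} {R : ℝ} (hR : 0 ≤ R) (h : ((norm z : ℤ) : ℝ) ≤ R ^ 2) :
    |(z.im : ℝ)| ≤ 2 * R := by
  rw [norm_eq] at h; push_cast at h
  apply abs_le_of_sq_le_sq _ (by linarith)
  nlinarith [sq_nonneg (2 * (z.re : ℝ) - z.im)]

lemma card_le_of_norm_le (S : Finset Eisenstein) {R : ℝ} (hR : 1 ≤ R)
    (h : ∀ z ∈ S, ((norm z : ℤ) : ℝ) ≤ R ^ 2) : (S.card : ℝ) ≤ 25 * R ^ 2 := by
  have := Finset.card_le_of_fiber_le S (fun z => z.re) (fun z => z.im)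
    (fun x _ y _ h1 h2 => QuadraticAlgebra.ext h1 h2) (L₁ := 4 * R) (L₂ := 4 * R)
    (by linarith) (by linarith)
    (fun x hx y hy _ => by
      have h1 := abs_le.1 (abs_im_le (by linarith) (h x hx))
      have h2 := abs_le.1 (abs_im_le (by linarith) (h y hy))
      push_cast; linarith)
    (fun x hx y hy => by
      have h1 := abs_le.1 (abs_re_le (by linarith) (h x hx))
      have h2 := abs_le.1 (abs_re_le (by linarith) (h y hy))
      push_cast; linarith)
  nlinarith

/-- The standard embedding of the Eisenstein integers. -/
noncomputable def toComplex (z : Eisenstein) : ℂ := ⟨z.re - z.im / 2, z.im * (√3 / 2)⟩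

lemma toComplex_mul (z w : Eisenstein) : toComplex (z * w) = toComplex z * toComplex w := by
  have h3 : √3 * √3 = 3 := by norm_num
  apply Complex.ext
  · simp [toComplex]; linear_combination (z.im * w.im / 4 : ℝ) * h3
  · simp [toComplex]; ring

lemma toComplex_one : toComplex 1 = 1 := by
  apply Complex.ext <;> simp [toComplex]

lemma toComplex_pow (z : Eisenstein) (k : ℕ) : toComplex (z ^ k) = toComplex z ^ k := by
  induction k with
  | zero => simp [toComplex_one]
  | succ k ih => rw [pow_succ, toComplex_mul, ih, pow_succ]

lemma norm_toComplex_sq (z : Eisenstein) : ‖toComplex z‖ ^ 2 = ((norm z : ℤ) : ℝ) := by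
  have h3 : √3 * √3 = 3 := by norm_num
  rw [← Complex.normSq_eq_norm_sq, Complex.normSq_apply, norm_eq]
  simp [toComplex]; linear_combination (z.im ^ 2 / 4 : ℝ) * h3

lemma norm_toComplex_pos {z : Eisenstein} (hz : z ≠ 0) : 0 < ‖toComplex z‖ := by
  have h1 := norm_toComplex_sq z
  have h2 : (0 : ℝ) < ((norm z : ℤ) : ℝ) := by exact_mod_cast norm_pos hz
  rw [← h1] at h2
  exact (_root_.norm_nonneg _).lt_of_ne' fun h0 => by simp [h0] at h2

/-- The number of lattice points of bounded size in a strip. -/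
lemma card_le_of_strip (S : Finset Eisenstein) {R w : ℝ} (hR : 1 ≤ R) (hw : 0 ≤ w)
    (h : ∀ z ∈ S, ‖toComplex z‖ ≤ R) (u : ℂ) (hu : ‖u‖ = 1)
    (hS : ∀ z ∈ S, |(u * toComplex z).im| ≤ w) : (S.card : ℝ) ≤ 5 * R * (4 * w + 1) := by
  replace h : ∀ z ∈ S, ((norm z : ℤ) : ℝ) ≤ R ^ 2 := fun z hz => by
    rw [← norm_toComplex_sq]; exact pow_le_pow_left₀ (_root_.norm_nonneg _) (h z hz) 2
  have h3 : √3 * √3 = 3 := by norm_num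
  set p := u.im with hp
  set q := u.re * (√3 / 2) - u.im / 2 with hq
  have him : ∀ z : Eisenstein, (u * toComplex z).im = p * z.re + q * z.im := by
    intro z; simp [toComplex, hp, hq]; ring
  have hpq : 1 / 2 ≤ |p| ∨ 1 / 2 ≤ |q| := by
    by_contra! hcon
    have h1 : u.re ^ 2 + u.im ^ 2 = 1 := by
      have := Complex.normSq_eq_norm_sq u
      rw [hu, Complex.normSq_apply] at this; linarith
    have h2 : p ^ 2 < 1 / 4 := by nlinarith [abs_nonneg p, sq_abs p]
    have h4 : q ^ 2 < 1 / 4 := by nlinarith [abs_nonneg q, sq_abs q]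
    have h5 : (q + p / 2) ^ 2 = 3 / 4 * u.re ^ 2 := by
      rw [hq]; linear_combination (u.re ^ 2 / 4) * h3
    nlinarith [sq_nonneg (q - p / 2), sq_nonneg (q - p)]
  have hbd : ∀ t : ℝ, ∀ r : ℝ, 1 / 2 ≤ |r| → |r * t| ≤ 2 * w → t ≤ 4 * w := by
    intro t r hr ht
    rw [abs_mul] at ht
    nlinarith [le_abs_self t, abs_nonneg t]
  rcases hpq with hpq | hpq
  · have := Finset.card_le_of_fiber_le S (fun z => z.im) (fun z => z.re)
      (fun x _ y _ h1 h2 => QuadraticAlgebra.ext h2 h1) (L₁ := 4 * w) (L₂ := 4 * R)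
      (by linarith) (by linarith)
      (fun x hx y hy hxy => by
        apply hbd _ p hpq
        have h1 := abs_le.1 (hS x hx)
        have h2 := abs_le.1 (hS y hy)
        rw [him] at h1 h2
        rw [hxy] at h1
        push_cast
        rw [abs_le]; constructor <;> nlinarith)
      (fun x hx y hy => by
        have h1 := abs_le.1 (abs_im_le (by linarith) (h x hx))
        have h2 := abs_le.1 (abs_im_le (by linarith) (h y hy))
        push_cast; linarith)
    nlinarith
  · have := Finset.card_le_of_fiber_le S (fun z => z.re) (fun z => z.im)
      (fun x _ y _ h1 h2 => QuadraticAlgebra.ext h1 h2) (L₁ := 4 * w) (L₂ := 4 * R)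
      (by linarith) (by linarith)
      (fun x hx y hy hxy => by
        apply hbd _ q hpq
        have h1 := abs_le.1 (hS x hx)
        have h2 := abs_le.1 (hS y hy)
        rw [him] at h1 h2
        rw [hxy] at h1
        push_cast
        rw [abs_le]; constructor <;> nlinarith)
      (fun x hx y hy => by
        have h1 := abs_le.1 (abs_re_le (by linarith) (h x hx))
        have h2 := abs_le.1 (abs_re_le (by linarith) (h y hy))
        push_cast; linarith)
    nlinarith

end Eisenstein

/-- A primitive cube root of unity. -/
noncomputable def cubeRootOfUnity : ℂ := ⟨-1 / 2, √3 / 2⟩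

lemma norm_cubeRootOfUnity : ‖cubeRootOfUnity‖ = 1 := by
  have h3 : √3 * √3 = 3 := by norm_num
  have : ‖cubeRootOfUnity‖ ^ 2 = 1 := by
    rw [← Complex.normSq_eq_norm_sq, Complex.normSq_apply, cubeRootOfUnity]
    simp; linear_combination h3 / 4
  nlinarith [norm_nonneg cubeRootOfUnity]

/-- If `z³` is close to the real line, then `z` is close to one of the three lines that are mapped
to the real line by cubing. -/
lemma exists_abs_im_le_of_abs_im_cube_le {z : ℂ} {t : ℝ} (h : |(z ^ 3).im| ≤ t * ‖z‖ ^ 3) :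
    ∃ k < 3, |(cubeRootOfUnity ^ k * z).im| ≤ t * ‖z‖ := by
  have h3 : √3 * √3 = 3 := by norm_num
  rcases eq_or_ne z 0 with rfl | hz
  · exact ⟨0, by norm_num, by simp⟩
  have hpos : 0 < ‖z‖ := norm_pos_iff.2 hz
  have hn : ‖z‖ ^ 2 = z.re ^ 2 + z.im ^ 2 := by
    rw [← Complex.normSq_eq_norm_sq, Complex.normSq_apply]; ring
  set x := z.im
  set y := z.re * (√3 / 2) - z.im / 2 with hy
  set w := -(z.re * (√3 / 2)) - z.im / 2 with hw
  have e0 : (cubeRootOfUnity ^ 0 * z).im = x := by simp [x]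
  have e1 : (cubeRootOfUnity ^ 1 * z).im = y := by simp [cubeRootOfUnity, hy]; ring
  have e2 : (cubeRootOfUnity ^ 2 * z).im = w := by
    simp [cubeRootOfUnity, hw, pow_two]
    linear_combination (-z.im / 4) * h3
  have hsum : x + y + w = 0 := by simp only [x, hy, hw]; ring
  have hsq : x ^ 2 + y ^ 2 + w ^ 2 = 3 / 2 * ‖z‖ ^ 2 := by
    rw [hn]; simp only [x, hy, hw]; linear_combination (z.re ^ 2 / 2) * h3
  have hprod : (z ^ 3).im = -4 * (x * y * w) := by
    simp only [x, hy, hw, pow_succ, pow_zero, one_mul, Complex.mul_im, Complex.mul_re]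
    linear_combination (-z.im * z.re ^ 2) * h3
  have key : ∀ p q r : ℝ, p + q + r = 0 → p ^ 2 + q ^ 2 + r ^ 2 = 3 / 2 * ‖z‖ ^ 2 →
      |4 * (p * (q * r))| ≤ t * ‖z‖ ^ 3 → |p| ≤ |q| → |p| ≤ |r| → |p| ≤ t * ‖z‖ := by
    intro p q r hs hq ht h1 h2
    have h1' := sq_le_sq.2 h1
    have h2' := sq_le_sq.2 h2
    have h4 : ‖z‖ ^ 2 ≤ 4 * |q * r| := by
      have h5 : q * r = p ^ 2 - 3 / 4 * ‖z‖ ^ 2 := by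
        have : p = -(q + r) := by linarith
        subst this; linarith
      have h6 := neg_abs_le (q * r)
      nlinarith
    rw [abs_mul, abs_mul p, abs_of_pos (by norm_num : (0 : ℝ) < 4)] at ht
    have h7 : |p| * ‖z‖ ^ 2 ≤ (t * ‖z‖) * ‖z‖ ^ 2 := by
      nlinarith [abs_nonneg p]
    exact le_of_mul_le_mul_right h7 (by positivity)
  rw [hprod] at h
  have hcase : (|x| ≤ |y| ∧ |x| ≤ |w|) ∨ (|y| ≤ |x| ∧ |y| ≤ |w|) ∨ (|w| ≤ |x| ∧ |w| ≤ |y|) := by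
    rcases le_total |x| |y| with h1 | h1 <;> rcases le_total |x| |w| with h2 | h2 <;>
      rcases le_total |y| |w| with h3 | h3 <;> grind
  have habs : ∀ s : ℝ, |4 * s| = |-4 * s| := fun s => by rw [neg_mul, abs_neg]
  rcases hcase with ⟨h1, h2⟩ | ⟨h1, h2⟩ | ⟨h1, h2⟩
  · refine ⟨0, by norm_num, e0 ▸ key x y w hsum hsq ?_ h1 h2⟩
    rw [habs]; convert h using 3; ring
  · refine ⟨1, by norm_num, e1 ▸ key y x w (by linarith) (by linarith) ?_ h1 h2⟩
    rw [habs]; convert h using 3; ring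
  · refine ⟨2, by norm_num, e2 ▸ key w x y (by linarith) (by linarith) ?_ h1 h2⟩
    rw [habs]; convert h using 3; ring

namespace Eisenstein

/-- The number of `z` of bounded size for which the argument of `m * z³` is small. -/
lemma card_le_of_cube_sector (S : Finset Eisenstein) {R t : ℝ} (hR : 1 ≤ R) (ht : 0 ≤ t)
    (h : ∀ z ∈ S, ‖toComplex z‖ ≤ R) (m : Eisenstein) (hm : m ≠ 0)
    (hS : ∀ z ∈ S, |(toComplex m * toComplex z ^ 3).im| ≤ t * (‖toComplex m‖ * ‖toComplex z‖ ^ 3)) :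
    (S.card : ℝ) ≤ 15 * R * (4 * (t * R) + 1) := by
  classical
  obtain ⟨v, hv⟩ := IsAlgClosed.exists_pow_nat_eq (toComplex m) (n := 3) (by norm_num)
  have hv0 : v ≠ 0 := by
    rintro rfl
    have := norm_toComplex_pos hm
    rw [← hv] at this; simp at this
  have hvn : 0 < ‖v‖ := norm_pos_iff.2 hv0
  set u : ℂ := v / ‖v‖ with hu
  have hun : ‖u‖ = 1 := by rw [hu, norm_div, Complex.norm_real, norm_norm, div_self hvn.ne']
  have hsub : S ⊆ (Finset.range 3).biUnion fun k =>
      S.filter fun z => |(cubeRootOfUnity ^ k * u * toComplex z).im| ≤ t * R := by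
    intro z hz
    have h1 : |((v * toComplex z) ^ 3).im| ≤ t * ‖v * toComplex z‖ ^ 3 := by
      rw [mul_pow, hv, norm_mul, mul_pow, ← norm_pow v, hv]; exact hS z hz
    obtain ⟨k, hk, h2⟩ := exists_abs_im_le_of_abs_im_cube_le h1
    rw [Finset.mem_biUnion]
    refine ⟨k, Finset.mem_range.2 hk, Finset.mem_filter.2 ⟨hz, ?_⟩⟩
    have h3 : cubeRootOfUnity ^ k * (v * toComplex z)
        = ((‖v‖ : ℝ) : ℂ) * (cubeRootOfUnity ^ k * u * toComplex z) := by
      have : ((‖v‖ : ℝ) : ℂ) ≠ 0 := by exact_mod_cast hvn.ne'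
      rw [hu]; field_simp
    rw [h3, Complex.im_ofReal_mul, abs_mul, abs_of_pos hvn,
      norm_mul] at h2
    have h4 := h z hz
    have h5 : t * ‖toComplex z‖ ≤ t * R := mul_le_mul_of_nonneg_left h4 ht
    have h6 : ‖v‖ * |(cubeRootOfUnity ^ k * u * toComplex z).im| ≤ ‖v‖ * (t * ‖toComplex z‖) := by
      linarith
    exact (le_of_mul_le_mul_left h6 hvn).trans h5
  have h1 := (Finset.card_le_card hsub).trans Finset.card_biUnion_le
  have h2 : ∀ k ∈ Finset.range 3, ((S.filter fun z =>
      |(cubeRootOfUnity ^ k * u * toComplex z).im| ≤ t * R).card : ℝ) ≤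
        5 * R * (4 * (t * R) + 1) := by
    intro k _
    refine card_le_of_strip _ hR (by positivity) (fun z hz => h z (Finset.mem_filter.1 hz).1)
      (cubeRootOfUnity ^ k * u) ?_ (fun z hz => (Finset.mem_filter.1 hz).2)
    rw [norm_mul, norm_pow, norm_cubeRootOfUnity, hun]; simp
  have h3 := Finset.sum_le_sum h2
  rw [Finset.sum_const, Finset.card_range, nsmul_eq_mul] at h3
  have h4 : (S.card : ℝ) ≤ ∑ k ∈ Finset.range 3, ((S.filter fun z =>
      |(cubeRootOfUnity ^ k * u * toComplex z).im| ≤ t * R).card : ℝ) := by exact_mod_cast h1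
  push_cast at h3
  linarith

/-- The number of `m` of bounded size for which the argument of `m * z³` is small. -/
lemma card_le_of_sector (S : Finset Eisenstein) {R t : ℝ} (hR : 1 ≤ R) (ht : 0 ≤ t)
    (h : ∀ m ∈ S, ‖toComplex m‖ ≤ R) (z : Eisenstein) (hz : z ≠ 0)
    (hS : ∀ m ∈ S, |(toComplex m * toComplex z ^ 3).im| ≤ t * (‖toComplex m‖ * ‖toComplex z‖ ^ 3)) :
    (S.card : ℝ) ≤ 5 * R * (4 * (t * R) + 1) := by
  have hz0 := norm_toComplex_pos hz
  set r : ℝ := ‖toComplex z‖ ^ 3 with hr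
  have hr0 : 0 < r := by positivity
  refine card_le_of_strip S hR (by positivity) h (toComplex z ^ 3 / (r : ℝ)) ?_ fun m hm => ?_
  · rw [norm_div, norm_pow, Complex.norm_real, Real.norm_of_nonneg hr0.le, ← hr, div_self hr0.ne']
  have h3 : toComplex m * toComplex z ^ 3
      = (r : ℂ) * (toComplex z ^ 3 / (r : ℂ) * toComplex m) := by
    have : (r : ℂ) ≠ 0 := by exact_mod_cast hr0.ne'
    field_simp
  have h2 := hS m hm
  rw [h3, Complex.im_ofReal_mul, abs_mul, abs_of_pos hr0] at h2
  have h5 : t * ‖toComplex m‖ ≤ t * R := mul_le_mul_of_nonneg_left (h m hm) ht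
  have h6 : r * |(toComplex z ^ 3 / (r : ℂ) * toComplex m).im| ≤ r * (t * ‖toComplex m‖) := by
    linarith
  exact (le_of_mul_le_mul_left h6 hr0).trans h5

end Eisenstein

namespace Eisenstein

open QuadraticAlgebra

/-- A cubic without integer roots whose discriminant is a square is parametrised by its quadratic
coefficient and a pair of Eisenstein integers. -/
lemma exists_param {a b c : ℤ} (hroot : ∀ r : ℤ, r ^ 3 + a * r ^ 2 + b * r + c ≠ 0)
    (hsq : ∃ y : ℤ, cubicDisc a b c = y ^ 2) :
    ∃ mg : Eisenstein × Eisenstein, mg.1 ≠ 0 ∧ mg.2 ≠ 0 ∧ norm mg.1 * norm mg.2 = a ^ 2 - 3 * b ∧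
      (mg.1 ^ 2 * star mg.1 * mg.2 ^ 3).im ^ 2 = 9 * cubicDisc a b c ∧
      2 * (mg.1 ^ 2 * star mg.1 * mg.2 ^ 3).re - (mg.1 ^ 2 * star mg.1 * mg.2 ^ 3).im =
        2 * a ^ 3 - 9 * a * b + 27 * c := by
  obtain ⟨y, hy⟩ := hsq
  set I := a ^ 2 - 3 * b with hI
  set J := 2 * a ^ 3 - 9 * a * b + 27 * c with hJ
  have h4 : 4 * I ^ 3 = J ^ 2 + 27 * y ^ 2 := by
    rw [← hy, hI, hJ, cubicDisc]; ring
  have hI0 : I ≠ 0 := by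
    intro h0
    rw [h0] at h4
    have hJ0 : J = 0 := by nlinarith [sq_nonneg J, sq_nonneg y]
    have h3 : (3 : ℤ) ∣ a := Int.prime_three.dvd_of_dvd_pow (n := 2) ⟨b, by linarith⟩
    obtain ⟨k, rfl⟩ := h3
    apply hroot (-k)
    have hb : b = 3 * k ^ 2 := by linarith
    subst hb
    linarith
  have hpar : ∃ p : ℤ, J + 3 * y = 2 * p := by
    have h1 : Even (J ^ 2 + 27 * y ^ 2) := ⟨2 * I ^ 3, by linarith⟩
    have h2 : Even (J + 3 * y) := by
      rw [Int.even_add, Int.even_pow' two_ne_zero, Int.even_mul, Int.even_pow' two_ne_zero] at h1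
      rw [Int.even_add, Int.even_mul]
      have e1 : ¬ Even (27 : ℤ) := by decide
      have e2 : ¬ Even (3 : ℤ) := by decide
      tauto
    obtain ⟨p, hp⟩ := h2
    exact ⟨p, by linarith⟩
  obtain ⟨p, hp⟩ := hpar
  have hnorm : norm (⟨p, 3 * y⟩ : Eisenstein) = I ^ 3 := by
    rw [norm_eq]
    have : (2 * p - 3 * y) ^ 2 = J ^ 2 := by rw [← hp]; ring
    linarith [this, h4]
  have hx0 : (⟨p, 3 * y⟩ : Eisenstein) ≠ 0 := by
    rw [Ne, ← norm_eq_zero, hnorm]; exact pow_ne_zero 3 hI0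
  obtain ⟨m, g, hmg⟩ := exists_eq_of_norm_eq_cube _ hx0 I hnorm
  refine ⟨(m, g), ?_, ?_, ?_, ?_, ?_⟩
  · rintro rfl; simp at hmg; exact hx0 hmg
  · rintro rfl; simp at hmg; exact hx0 hmg
  · have : (norm m * norm g) ^ 3 = I ^ 3 := by
      rw [← hnorm, hmg]
      simp only [map_mul, map_pow, QuadraticAlgebra.norm_star]; ring
    exact (Odd.strictMono_pow (by decide : Odd 3)).injective this
  · simp only; rw [← hmg, hy]; ring
  · simp only; rw [← hmg]; simp only; linarith

/-- The cubics are determined by their parameters. -/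
lemma eq_of_param {N J a b c a' b' c' : ℤ} (ha : a = a') (h1 : N = a ^ 2 - 3 * b)
    (h1' : N = a' ^ 2 - 3 * b') (h2 : J = 2 * a ^ 3 - 9 * a * b + 27 * c)
    (h2' : J = 2 * a' ^ 3 - 9 * a' * b' + 27 * c') : (a, b, c) = (a', b', c') := by
  subst ha
  have hb : b = b' := by linarith
  subst hb
  have hc : c = c' := by linarith
  rw [hc]

lemma cubicDisc_le {a b c : ℤ} {n : ℝ} (hn : 1 ≤ n) (ha : |(a : ℝ)| ≤ n) (hb : |(b : ℝ)| ≤ n)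
    (hc : |(c : ℝ)| ≤ n) {I : ℝ} (hI : I = a ^ 2 - 3 * b) (hIn : 12 * n ≤ I) :
    (cubicDisc a b c : ℝ) ≤ 32 * (I * n ^ 2) := by
  have hab := abs_nonneg (a : ℝ)
  have hbb := abs_nonneg (b : ℝ)
  have hcb := abs_nonneg (c : ℝ)
  have hb' := abs_le.1 hb
  have ha2 : (a : ℝ) ^ 2 ≤ 5 / 4 * I := by linarith
  have hsa : |(a : ℝ)| ^ 2 = (a : ℝ) ^ 2 := sq_abs _
  have ha1 : |(a : ℝ)| ≤ (a : ℝ) ^ 2 := by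
    rw [← hsa]
    have : |a| ≤ |a| ^ 2 := by
      rcases eq_or_ne a 0 with rfl | h
      · simp
      · exact le_self_pow₀ (Int.one_le_abs h) two_ne_zero
    have h2 : ((|a| : ℤ) : ℝ) ≤ ((|a| ^ 2 : ℤ) : ℝ) := by exact_mod_cast this
    simpa using h2
  have t1 : (a : ℝ) ^ 2 * b ^ 2 ≤ a ^ 2 * n ^ 2 := by
    apply mul_le_mul_of_nonneg_left _ (sq_nonneg _)
    rw [← sq_abs (b : ℝ)]; exact pow_le_pow_left₀ hbb hb 2
  have t2 : -(b : ℝ) ^ 3 ≤ n ^ 3 := by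
    calc -(b : ℝ) ^ 3 ≤ |(b : ℝ) ^ 3| := neg_le_abs _
      _ = |(b : ℝ)| ^ 3 := abs_pow _ _
      _ ≤ n ^ 3 := pow_le_pow_left₀ hbb hb 3
  have t3 : -((a : ℝ) ^ 3 * c) ≤ a ^ 2 * n ^ 2 := by
    calc -((a : ℝ) ^ 3 * c) ≤ |(a : ℝ) ^ 3 * c| := neg_le_abs _
      _ = |(a : ℝ)| ^ 2 * (|(a : ℝ)| * |(c : ℝ)|) := by rw [abs_mul, abs_pow]; ring
      _ ≤ |(a : ℝ)| ^ 2 * (n * n) := by gcongr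
      _ = a ^ 2 * n ^ 2 := by rw [hsa]; ring
  have t4 : (a : ℝ) * b * c ≤ a ^ 2 * n ^ 2 := by
    calc (a : ℝ) * b * c ≤ |(a : ℝ) * b * c| := le_abs_self _
      _ = |(a : ℝ)| * (|(b : ℝ)| * |(c : ℝ)|) := by rw [abs_mul, abs_mul]; ring
      _ ≤ a ^ 2 * (n * n) := by gcongr
      _ = a ^ 2 * n ^ 2 := by ring
  have t5 : (a : ℝ) ^ 2 * n ^ 2 ≤ 5 / 4 * I * n ^ 2 :=
    mul_le_mul_of_nonneg_right ha2 (sq_nonneg _)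
  have t6 : n ^ 3 ≤ I * n ^ 2 / 12 := by nlinarith [sq_nonneg n]
  rw [cubicDisc]; push_cast
  nlinarith [sq_nonneg (c : ℝ)]

/-- The argument of `m * g³` is small. -/
lemma abs_im_le_of_param {m g : Eisenstein} (hm : m ≠ 0) {a b c : ℤ} {n A : ℝ}
    (hn : 1 ≤ n) (ha : |(a : ℝ)| ≤ n) (hb : |(b : ℝ)| ≤ n) (hc : |(c : ℝ)| ≤ n)
    (hI : norm m * norm g = a ^ 2 - 3 * b)
    (him : (m ^ 2 * star m * g ^ 3).im ^ 2 = 9 * cubicDisc a b c)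
    (hA : 0 < A) (hAn : 12 * n ≤ A ^ 2) (hAI : A ^ 2 ≤ ((norm m * norm g : ℤ) : ℝ)) :
    |(toComplex m * toComplex g ^ 3).im| ≤
      30 * n / A ^ 2 * (‖toComplex m‖ * ‖toComplex g‖ ^ 3) := by
  have h3 : √3 ^ 2 = 3 := by norm_num
  set x := ‖toComplex m‖ with hx
  set y := ‖toComplex g‖ with hy
  have hx0 : 0 < x := norm_toComplex_pos hm
  have hy0 : 0 ≤ y := _root_.norm_nonneg _
  have hxy : ((norm m * norm g : ℤ) : ℝ) = x ^ 2 * y ^ 2 := by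
    rw [hx, hy, norm_toComplex_sq, norm_toComplex_sq]; push_cast; ring
  rw [hxy] at hAI
  have hI' : x ^ 2 * y ^ 2 = (a : ℝ) ^ 2 - 3 * b := by rw [← hxy, hI]; push_cast; ring
  have hd := cubicDisc_le hn ha hb hc hI' (hAn.trans hAI)
  have e1 : m ^ 2 * star m * g ^ 3 = ((norm m : ℤ) : Eisenstein) * (m * g ^ 3) := by
    rw [coe_norm]; ring
  have e2 : (m ^ 2 * star m * g ^ 3).im = norm m * (m * g ^ 3).im := by rw [e1]; simp
  have e3 : (toComplex m * toComplex g ^ 3).im = (m * g ^ 3).im * (√3 / 2) := by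
    rw [← toComplex_pow, ← toComplex_mul]; rfl
  have him' : (x ^ 2 * (m * g ^ 3).im) ^ 2 = 9 * (cubicDisc a b c : ℝ) := by
    rw [hx, norm_toComplex_sq]; rw [e2] at him; exact_mod_cast him
  set q : ℝ := ((m * g ^ 3).im : ℝ)
  have h5 : (x ^ 2 * (q * (√3 / 2))) ^ 2 ≤ (30 * n * (x * y)) ^ 2 := by
    have : (x ^ 2 * (q * (√3 / 2))) ^ 2 = 3 / 4 * (x ^ 2 * q) ^ 2 := by
      linear_combination (x ^ 4 * q ^ 2 / 4) * h3
    rw [this, him']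
    have : (30 * n * (x * y)) ^ 2 = 900 * (x ^ 2 * y ^ 2 * n ^ 2) := by ring
    rw [this]
    nlinarith [sq_nonneg (x * y * n)]
  have h6 := abs_le_of_sq_le_sq h5 (by positivity)
  rw [e3]
  rw [abs_mul, abs_of_nonneg (by positivity : 0 ≤ x ^ 2)] at h6
  rw [div_mul_eq_mul_div, le_div_iff₀ (by positivity)]
  have h7 : |q * (√3 / 2)| * A ^ 2 ≤ |q * (√3 / 2)| * (x ^ 2 * y ^ 2) :=
    mul_le_mul_of_nonneg_left hAI (abs_nonneg _)
  have h8 : x ^ 2 * |q * (√3 / 2)| * y ^ 2 ≤ 30 * n * (x * y) * y ^ 2 :=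
    mul_le_mul_of_nonneg_right h6 (sq_nonneg _)
  calc |q * (√3 / 2)| * A ^ 2 ≤ |q * (√3 / 2)| * (x ^ 2 * y ^ 2) := h7
    _ = x ^ 2 * |q * (√3 / 2)| * y ^ 2 := by ring
    _ ≤ 30 * n * (x * y) * y ^ 2 := h8
    _ = 30 * n * (x * y ^ 3) := by ring

/-- The number of pairs in a dyadic box for which the argument of `m * g³` is small. -/
lemma card_pairs_le (P : Finset (Eisenstein × Eisenstein)) {M G t : ℝ} (hM : 1 ≤ M) (hG : 1 ≤ G)
    (ht : 0 ≤ t) (h₁ : ∀ p ∈ P, p.1 ≠ 0 ∧ ‖toComplex p.1‖ ≤ 2 * M)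
    (h₂ : ∀ p ∈ P, p.2 ≠ 0 ∧ ‖toComplex p.2‖ ≤ 2 * G)
    (hP : ∀ p ∈ P, |(toComplex p.1 * toComplex p.2 ^ 3).im| ≤
      t * (‖toComplex p.1‖ * ‖toComplex p.2‖ ^ 3)) :
    (P.card : ℝ) ≤ 3000 * (8 * t * (M * G) ^ 2 + M * G * √(M * G)) := by
  classical
  have hM0 : 0 < M := by linarith
  have hG0 : 0 < G := by linarith
  have hbox : ∀ (f : Eisenstein × Eisenstein → Eisenstein) (R : ℝ), 1 ≤ R →
      (∀ p ∈ P, ‖toComplex (f p)‖ ≤ 2 * R) → ((P.image f).card : ℝ) ≤ 100 * R ^ 2 := by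
    intro f R hR h
    have := card_le_of_norm_le (P.image f) (R := 2 * R) (by linarith) (by
      simp only [Finset.mem_image]
      rintro _ ⟨p, hp, rfl⟩
      rw [← norm_toComplex_sq]
      exact pow_le_pow_left₀ (_root_.norm_nonneg _) (h p hp) 2)
    linarith
  rcases le_total M G with hMG | hMG
  · have hfib : ∀ b ∈ P.image Prod.fst, ((P.filter (Prod.fst · = b)).card : ℝ) ≤
        30 * G * (8 * (t * G) + 1) := by
      intro b hb
      obtain ⟨p₀, hp₀, rfl⟩ := Finset.mem_image.1 hb
      have hc : (P.filter (Prod.fst · = p₀.1)).card =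
          ((P.filter (Prod.fst · = p₀.1)).image Prod.snd).card := by
        rw [Finset.card_image_of_injOn]
        intro x hx y hy hxy
        simp only [Finset.coe_filter, Set.mem_ofPred_eq] at hx hy
        exact Prod.ext (hx.2.trans hy.2.symm) hxy
      rw [hc]
      have := card_le_of_cube_sector ((P.filter (Prod.fst · = p₀.1)).image Prod.snd) (R := 2 * G)
        (t := t) (by linarith) ht (by
          simp only [Finset.mem_image, Finset.mem_filter]
          rintro _ ⟨p, ⟨hp, _⟩, rfl⟩
          exact (h₂ p hp).2) p₀.1 (h₁ p₀ hp₀).1 (by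
          simp only [Finset.mem_image, Finset.mem_filter]
          rintro _ ⟨p, ⟨hp, h⟩, rfl⟩
          rw [← h]; exact hP p hp)
      linarith
    have h := Finset.card_le_mul_card_image_real Prod.fst P hfib
    have hb := hbox Prod.fst M hM fun p hp => (h₁ p hp).2
    have hs : M ≤ √(M * G) := Real.le_sqrt_of_sq_le (by nlinarith)
    calc (P.card : ℝ) ≤ 30 * G * (8 * (t * G) + 1) * (100 * M ^ 2) := by
          refine h.trans (mul_le_mul_of_nonneg_left hb (by positivity))
      _ = 3000 * (8 * t * (M * G) ^ 2 + M * G * M) := by ring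
      _ ≤ _ := by gcongr
  · have hfib : ∀ b ∈ P.image Prod.snd, ((P.filter (Prod.snd · = b)).card : ℝ) ≤
        30 * M * (8 * (t * M) + 1) := by
      intro b hb
      obtain ⟨p₀, hp₀, rfl⟩ := Finset.mem_image.1 hb
      have hc : (P.filter (Prod.snd · = p₀.2)).card =
          ((P.filter (Prod.snd · = p₀.2)).image Prod.fst).card := by
        rw [Finset.card_image_of_injOn]
        intro x hx y hy hxy
        simp only [Finset.coe_filter, Set.mem_ofPred_eq] at hx hy
        exact Prod.ext hxy (hx.2.trans hy.2.symm)
      rw [hc]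
      have := card_le_of_sector ((P.filter (Prod.snd · = p₀.2)).image Prod.fst) (R := 2 * M)
        (t := t) (by linarith) ht (by
          simp only [Finset.mem_image, Finset.mem_filter]
          rintro _ ⟨p, ⟨hp, _⟩, rfl⟩
          exact (h₁ p hp).2) p₀.2 (h₂ p₀ hp₀).1 (by
          simp only [Finset.mem_image, Finset.mem_filter]
          rintro _ ⟨p, ⟨hp, h⟩, rfl⟩
          rw [← h]; exact hP p hp)
      have hp : 0 ≤ M * (8 * (t * M) + 1) := by positivity
      linarith
    have h := Finset.card_le_mul_card_image_real Prod.snd P hfib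
    have hb := hbox Prod.snd G hG fun p hp => (h₂ p hp).2
    have hs : G ≤ √(M * G) := Real.le_sqrt_of_sq_le (by nlinarith)
    calc (P.card : ℝ) ≤ 30 * M * (8 * (t * M) + 1) * (100 * G ^ 2) := by
          refine h.trans (mul_le_mul_of_nonneg_left hb (by positivity))
      _ = 3000 * (8 * t * (M * G) ^ 2 + M * G * G) := by ring
      _ ≤ _ := by gcongr

/-- The total number of pairs in a dyadic box. -/
lemma card_pairs_le_of_norm_le (P : Finset (Eisenstein × Eisenstein)) {M G : ℝ} (hM : 1 ≤ M)
    (hG : 1 ≤ G) (h₁ : ∀ p ∈ P, ‖toComplex p.1‖ ≤ 2 * M)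
    (h₂ : ∀ p ∈ P, ‖toComplex p.2‖ ≤ 2 * G) :
    (P.card : ℝ) ≤ 10000 * (M * G) ^ 2 := by
  classical
  have hbox : ∀ (f : Eisenstein × Eisenstein → Eisenstein) (R : ℝ), 1 ≤ R →
      (∀ p ∈ P, ‖toComplex (f p)‖ ≤ 2 * R) → ((P.image f).card : ℝ) ≤ 100 * R ^ 2 := by
    intro f R hR h
    have := card_le_of_norm_le (P.image f) (R := 2 * R) (by linarith) (by
      simp only [Finset.mem_image]
      rintro _ ⟨p, hp, rfl⟩
      rw [← norm_toComplex_sq]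
      exact pow_le_pow_left₀ (_root_.norm_nonneg _) (h p hp) 2)
    linarith
  have hsub : P ⊆ P.image Prod.fst ×ˢ P.image Prod.snd := fun p hp =>
    Finset.mem_product.2 ⟨Finset.mem_image_of_mem _ hp, Finset.mem_image_of_mem _ hp⟩
  have h := Finset.card_le_card hsub
  rw [Finset.card_product] at h
  have h' : (P.card : ℝ) ≤ ((P.image Prod.fst).card : ℝ) * (P.image Prod.snd).card := by
    exact_mod_cast h
  calc (P.card : ℝ) ≤ _ := h'
    _ ≤ (100 * M ^ 2) * (100 * G ^ 2) := by
        gcongr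
        · exact hbox _ _ hM h₁
        · exact hbox _ _ hG h₂
    _ = _ := by ring

end Eisenstein

namespace Eisenstein

open QuadraticAlgebra

lemma card_le_of_abs_sq_sub_le (S : Finset ℤ) {I n A : ℝ} (hA : 0 < A) (hAn : 12 * n ≤ A ^ 2)
    (hn : 0 < n) (hAI : A ^ 2 ≤ I) (h : ∀ x ∈ S, |(x : ℝ) ^ 2 - I| ≤ 3 * n) :
    (S.card : ℝ) ≤ 2 * (4 * n / A + 1) := by
  have key : ∀ x y : ℤ, |(x : ℝ) ^ 2 - I| ≤ 3 * n → |(y : ℝ) ^ 2 - I| ≤ 3 * n → (0 : ℝ) ≤ x →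
      (0 : ℝ) ≤ y → (x : ℝ) - y ≤ 4 * n / A := by
    intro x y hx hy hx0 hy0
    have hx' := abs_le.1 hx
    have hy' := abs_le.1 hy
    have h1 : 8 / 10 * A ≤ x := abs_le_of_sq_le_sq' (by nlinarith) hx0 |>.2
    have h2 : 8 / 10 * A ≤ y := abs_le_of_sq_le_sq' (by nlinarith) hy0 |>.2
    rw [le_div_iff₀ hA]
    rcases le_or_gt ((x : ℝ) - y) 0 with h0 | h0
    · nlinarith
    · nlinarith
  have hL : 0 ≤ 4 * n / A := by positivity
  have h1 : ((S.filter (0 ≤ ·)).card : ℝ) ≤ 4 * n / A + 1 := by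
    apply Finset.card_int_le_of_sub_le _ hL
    intro x hx y hy
    rw [Finset.mem_filter] at hx hy
    push_cast
    exact key x y (h x hx.1) (h y hy.1) (by exact_mod_cast hx.2) (by exact_mod_cast hy.2)
  have h2 : ((S.filter (fun x => ¬ 0 ≤ x)).card : ℝ) ≤ 4 * n / A + 1 := by
    apply Finset.card_int_le_of_sub_le _ hL
    intro x hx y hy
    rw [Finset.mem_filter, not_le] at hx hy
    have := key (-y) (-x) (by push_cast; rw [neg_sq]; exact h y hy.1)
      (by push_cast; rw [neg_sq]; exact h x hx.1) (by exact_mod_cast (by omega : 0 ≤ -y))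
      (by exact_mod_cast (by omega : 0 ≤ -x))
    push_cast at this ⊢
    linarith
  have h3 : (S.card : ℝ) = (S.filter (0 ≤ ·)).card + (S.filter (fun x => ¬ 0 ≤ x)).card := by
    rw [← Nat.cast_add, Finset.card_filter_add_card_filter_not]
  linarith

/-- The pair `p` of Eisenstein integers parametrises the cubic with coefficients `t`, as in
`exists_param`. -/
def IsParam (t : ℤ × ℤ × ℤ) (p : Eisenstein × Eisenstein) : Prop :=
  p.1 ≠ 0 ∧ p.2 ≠ 0 ∧ norm p.1 * norm p.2 = t.1 ^ 2 - 3 * t.2.1 ∧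
    (p.1 ^ 2 * star p.1 * p.2 ^ 3).im ^ 2 = 9 * cubicDisc t.1 t.2.1 t.2.2 ∧
    2 * (p.1 ^ 2 * star p.1 * p.2 ^ 3).re - (p.1 ^ 2 * star p.1 * p.2 ^ 3).im =
      2 * t.1 ^ 3 - 9 * t.1 * t.2.1 + 27 * t.2.2

lemma IsParam.eq {t t' : ℤ × ℤ × ℤ} {p : Eisenstein × Eisenstein} (h : IsParam t p)
    (h' : IsParam t' p) (ha : t.1 = t'.1) : t = t' :=
  eq_of_param ha h.2.2.1 h'.2.2.1 h.2.2.2.2 h'.2.2.2.2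

lemma card_block_le (T : Finset (ℤ × ℤ × ℤ)) (φ : ℤ × ℤ × ℤ → Eisenstein × Eisenstein)
    {n M G : ℝ} (hn : 1 ≤ n) (hM : 1 ≤ M) (hG : 1 ≤ G)
    (hbox : ∀ t ∈ T, |(t.1 : ℝ)| ≤ n ∧ |(t.2.1 : ℝ)| ≤ n ∧ |(t.2.2 : ℝ)| ≤ n)
    (hφ : ∀ t ∈ T, IsParam t (φ t))
    (h₁ : ∀ t ∈ T, M ^ 2 ≤ (norm (φ t).1 : ℤ) ∧ ((norm (φ t).1 : ℤ) : ℝ) ≤ (2 * M) ^ 2)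
    (h₂ : ∀ t ∈ T, G ^ 2 ≤ (norm (φ t).2 : ℤ) ∧ ((norm (φ t).2 : ℤ) : ℝ) ≤ (2 * G) ^ 2) :
    (T.card : ℝ) ≤ 10000000 * (n * √n) := by
  classical
  have hs1 : 1 ≤ √n := Real.one_le_sqrt.2 hn
  have hss : √n ^ 2 = n := Real.sq_sqrt (by linarith)
  rcases T.eq_empty_or_nonempty with rfl | ⟨t₀, ht₀⟩
  · simp; positivity
  have hM0 : 0 < M := by linarith
  have hG0 : 0 < G := by linarith
  obtain ⟨A, hA⟩ : ∃ A, A = M * G := ⟨_, rfl⟩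
  have hA1 : 1 ≤ A := by nlinarith
  have hA0 : 0 < A := by linarith
  set P := T.image φ with hP
  have hAI : ∀ t ∈ T, A ^ 2 ≤ ((norm (φ t).1 * norm (φ t).2 : ℤ) : ℝ) ∧
      ((norm (φ t).1 * norm (φ t).2 : ℤ) : ℝ) ≤ 16 * A ^ 2 := by
    intro t ht
    obtain ⟨h1, h1'⟩ := h₁ t ht
    obtain ⟨h2, h2'⟩ := h₂ t ht
    push_cast
    constructor
    · calc A ^ 2 = M ^ 2 * G ^ 2 := by rw [hA]; ring
        _ ≤ _ := mul_le_mul h1 h2 (by positivity) ((by positivity : 0 ≤ M ^ 2).trans h1)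
    · calc _ ≤ (2 * M) ^ 2 * (2 * G) ^ 2 :=
            mul_le_mul h1' h2' ((by positivity : 0 ≤ G ^ 2).trans h2) (by positivity)
        _ = _ := by rw [hA]; ring
  have hsub : ∀ t ∈ T, |(t.1 : ℝ) ^ 2 - ((norm (φ t).1 * norm (φ t).2 : ℤ) : ℝ)| ≤ 3 * n := by
    intro t ht
    rw [(hφ t ht).2.2.1]
    push_cast
    have := abs_le.1 (hbox t ht).2.1
    rw [abs_le]; constructor <;> linarith
  have hPnorm : ∀ p ∈ P, (p.1 ≠ 0 ∧ ‖toComplex p.1‖ ≤ 2 * M) ∧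
      (p.2 ≠ 0 ∧ ‖toComplex p.2‖ ≤ 2 * G) := by
    simp only [hP, Finset.mem_image]
    rintro _ ⟨t, ht, rfl⟩
    refine ⟨⟨(hφ t ht).1, ?_⟩, (hφ t ht).2.1, ?_⟩
    · exact le_of_sq_le_sq (by rw [norm_toComplex_sq]; exact (h₁ t ht).2) (by positivity)
    · exact le_of_sq_le_sq (by rw [norm_toComplex_sq]; exact (h₂ t ht).2) (by positivity)
  have hfib : ∀ p, ((T.filter (φ · = p)).card) =
      ((T.filter (φ · = p)).image (fun t => t.1)).card := by
    intro p
    rw [Finset.card_image_of_injOn]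
    intro x hx y hy hxy
    simp only [Finset.coe_filter, Set.mem_ofPred_eq] at hx hy
    refine IsParam.eq (hφ x hx.1) ?_ hxy
    rw [hx.2, ← hy.2]
    exact hφ y hy.1
  have hP0 : (0 : ℝ) ≤ P.card := Nat.cast_nonneg _
  rcases lt_or_ge (A ^ 2) (12 * n) with hlt | hge
  · have hPc := card_pairs_le_of_norm_le P hM hG (fun p hp => (hPnorm p hp).1.2)
      (fun p hp => (hPnorm p hp).2.2)
    rw [← hA] at hPc
    have hT : (T.card : ℝ) ≤ (29 * √n) * P.card := by
      apply Finset.card_le_mul_card_image_real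
      intro p hp
      rw [hfib]
      refine (Finset.card_int_le_of_sub_le _ (L := 28 * √n) (by positivity) ?_).trans (by linarith)
      have hab : ∀ t ∈ T, |(t.1 : ℝ)| ≤ 14 * √n := by
        intro t ht
        have h1 := abs_le.1 (hsub t ht)
        have h2 := (hAI t ht).2
        apply abs_le_of_sq_le_sq _ (by positivity)
        rw [mul_pow, hss]
        nlinarith
      simp only [Finset.mem_image, Finset.mem_filter]
      rintro _ ⟨x, hx, rfl⟩ _ ⟨y, hy, rfl⟩
      have h1 := abs_le.1 (hab x hx.1)
      have h2 := abs_le.1 (hab y hy.1)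
      push_cast
      linarith
    calc (T.card : ℝ) ≤ (29 * √n) * P.card := hT
      _ ≤ (29 * √n) * (10000 * (12 * n)) := by
        apply mul_le_mul_of_nonneg_left _ (by positivity)
        linarith
      _ ≤ _ := by nlinarith [mul_nonneg (by linarith : 0 ≤ n) (Real.sqrt_nonneg n)]
  · have hA2n : A ≤ 2 * n := by
      have h1 := (hAI t₀ ht₀).1
      have h2 := abs_le.1 (hsub t₀ ht₀)
      have h3 := abs_le.1 (hbox t₀ ht₀).1
      apply le_of_sq_le_sq _ (by linarith)
      nlinarith
    have hPc := card_pairs_le P hM hG (t := 30 * n / A ^ 2) (by positivity)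
      (fun p hp => (hPnorm p hp).1) (fun p hp => (hPnorm p hp).2) (by
        simp only [hP, Finset.mem_image]
        rintro _ ⟨t, ht, rfl⟩
        obtain ⟨hm, _, hI, him, _⟩ := hφ t ht
        exact abs_im_le_of_param hm hn (hbox t ht).1 (hbox t ht).2.1 (hbox t ht).2.2 hI him hA0
          hge (hAI t ht).1)
    rw [← hA] at hPc
    have hT : (T.card : ℝ) ≤ (12 * n / A) * P.card := by
      apply Finset.card_le_mul_card_image_real
      intro p hp
      obtain ⟨t, ht, rfl⟩ := Finset.mem_image.1 hp
      rw [hfib]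
      refine (card_le_of_abs_sq_sub_le _ (I := ((norm (φ t).1 * norm (φ t).2 : ℤ) : ℝ)) hA0 hge
        (by linarith) (hAI t ht).1 ?_).trans ?_
      · simp only [Finset.mem_image, Finset.mem_filter]
        rintro _ ⟨x, hx, rfl⟩
        rw [← hx.2]
        exact hsub x hx.1
      · have : 1 ≤ 2 * n / A := by rwa [le_div_iff₀ hA0, one_mul]
        calc 2 * (4 * n / A + 1) ≤ 2 * (4 * n / A + 2 * n / A) := by linarith
          _ = 12 * n / A := by ring
    have hsA : √n ≤ A := by
      apply le_of_sq_le_sq _ hA0.le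
      rw [hss]; linarith
    have hsA' : √A ≤ 3 / 2 * √n := by
      rw [Real.sqrt_le_left (by positivity), mul_pow, hss]
      linarith
    have hn2 : n ^ 2 / A ≤ n * √n := by
      rw [div_le_iff₀ hA0]
      calc n ^ 2 = n * √n * √n := by rw [mul_assoc, ← sq, hss, sq]
        _ ≤ _ := by gcongr
    calc (T.card : ℝ) ≤ (12 * n / A) * P.card := hT
      _ ≤ (12 * n / A) * (3000 * (8 * (30 * n / A ^ 2) * A ^ 2 + A * √A)) := by gcongr
      _ = 36000 * (240 * (n ^ 2 / A) + n * √A) := by field_simp; ring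
      _ ≤ 36000 * (240 * (n * √n) + n * (3 / 2 * √n)) := by gcongr
      _ ≤ _ := by nlinarith [mul_nonneg (by linarith : 0 ≤ n) (Real.sqrt_nonneg n)]

lemma pow_log_four_bound (k : ℕ) (hk : k ≠ 0) :
    ((2 : ℝ) ^ Nat.log 4 k) ^ 2 ≤ k ∧ (k : ℝ) ≤ (2 * (2 : ℝ) ^ Nat.log 4 k) ^ 2 := by
  have h1 : (4 ^ Nat.log 4 k : ℕ) ≤ k := Nat.pow_log_le_self 4 hk
  have h2 : k < 4 ^ (Nat.log 4 k + 1) := Nat.lt_pow_succ_log_self (by norm_num) k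
  have h1' : (4 : ℝ) ^ Nat.log 4 k ≤ k := by exact_mod_cast h1
  have h2' : (k : ℝ) ≤ 4 ^ (Nat.log 4 k + 1) := by exact_mod_cast h2.le
  have h4 : ((2 : ℝ) ^ Nat.log 4 k) ^ 2 = 4 ^ Nat.log 4 k := by
    rw [← pow_mul, mul_comm, pow_mul]; norm_num
  rw [mul_pow, h4]
  refine ⟨h1', h2'.trans_eq ?_⟩
  rw [pow_succ]; ring

/-- The number of cubics in a box without rational roots whose discriminant is a square. -/
lemma card_le_of_disc_sq (T : Finset (ℤ × ℤ × ℤ)) {n : ℕ} (hn : 1 ≤ n)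
    (hbox : ∀ t ∈ T, |(t.1 : ℝ)| ≤ n ∧ |(t.2.1 : ℝ)| ≤ n ∧ |(t.2.2 : ℝ)| ≤ n)
    (hroot : ∀ t ∈ T, ∀ r : ℤ, r ^ 3 + t.1 * r ^ 2 + t.2.1 * r + t.2.2 ≠ 0)
    (hsq : ∀ t ∈ T, ∃ y : ℤ, cubicDisc t.1 t.2.1 t.2.2 = y ^ 2) :
    (T.card : ℝ) ≤ ((Nat.log 4 (4 * n ^ 2) : ℝ) + 1) ^ 2 * (10000000 * (n * √n)) := by
  classical
  have hn' : (1 : ℝ) ≤ n := by exact_mod_cast hn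
  have hex : ∀ t : ℤ × ℤ × ℤ, ∃ p : Eisenstein × Eisenstein, t ∈ T → IsParam t p := by
    intro t
    by_cases ht : t ∈ T
    · obtain ⟨p, hp⟩ := exists_param (hroot t ht) (hsq t ht)
      exact ⟨p, fun _ => hp⟩
    · exact ⟨0, fun h => absurd h ht⟩
  choose φ hφ using hex
  set ℓ := Nat.log 4 (4 * n ^ 2) with hℓ
  set key : ℤ × ℤ × ℤ → ℕ × ℕ := fun t =>
    (Nat.log 4 (norm (φ t).1).natAbs, Nat.log 4 (norm (φ t).2).natAbs) with hkey
  have hnat : ∀ t ∈ T, (norm (φ t).1).natAbs ≠ 0 ∧ (norm (φ t).2).natAbs ≠ 0 ∧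
      (((norm (φ t).1).natAbs : ℕ) : ℤ) = norm (φ t).1 ∧
      (((norm (φ t).2).natAbs : ℕ) : ℤ) = norm (φ t).2 := by
    intro t ht
    have h1 := norm_pos (hφ t ht).1
    have h2 := norm_pos (hφ t ht).2.1
    refine ⟨by omega, by omega, by omega, by omega⟩
  have hle : ∀ t ∈ T, (norm (φ t).1).natAbs ≤ 4 * n ^ 2 ∧ (norm (φ t).2).natAbs ≤ 4 * n ^ 2 := by
    intro t ht
    obtain ⟨h1, h2, -, -⟩ := hnat t ht
    have h3 : (norm (φ t).1).natAbs * (norm (φ t).2).natAbs ≤ 4 * n ^ 2 := by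
      rw [← Int.natAbs_mul, (hφ t ht).2.2.1]
      have ha := abs_le.1 (hbox t ht).1
      have hb := abs_le.1 (hbox t ht).2.1
      have : |((t.1 ^ 2 - 3 * t.2.1 : ℤ) : ℝ)| ≤ 4 * n ^ 2 := by
        push_cast
        rw [abs_le]
        constructor <;> nlinarith
      have h5 : ((t.1 ^ 2 - 3 * t.2.1).natAbs : ℝ) ≤ 4 * n ^ 2 := by
        rwa [Nat.cast_natAbs, Int.cast_abs]
      exact_mod_cast h5
    exact ⟨(Nat.le_mul_of_pos_right _ (Nat.pos_of_ne_zero h2)).trans h3,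
      (Nat.le_mul_of_pos_left _ (Nat.pos_of_ne_zero h1)).trans h3⟩
  have hmaps : ∀ t ∈ T, key t ∈ Finset.range (ℓ + 1) ×ˢ Finset.range (ℓ + 1) := by
    intro t ht
    rw [Finset.mem_product, Finset.mem_range, Finset.mem_range]
    exact ⟨Nat.lt_succ_of_le (Nat.log_mono_right (b := 4) (hle t ht).1),
      Nat.lt_succ_of_le (Nat.log_mono_right (b := 4) (hle t ht).2)⟩
  rw [Finset.card_eq_sum_card_fiberwise hmaps, Nat.cast_sum]
  refine (Finset.sum_le_card_nsmul _ _ (10000000 * ((n : ℝ) * √n)) ?_).trans_eq ?_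
  · intro k _
    refine card_block_le _ φ hn' (M := 2 ^ k.1) (G := 2 ^ k.2) (one_le_pow₀ (by norm_num))
      (one_le_pow₀ (by norm_num)) (fun t ht => hbox t (Finset.mem_filter.1 ht).1)
      (fun t ht => hφ t (Finset.mem_filter.1 ht).1) ?_ ?_
    · intro t ht
      obtain ⟨ht', rfl⟩ := Finset.mem_filter.1 ht
      have := pow_log_four_bound _ (hnat t ht').1
      rw [← (hnat t ht').2.2.1, Int.cast_natCast]
      exact this
    · intro t ht
      obtain ⟨ht', rfl⟩ := Finset.mem_filter.1 ht
      have := pow_log_four_bound _ (hnat t ht').2.1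
      rw [← (hnat t ht').2.2.2, Int.cast_natCast]
      exact this
  · rw [Finset.card_product, Finset.card_range, nsmul_eq_mul]
    push_cast
    ring

end Eisenstein

/-- A power of the logarithm is bounded by any positive power. -/
lemma exists_log_sq_le {ε : ℝ} (hε : 0 < ε) : ∃ K : ℝ, 0 < K ∧ ∀ n : ℕ, 1 ≤ n →
    ((Nat.log 4 (4 * n ^ 2) : ℝ) + 1) ^ 2 ≤ K * (n : ℝ) ^ ε := by
  refine ⟨(3 * (2 / ε + 2)) ^ 2, by positivity, fun n hn => ?_⟩
  have hn' : (1 : ℝ) ≤ n := by exact_mod_cast hn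
  have hn0 : (0 : ℝ) < n := by linarith
  have h1 : (4 : ℝ) ^ Nat.log 4 (4 * n ^ 2) ≤ 4 * n ^ 2 := by
    exact_mod_cast Nat.pow_log_le_self 4 (x := 4 * n ^ 2) (by positivity)
  have h2 := Real.log_le_log (by positivity) h1
  rw [Real.log_pow, Real.log_mul (by norm_num) (by positivity), Real.log_pow] at h2
  push_cast at h2
  have h4 : (1 : ℝ) ≤ Real.log 4 := by
    have h41 := Real.log_two_gt_d9
    have h42 : Real.log 4 = 2 * Real.log 2 := by
      rw [show (4 : ℝ) = 2 ^ 2 by norm_num, Real.log_pow]; norm_num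
    linarith
  have h5 := Real.log_le_rpow_div hn0.le (half_pos hε)
  have h6 : (1 : ℝ) ≤ (n : ℝ) ^ (ε / 2) := Real.one_le_rpow hn' (by positivity)
  have h7 : 0 ≤ Real.log n := Real.log_nonneg hn'
  have h8 : (Nat.log 4 (4 * n ^ 2) : ℝ) ≤ 1 + 2 * Real.log n := by
    have : ((Nat.log 4 (4 * n ^ 2) : ℝ) - 1) * Real.log 4 ≤ 2 * Real.log n := by linarith
    nlinarith
  have h9 : (n : ℝ) ^ (ε / 2) / (ε / 2) = 2 / ε * (n : ℝ) ^ (ε / 2) := by field_simp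
  have h10 : (n : ℝ) ^ ε = ((n : ℝ) ^ (ε / 2)) ^ 2 := by
    rw [← Real.rpow_natCast, ← Real.rpow_mul hn0.le]; norm_num
  rw [h10, ← mul_pow]
  apply pow_le_pow_left₀ (by positivity)
  have : 0 ≤ 2 / ε := by positivity
  nlinarith

/-- The integer points of the cube of half-side `n`. -/
noncomputable def cubeBox (n : ℕ) : Finset (ℤ × ℤ × ℤ) :=
  Finset.Icc (-(n : ℤ)) n ×ˢ Finset.Icc (-(n : ℤ)) n ×ˢ Finset.Icc (-(n : ℤ)) n

lemma mem_cubeBox {n : ℕ} {t : ℤ × ℤ × ℤ} :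
    t ∈ cubeBox n ↔ |t.1| ≤ n ∧ |t.2.1| ≤ n ∧ |t.2.2| ≤ n := by
  simp only [cubeBox, Finset.mem_product, Finset.mem_Icc, abs_le]

/-- The cubics with coefficients in the box which vanish at `r`. -/
noncomputable def cubicsWithRoot (n : ℕ) (r : ℤ) : Finset (ℤ × ℤ × ℤ) :=
  (cubeBox n).filter fun t => r ^ 3 + t.1 * r ^ 2 + t.2.1 * r + t.2.2 = 0

lemma mem_cubicsWithRoot {n : ℕ} {r : ℤ} {t : ℤ × ℤ × ℤ} :
    t ∈ cubicsWithRoot n r ↔ (|t.1| ≤ n ∧ |t.2.1| ≤ n ∧ |t.2.2| ≤ n) ∧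
      r ^ 3 + t.1 * r ^ 2 + t.2.1 * r + t.2.2 = 0 := by
  rw [cubicsWithRoot, Finset.mem_filter, mem_cubeBox]

lemma abs_root_le {n : ℕ} {r : ℤ} {t : ℤ × ℤ × ℤ} (h : t ∈ cubicsWithRoot n r) :
    |r| ≤ n + 1 := by
  obtain ⟨⟨ha, hb, hc⟩, h⟩ := mem_cubicsWithRoot.1 h
  by_contra! hr
  have h1 : |r| ^ 3 ≤ n * |r| ^ 2 + n * |r| + n := by
    have : |r| ^ 3 = |t.1 * r ^ 2 + t.2.1 * r + t.2.2| := by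
      rw [← abs_pow, ← abs_neg]; congr 1; linarith
    rw [this]
    refine (abs_add_three _ _ _).trans ?_
    rw [abs_mul, abs_mul, abs_pow]
    gcongr
  have h2 : (n : ℤ) ≤ |r| - 2 := by linarith [Int.add_one_le_of_lt hr]
  nlinarith [abs_nonneg r, sq_nonneg |r|]

lemma card_cubicsWithRoot_neg (n : ℕ) (r : ℤ) :
    (cubicsWithRoot n (-r)).card = (cubicsWithRoot n r).card := by
  refine Finset.card_nbij' (fun t => (-t.1, t.2.1, -t.2.2)) (fun t => (-t.1, t.2.1, -t.2.2))
    ?_ ?_ ?_ ?_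
  · intro t ht
    rw [Finset.mem_coe, mem_cubicsWithRoot] at ht ⊢
    simp only [abs_neg]
    exact ⟨ht.1, by linarith [ht.2]⟩
  · intro t ht
    rw [Finset.mem_coe, mem_cubicsWithRoot] at ht ⊢
    simp only [abs_neg]
    exact ⟨ht.1, by linarith [ht.2]⟩
  · intro t _; simp
  · intro t _; simp

lemma card_cubicsWithRoot_zero (n : ℕ) : (cubicsWithRoot n 0).card = (2 * n + 1) ^ 2 := by
  have : (cubicsWithRoot n 0).card =
      (Finset.Icc (-(n : ℤ)) n ×ˢ Finset.Icc (-(n : ℤ)) n).card := by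
    refine Finset.card_nbij' (fun t => (t.1, t.2.1)) (fun t => (t.1, t.2, 0)) ?_ ?_ ?_ ?_
    · intro t ht
      rw [Finset.mem_coe, mem_cubicsWithRoot] at ht
      rw [Finset.mem_coe, Finset.mem_product, Finset.mem_Icc, Finset.mem_Icc]
      exact ⟨abs_le.1 ht.1.1, abs_le.1 ht.1.2.1⟩
    · intro t ht
      rw [Finset.mem_coe, Finset.mem_product, Finset.mem_Icc, Finset.mem_Icc] at ht
      rw [Finset.mem_coe, mem_cubicsWithRoot]
      exact ⟨⟨abs_le.2 ht.1, abs_le.2 ht.2, by simp⟩, by simp⟩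
    · rintro ⟨a, b, c⟩ ht
      rw [Finset.mem_coe, mem_cubicsWithRoot] at ht
      have : c = 0 := by simpa using ht.2
      rw [this]
    · intro t _; rfl
  rw [this, Finset.card_product, Int.card_Icc]
  have : ((n : ℤ) + 1 - -n).toNat = 2 * n + 1 := by omega
  rw [this, sq]

lemma Int.Icc_neg_succ (n : ℕ) : Finset.Icc (-((n + 1 : ℕ) : ℤ)) ((n + 1 : ℕ) : ℤ) =
    insert (-((n + 1 : ℕ) : ℤ)) (insert ((n + 1 : ℕ) : ℤ) (Finset.Icc (-(n : ℤ)) n)) := by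
  ext x
  simp only [Finset.mem_Icc, Finset.mem_insert]
  omega

lemma Int.sum_Icc_neg_succ {R : Type*} [AddCommMonoid R] (f : ℤ → R) (n : ℕ) :
    ∑ x ∈ Finset.Icc (-((n + 1 : ℕ) : ℤ)) ((n + 1 : ℕ) : ℤ), f x =
      f (-((n + 1 : ℕ) : ℤ)) + (f ((n + 1 : ℕ) : ℤ) + ∑ x ∈ Finset.Icc (-(n : ℤ)) n, f x) := by
  rw [Int.Icc_neg_succ, Finset.sum_insert, Finset.sum_insert]
  · simp
  · simp only [Finset.mem_Icc, Finset.mem_insert]; omega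

lemma Int.sum_Icc_neg_of_even (f : ℤ → ℝ) (hf : ∀ x, f (-x) = f x) (n : ℕ) :
    ∑ x ∈ Finset.Icc (-(n : ℤ)) n, f x = f 0 + 2 * ∑ k ∈ Finset.Ioc 0 n, f k := by
  induction n with
  | zero => simp
  | succ n ih =>
    rw [Int.sum_Icc_neg_succ, ih, Finset.sum_Ioc_succ_top (Nat.zero_le n), hf]
    ring

lemma card_cubicsWithRoot_one (n : ℕ) : ((cubicsWithRoot n 1).card : ℤ) = 3 * n * (n + 1) := by
  have hmaps : ∀ t ∈ cubicsWithRoot n 1, t.1 ∈ Finset.Icc (-(n : ℤ)) n := fun t ht =>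
    Finset.mem_Icc.2 (abs_le.1 (mem_cubicsWithRoot.1 ht).1.1)
  have hfib : ∀ a ∈ Finset.Icc (-(n : ℤ)) n,
      (((cubicsWithRoot n 1).filter (fun t => t.1 = a)).card : ℤ) = 2 * n + 1 - |a + 1| := by
    intro a ha
    rw [Finset.mem_Icc] at ha
    have : ((cubicsWithRoot n 1).filter (fun t => t.1 = a)).card =
        (Finset.Icc (max (-(n : ℤ)) (-n - 1 - a)) (min (n : ℤ) (n - 1 - a))).card := by
      refine Finset.card_nbij' (fun t => t.2.1) (fun b => (a, b, -1 - a - b)) ?_ ?_ ?_ ?_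
      · rintro ⟨a', b, c⟩ ht
        simp only [Finset.mem_coe, Finset.mem_filter, mem_cubicsWithRoot, abs_le, one_pow,
          mul_one] at ht
        simp only [Finset.mem_coe, Finset.mem_Icc, max_le_iff, le_min_iff]
        omega
      · intro b hb
        simp only [Finset.mem_coe, Finset.mem_Icc, max_le_iff, le_min_iff] at hb
        simp only [Finset.mem_coe, Finset.mem_filter, mem_cubicsWithRoot, abs_le, one_pow,
          mul_one, and_true]
        omega
      · rintro ⟨a', b, c⟩ ht
        simp only [Finset.mem_coe, Finset.mem_filter, mem_cubicsWithRoot, abs_le, one_pow,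
          mul_one] at ht
        simp only [Prod.mk.injEq, true_and]
        omega
      · intro b _; rfl
    rw [this, Int.card_Icc]
    rcases abs_cases (a + 1) with h | h
    · rw [max_eq_left (by omega), min_eq_right (by omega)]; omega
    · rw [max_eq_right (by omega), min_eq_left (by omega)]; omega
  have hsum : ∑ a ∈ Finset.Icc (-(n : ℤ)) n, (2 * (n : ℤ) + 1 - |a + 1|) = 3 * n * (n + 1) := by
    clear hmaps hfib
    have habs : ∑ a ∈ Finset.Icc (-(n : ℤ)) n, |a + 1| = (n : ℤ) ^ 2 + n + 1 := by
      induction n with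
      | zero => simp
      | succ n ih =>
        rw [Int.sum_Icc_neg_succ, ih]
        rw [abs_of_nonpos (by push_cast; linarith), abs_of_nonneg (by positivity)]
        push_cast; ring
    rw [Finset.sum_sub_distrib, habs, Finset.sum_const, Int.card_Icc, nsmul_eq_mul]
    have : (((n : ℤ) + 1 - -n).toNat : ℤ) = 2 * n + 1 := by omega
    rw [this]; ring
  rw [Finset.card_eq_sum_card_fiberwise hmaps, Nat.cast_sum, Finset.sum_congr rfl hfib, hsum]

lemma Int.abs_card_Icc_ceil_floor_sub_le {x y : ℝ} (h : x ≤ y) :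
    |((Finset.Icc ⌈x⌉ ⌊y⌋).card : ℝ) - (y - x)| ≤ 1 := by
  have h1 := Int.floor_le y
  have h2 := Int.lt_floor_add_one y
  have h3 := Int.le_ceil x
  have h4 := Int.ceil_lt_add_one x
  have h5 : 0 ≤ ⌊y⌋ + 1 - ⌈x⌉ := by
    have : ((⌈x⌉ : ℤ) : ℝ) < ((⌊y⌋ + 2 : ℤ) : ℝ) := by push_cast; linarith
    have := Int.cast_lt.1 this
    omega
  have h6 : ((Finset.Icc ⌈x⌉ ⌊y⌋).card : ℝ) = ⌊y⌋ + 1 - ⌈x⌉ := by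
    rw [Int.card_Icc]
    have : (((⌊y⌋ + 1 - ⌈x⌉).toNat : ℤ) : ℝ) = ((⌊y⌋ + 1 - ⌈x⌉ : ℤ) : ℝ) := by
      rw [Int.toNat_of_nonneg h5]
    push_cast at this
    exact_mod_cast this
  rw [h6, abs_le]
  constructor <;> linarith

lemma abs_card_cubicsWithRoot_sub_le {n r : ℕ} (hn : 16 ≤ n) (hr : 2 ≤ r) (hrn : r ^ 2 ≤ n) :
    |((cubicsWithRoot n r).card : ℝ) - 4 * (n : ℝ) ^ 2 / (r : ℝ) ^ 2| ≤ (4 * n : ℝ) := by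
  have hn' : (16 : ℝ) ≤ n := by exact_mod_cast hn
  have hr' : (2 : ℝ) ≤ r := by exact_mod_cast hr
  have hrn' : (r : ℝ) ^ 2 ≤ n := by exact_mod_cast hrn
  have hr0 : (0 : ℝ) < r := by linarith
  have hr20 : (0 : ℝ) < (r : ℝ) ^ 2 := by positivity
  have hr24 : (4 : ℝ) ≤ (r : ℝ) ^ 2 := by nlinarith
  have hr4 : (r : ℝ) ≤ n / 4 := by
    apply le_of_sq_le_sq _ (by linarith)
    nlinarith
  have hmaps : ∀ t ∈ cubicsWithRoot n r, t.2.1 ∈ Finset.Icc (-(n : ℤ)) n := fun t ht =>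
    Finset.mem_Icc.2 (abs_le.1 (mem_cubicsWithRoot.1 ht).1.2.1)
  have hfib : ∀ b ∈ Finset.Icc (-(n : ℤ)) n,
      |(((cubicsWithRoot n r).filter (fun t => t.2.1 = b)).card : ℝ) - 2 * n / r ^ 2| ≤ 1 := by
    intro b hb
    rw [Finset.mem_Icc] at hb
    have hb1 : -(n : ℝ) ≤ b := by exact_mod_cast hb.1
    have hb2 : (b : ℝ) ≤ n := by exact_mod_cast hb.2
    obtain ⟨x, hx⟩ : ∃ x, x = (-(n : ℝ) - r ^ 3 - b * r) / r ^ 2 := ⟨_, rfl⟩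
    obtain ⟨y, hy⟩ : ∃ y, y = ((n : ℝ) - r ^ 3 - b * r) / r ^ 2 := ⟨_, rfl⟩
    have hyx : y - x = 2 * n / r ^ 2 := by rw [hx, hy]; ring
    have hmem : ∀ a : ℤ, a ∈ Finset.Icc ⌈x⌉ ⌊y⌋ ↔ |-((r : ℤ) ^ 3 + a * r ^ 2 + b * r)| ≤ n := by
      intro a
      rw [Finset.mem_Icc, Int.ceil_le, Int.le_floor, hx, hy, div_le_iff₀ hr20, le_div_iff₀ hr20,
        ← Int.cast_le (R := ℝ), abs_neg, Int.cast_abs, abs_le]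
      push_cast
      constructor
      · rintro ⟨h1, h2⟩; constructor <;> linarith
      · rintro ⟨h1, h2⟩; constructor <;> linarith
    have habs : ∀ a : ℤ, a ∈ Finset.Icc ⌈x⌉ ⌊y⌋ → |a| ≤ n := by
      intro a ha
      rw [Finset.mem_Icc, Int.ceil_le, Int.le_floor, hx, hy, div_le_iff₀ hr20,
        le_div_iff₀ hr20] at ha
      rw [← Int.cast_le (R := ℝ), Int.cast_abs, abs_le]
      push_cast
      have h1 : (n : ℝ) ≤ n / 4 * r ^ 2 := by nlinarith
      have h2 : (r : ℝ) ^ 3 ≤ n / 4 * r ^ 2 := by nlinarith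
      have h3 : (n : ℝ) * r ≤ n / 2 * r ^ 2 := by
        nlinarith [mul_nonneg (by linarith : (0 : ℝ) ≤ n) hr0.le]
      have h4 : (b : ℝ) * r ≤ n * r := by gcongr
      have h5 : -((n : ℝ) * r) ≤ b * r := by nlinarith
      constructor
      · refine le_of_mul_le_mul_right ?_ hr20; linarith
      · refine le_of_mul_le_mul_right ?_ hr20; nlinarith
    have hcard : ((cubicsWithRoot n r).filter (fun t => t.2.1 = b)).card =
        (Finset.Icc ⌈x⌉ ⌊y⌋).card := by
      refine Finset.card_nbij' (fun t => t.1)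
        (fun a => (a, b, -((r : ℤ) ^ 3 + a * r ^ 2 + b * r))) ?_ ?_ ?_ ?_
      · rintro ⟨a, b', c⟩ ht
        simp only [Finset.mem_coe, Finset.mem_filter, mem_cubicsWithRoot] at ht
        obtain ⟨⟨⟨-, -, hc⟩, h⟩, rfl⟩ := ht
        rw [Finset.mem_coe, hmem]
        convert hc using 2
        linarith
      · intro a ha
        rw [Finset.mem_coe] at ha
        simp only [Finset.mem_coe, Finset.mem_filter, mem_cubicsWithRoot, and_true]
        exact ⟨⟨habs a ha, abs_le.2 hb, (hmem a).1 ha⟩, by ring⟩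
      · rintro ⟨a, b', c⟩ ht
        simp only [Finset.mem_coe, Finset.mem_filter, mem_cubicsWithRoot] at ht
        obtain ⟨⟨-, h⟩, rfl⟩ := ht
        simp only [Prod.mk.injEq, true_and]
        linarith
      · intro a _; rfl
    rw [hcard, ← hyx]
    apply Int.abs_card_Icc_ceil_floor_sub_le
    have : 0 ≤ y - x := by rw [hyx]; positivity
    linarith
  have hcardI : ((Finset.Icc (-(n : ℤ)) n).card : ℝ) = 2 * n + 1 := by
    rw [Int.card_Icc]
    have : ((n : ℤ) + 1 - -n).toNat = 2 * n + 1 := by omega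
    rw [this]; push_cast; ring
  have hsum : |((cubicsWithRoot n r).card : ℝ) - (2 * (n : ℝ) + 1) * (2 * n / (r : ℝ) ^ 2)| ≤
      2 * (n : ℝ) + 1 := by
    rw [Finset.card_eq_sum_card_fiberwise hmaps, Nat.cast_sum, ← hcardI, ← nsmul_eq_mul,
      ← Finset.sum_const, ← Finset.sum_sub_distrib]
    refine (Finset.abs_sum_le_sum_abs _ _).trans ((Finset.sum_le_card_nsmul _ _ 1 hfib).trans ?_)
    rw [nsmul_eq_mul, mul_one]
  have h0 : 0 ≤ 2 * (n : ℝ) / r ^ 2 := by positivity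
  have h1 : 2 * (n : ℝ) / r ^ 2 ≤ n / 2 := by
    rw [div_le_iff₀ hr20]; nlinarith
  have h2 : (2 * (n : ℝ) + 1) * (2 * n / r ^ 2) = 4 * n ^ 2 / r ^ 2 + 2 * n / r ^ 2 := by ring
  rw [h2] at hsum
  rw [abs_le] at hsum ⊢
  constructor <;> linarith

lemma card_cubicsWithRoot_le {n r : ℕ} (hr : 1 ≤ r) (hrn : r ≤ 2 * n) :
    ((cubicsWithRoot n r).card : ℝ) ≤ 24 * (n ^ 2 / r ^ 2) := by
  have hr' : (1 : ℝ) ≤ r := by exact_mod_cast hr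
  have hr0 : (0 : ℝ) < r := by linarith
  have hrn' : (r : ℝ) ≤ 2 * n := by exact_mod_cast hrn
  have hbox : ∀ t ∈ cubicsWithRoot n r, |(t.1 : ℝ)| ≤ n ∧ |(t.2.1 : ℝ)| ≤ n ∧ |(t.2.2 : ℝ)| ≤ n ∧
      (r : ℝ) ^ 3 + t.1 * r ^ 2 + t.2.1 * r + t.2.2 = 0 := by
    intro t ht
    obtain ⟨⟨h1, h2, h3⟩, h4⟩ := mem_cubicsWithRoot.1 ht
    exact ⟨by exact_mod_cast h1, by exact_mod_cast h2, by exact_mod_cast h3, by exact_mod_cast h4⟩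
  have := Finset.card_le_of_fiber_le (cubicsWithRoot n r) (fun t => t.1) (fun t => t.2.1)
    (L₁ := 2 * n / r) (L₂ := 4 * n / r) (by
      rintro ⟨a, b, c⟩ hx ⟨a', b', c'⟩ hy h1 h2
      simp only at h1 h2
      subst h1 h2
      have h1 := (mem_cubicsWithRoot.1 hx).2
      have h2 := (mem_cubicsWithRoot.1 hy).2
      simp only at h1 h2
      simp only [Prod.mk.injEq, true_and]
      linarith) (by positivity) (by positivity) (by
      intro x hx y hy hxy
      obtain ⟨-, -, hc, he⟩ := hbox x hx
      obtain ⟨-, -, hc', he'⟩ := hbox y hy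
      rw [abs_le] at hc hc'
      rw [hxy] at he
      push_cast
      rw [le_div_iff₀ hr0]
      linarith) (by
      intro x hx y hy
      obtain ⟨-, hb, hc, he⟩ := hbox x hx
      obtain ⟨-, hb', hc', he'⟩ := hbox y hy
      rw [abs_le] at hb hb' hc hc'
      push_cast
      rw [le_div_iff₀ hr0]
      refine le_of_mul_le_mul_right ?_ hr0
      nlinarith)
  have h1 : 1 ≤ 2 * (n : ℝ) / r := by rwa [le_div_iff₀ hr0, one_mul]
  calc _ ≤ (2 * (n : ℝ) / r + 1) * (4 * n / r + 1) := this
    _ ≤ (2 * (n : ℝ) / r + 2 * n / r) * (4 * n / r + 2 * n / r) := by gcongr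
    _ = _ := by field_simp; ring

lemma card_cubicsWithRoot_inter_le (n : ℕ) {r s : ℤ} (hrs : r ≠ s) :
    ((cubicsWithRoot n r ∩ cubicsWithRoot n s).card : ℝ) ≤
      2 * n * ((max 1 |(r : ℝ)|)⁻¹ * (max 1 |(s : ℝ)|)⁻¹) + 1 := by
  classical
  set S := cubicsWithRoot n r ∩ cubicsWithRoot n s with hS
  have hkey : ∀ x ∈ S, ∀ y ∈ S, y.2.1 - x.2.1 = -(r + s) * (y.1 - x.1) ∧
      y.2.2 - x.2.2 = r * s * (y.1 - x.1) := by
    intro x hx y hy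
    rw [hS, Finset.mem_inter] at hx hy
    have h1 := (mem_cubicsWithRoot.1 hx.1).2
    have h2 := (mem_cubicsWithRoot.1 hx.2).2
    have h3 := (mem_cubicsWithRoot.1 hy.1).2
    have h4 := (mem_cubicsWithRoot.1 hy.2).2
    have hb : y.2.1 - x.2.1 = -(r + s) * (y.1 - x.1) := by
      apply mul_left_cancel₀ (sub_ne_zero.2 hrs)
      linear_combination h3 - h4 - h1 + h2
    refine ⟨hb, ?_⟩
    linear_combination h3 - h1 - r * hb
  have hcard : S.card = (S.image (fun t => t.1)).card := by
    rw [Finset.card_image_of_injOn]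
    intro x hx y hy hxy
    simp only at hxy
    obtain ⟨h1, h2⟩ := hkey x hx y hy
    rw [hxy, sub_self, mul_zero] at h1 h2
    exact Prod.ext hxy (Prod.ext (by linarith) (by linarith))
  have hpos : 0 < max 1 |(r : ℝ)| * max 1 |(s : ℝ)| := by positivity
  rw [hcard, ← mul_inv, ← div_eq_mul_inv]
  refine Finset.card_int_le_of_sub_le _ (by positivity) ?_
  simp only [Finset.mem_image]
  rintro _ ⟨y, hy, rfl⟩ _ ⟨x, hx, rfl⟩
  obtain ⟨h1, h2⟩ := hkey x hx y hy
  have hx' := (mem_cubicsWithRoot.1 (Finset.mem_inter.1 hx).1).1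
  have hy' := (mem_cubicsWithRoot.1 (Finset.mem_inter.1 hy).1).1
  have hB : |y.2.1 - x.2.1| ≤ 2 * n := (abs_sub _ _).trans (by linarith [hx'.2.1, hy'.2.1])
  have hC : |y.2.2 - x.2.2| ≤ 2 * n := (abs_sub _ _).trans (by linarith [hx'.2.2, hy'.2.2])
  have hone : ∀ z : ℤ, z ≠ 0 → (1 : ℝ) ≤ |(z : ℝ)| := fun z hz => by
    exact_mod_cast Int.one_le_abs hz
  have habs : |((y.1 - x.1 : ℤ) : ℝ)| * (max 1 |(r : ℝ)| * max 1 |(s : ℝ)|) ≤ 2 * n := by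
    rcases eq_or_ne r 0 with rfl | hr
    · rw [h1, abs_mul, abs_neg, zero_add] at hB
      rw [Int.cast_zero, abs_zero, max_eq_left zero_le_one, max_eq_right (hone s (Ne.symm hrs)),
        one_mul, mul_comm]
      exact_mod_cast hB
    rcases eq_or_ne s 0 with rfl | hs
    · rw [h1, abs_mul, abs_neg, add_zero] at hB
      rw [Int.cast_zero, abs_zero, max_eq_left zero_le_one, max_eq_right (hone r hrs),
        mul_one, mul_comm]
      exact_mod_cast hB
    · rw [h2, abs_mul, abs_mul] at hC
      rw [max_eq_right (hone r hr), max_eq_right (hone s hs), mul_comm]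
      exact_mod_cast hC
  rw [le_div_iff₀ hpos]
  exact (mul_le_mul_of_nonneg_right (le_abs_self _) hpos.le).trans habs

/-- Bonferroni's inequality. -/
lemma Finset.sum_card_le_card_biUnion_add {α ι : Type*} [DecidableEq α] [DecidableEq ι]
    (R : Finset ι) (A : ι → Finset α) :
    ∑ r ∈ R, (A r).card ≤ (R.biUnion A).card + ∑ r ∈ R, ∑ s ∈ R.erase r, (A r ∩ A s).card := by
  induction R using Finset.induction_on with
  | empty => simp
  | insert a R ha ih =>
    rw [Finset.sum_insert ha, Finset.sum_insert ha, Finset.biUnion_insert,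
      Finset.erase_insert ha]
    have h1 : (A a ∩ R.biUnion A).card ≤ ∑ s ∈ R, (A a ∩ A s).card := by
      rw [Finset.inter_biUnion]; exact Finset.card_biUnion_le
    have h2 := Finset.card_union_add_card_inter (A a) (R.biUnion A)
    have h3 : ∑ r ∈ R, ∑ s ∈ R.erase r, (A r ∩ A s).card ≤
        ∑ r ∈ R, ∑ s ∈ (insert a R).erase r, (A r ∩ A s).card :=
      Finset.sum_le_sum fun r _ => Finset.sum_le_sum_of_subset
        (Finset.erase_subset_erase _ (Finset.subset_insert _ _))
    omega

lemma sum_Ioc_inv_sq_le_inv {k n : ℕ} (hk : k ≠ 0) (h : k ≤ n) :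
    ∑ i ∈ Finset.Ioc k n, ((i : ℝ) ^ 2)⁻¹ ≤ (k : ℝ)⁻¹ :=
  (sum_Ioc_inv_sq_le_sub hk h).trans (sub_le_self _ (by positivity))

lemma tendsto_sum_Ioc_inv_sq :
    Filter.Tendsto (fun n : ℕ => ∑ i ∈ Finset.Ioc 0 n, ((i : ℝ) ^ 2)⁻¹) Filter.atTop
      (nhds (π ^ 2 / 6)) := by
  have h := (hasSum_zeta_two.tendsto_sum_nat).comp (Filter.tendsto_add_atTop_nat 1)
  refine h.congr fun n => ?_
  rw [Function.comp_apply, Finset.sum_range_succ']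
  induction n with
  | zero => simp
  | succ n ih =>
    rw [Finset.sum_Ioc_succ_top (Nat.zero_le n), ← ih, Finset.sum_range_succ]
    simp only [one_div]
    ring

lemma sum_Ioc_inv_sq_le (s : ℕ) : ∑ i ∈ Finset.Ioc 0 s, ((i : ℝ) ^ 2)⁻¹ ≤ π ^ 2 / 6 := by
  refine ge_of_tendsto tendsto_sum_Ioc_inv_sq (Filter.eventually_atTop.2 ⟨s, fun n hn => ?_⟩)
  rw [← Finset.sum_Ioc_consecutive _ (Nat.zero_le s) hn]
  exact le_add_of_nonneg_right (Finset.sum_nonneg fun i _ => by positivity)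

lemma le_sum_Ioc_inv_sq {s : ℕ} (hs : s ≠ 0) :
    π ^ 2 / 6 ≤ ∑ i ∈ Finset.Ioc 0 s, ((i : ℝ) ^ 2)⁻¹ + (s : ℝ)⁻¹ := by
  refine le_of_tendsto tendsto_sum_Ioc_inv_sq (Filter.eventually_atTop.2 ⟨s, fun n hn => ?_⟩)
  rw [← Finset.sum_Ioc_consecutive _ (Nat.zero_le s) hn]
  gcongr
  exact sum_Ioc_inv_sq_le_inv hs hn

/-- The cubics in the box with an integer root. -/
noncomputable def cubicsWithSomeRoot (n : ℕ) : Finset (ℤ × ℤ × ℤ) :=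
  (Finset.Icc (-((n + 1 : ℕ) : ℤ)) ((n + 1 : ℕ) : ℤ)).biUnion (cubicsWithRoot n)

lemma mem_cubicsWithSomeRoot {n : ℕ} {t : ℤ × ℤ × ℤ} :
    t ∈ cubicsWithSomeRoot n ↔ (|t.1| ≤ n ∧ |t.2.1| ≤ n ∧ |t.2.2| ≤ n) ∧
      ∃ r : ℤ, r ^ 3 + t.1 * r ^ 2 + t.2.1 * r + t.2.2 = 0 := by
  rw [cubicsWithSomeRoot, Finset.mem_biUnion]
  constructor
  · rintro ⟨r, -, h⟩
    obtain ⟨h1, h2⟩ := mem_cubicsWithRoot.1 h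
    exact ⟨h1, r, h2⟩
  · rintro ⟨h1, r, h2⟩
    have h := mem_cubicsWithRoot.2 ⟨h1, h2⟩
    refine ⟨r, Finset.mem_Icc.2 (abs_le.1 ?_), h⟩
    push_cast
    exact abs_root_le h

/-- Counting the cubics of the box with their integer roots in `[-m, m]`. -/
noncomputable def rootCount (n m : ℕ) : ℝ :=
  ∑ r ∈ Finset.Icc (-(m : ℤ)) m, ((cubicsWithRoot n r).card : ℝ)

lemma rootCount_eq (n m : ℕ) : rootCount n m =
    (2 * (n : ℝ) + 1) ^ 2 + 2 * ∑ k ∈ Finset.Ioc 0 m, ((cubicsWithRoot n k).card : ℝ) := by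
  rw [rootCount, Int.sum_Icc_neg_of_even _ (fun r => by rw [card_cubicsWithRoot_neg]),
    card_cubicsWithRoot_zero]
  push_cast; rfl

lemma abs_rootCount_sub_le {n s : ℕ} (hn : 16 ≤ n) (hs : 1 ≤ s) (hsn : s ^ 2 ≤ n) :
    |rootCount n s - 8 * (π ^ 2 / 6 + 1 / 4) * (n : ℝ) ^ 2| ≤
      (10 * n + 1 + 8 * n * s + 8 * (n : ℝ) ^ 2 / s : ℝ) := by
  have hone : ((cubicsWithRoot n (1 : ℕ)).card : ℝ) = 3 * n * (n + 1) := by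
    exact_mod_cast card_cubicsWithRoot_one n
  have hs0 : (0 : ℝ) < s := by exact_mod_cast hs
  have hsum : |∑ k ∈ Finset.Ioc 1 s, ((cubicsWithRoot n k).card : ℝ) -
      4 * (n : ℝ) ^ 2 * ∑ k ∈ Finset.Ioc 1 s, ((k : ℝ) ^ 2)⁻¹| ≤ (s * (4 * n) : ℝ) := by
    rw [Finset.mul_sum, ← Finset.sum_sub_distrib]
    refine (Finset.abs_sum_le_sum_abs _ _).trans
      ((Finset.sum_le_card_nsmul _ _ (4 * (n : ℝ)) ?_).trans ?_)
    · intro k hk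
      rw [Finset.mem_Ioc] at hk
      exact abs_card_cubicsWithRoot_sub_le hn hk.1 ((Nat.pow_le_pow_left hk.2 2).trans hsn)
    · rw [nsmul_eq_mul, Nat.card_Ioc]
      gcongr
      exact Nat.sub_le _ _
  have hz1 := sum_Ioc_inv_sq_le s
  have hz2 := le_sum_Ioc_inv_sq (s := s) (by omega)
  rw [← Finset.sum_Ioc_consecutive _ zero_le_one hs] at hz1 hz2
  have h01 : ∑ k ∈ Finset.Ioc 0 1, (((k : ℕ) : ℝ) ^ 2)⁻¹ = 1 := by simp
  rw [h01] at hz1 hz2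
  rw [rootCount_eq, ← Finset.sum_Ioc_consecutive _ zero_le_one hs]
  have h01' : ∑ k ∈ Finset.Ioc 0 1, ((cubicsWithRoot n (k : ℕ)).card : ℝ) = 3 * n * (n + 1) := by
    rw [← hone]; simp
  rw [h01']
  set Z := ∑ k ∈ Finset.Ioc 1 s, ((k : ℝ) ^ 2)⁻¹
  set W := ∑ k ∈ Finset.Ioc 1 s, ((cubicsWithRoot n k).card : ℝ)
  have h8 : 8 * (n : ℝ) ^ 2 / s = 8 * (n : ℝ) ^ 2 * (s : ℝ)⁻¹ := div_eq_mul_inv _ _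
  have hn2 : 0 ≤ (n : ℝ) ^ 2 := by positivity
  have e1 := mul_le_mul_of_nonneg_left hz1 hn2
  have e2 := mul_le_mul_of_nonneg_left hz2 hn2
  have hn0 : (0 : ℝ) ≤ n := Nat.cast_nonneg n
  rw [h8]
  have hinv : 0 ≤ (n : ℝ) ^ 2 * (s : ℝ)⁻¹ := by positivity
  rw [abs_le] at hsum ⊢
  constructor <;> nlinarith

lemma rootCount_sub_le {n s : ℕ} (hn : 1 ≤ n) (hs : 1 ≤ s) (hsn : s ≤ n + 1) :
    rootCount n (n + 1) - rootCount n s ≤ 48 * ((n : ℝ) ^ 2 / s) := by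
  rw [rootCount_eq, rootCount_eq, ← Finset.sum_Ioc_consecutive _ (Nat.zero_le s) hsn]
  have h : ∑ k ∈ Finset.Ioc s (n + 1), ((cubicsWithRoot n k).card : ℝ) ≤
      24 * (n : ℝ) ^ 2 * ∑ k ∈ Finset.Ioc s (n + 1), ((k : ℝ) ^ 2)⁻¹ := by
    rw [Finset.mul_sum]
    refine Finset.sum_le_sum fun k hk => ?_
    rw [Finset.mem_Ioc] at hk
    refine (card_cubicsWithRoot_le (by omega) (by omega)).trans_eq ?_
    rw [div_eq_mul_inv]; ring
  have h2 := mul_le_mul_of_nonneg_left (sum_Ioc_inv_sq_le_inv (by omega : s ≠ 0) hsn)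
    (by positivity : 0 ≤ 24 * (n : ℝ) ^ 2)
  rw [div_eq_mul_inv]
  linarith

lemma sum_inter_le {n s : ℕ} (hs : 1 ≤ s) :
    ∑ r ∈ Finset.Icc (-(s : ℤ)) s, ∑ r' ∈ (Finset.Icc (-(s : ℤ)) s).erase r,
      ((cubicsWithRoot n r ∩ cubicsWithRoot n r').card : ℝ) ≤ 30 * (n * s) + 9 * (s : ℝ) ^ 2 := by
  set R := Finset.Icc (-(s : ℤ)) s with hR
  set m : ℤ → ℝ := fun r => (max 1 |(r : ℝ)|)⁻¹ with hm
  have hs' : (1 : ℝ) ≤ s := by exact_mod_cast hs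
  have hcard : (R.card : ℝ) ≤ 3 * s := by
    rw [hR, Int.card_Icc]
    have : ((s : ℤ) + 1 - -s).toNat = 2 * s + 1 := by omega
    rw [this]; push_cast; linarith
  have hm2 : ∑ r ∈ R, m r ^ 2 ≤ 5 := by
    rw [hR, Int.sum_Icc_neg_of_even _ (fun r => by simp [hm])]
    have h0 : m 0 = 1 := by simp [hm]
    have h1 : ∑ k ∈ Finset.Ioc 0 s, m ((k : ℕ) : ℤ) ^ 2 =
        ∑ k ∈ Finset.Ioc 0 s, ((k : ℝ) ^ 2)⁻¹ := by
      refine Finset.sum_congr rfl fun k hk => ?_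
      have hk1 : (1 : ℝ) ≤ k := by exact_mod_cast (Finset.mem_Ioc.1 hk).1
      simp only [hm, Int.cast_natCast]
      rw [abs_of_nonneg (by linarith), max_eq_right hk1, inv_pow]
    have h2 := sum_Ioc_inv_sq_le s
    have h3 := Real.pi_lt_d2
    have h4 := Real.pi_pos
    rw [h0, h1]
    nlinarith
  have hsq : (∑ r ∈ R, m r) ^ 2 ≤ 15 * s := by
    refine sq_sum_le_card_mul_sum_sq.trans ?_
    calc (R.card : ℝ) * ∑ r ∈ R, m r ^ 2 ≤ (3 * s) * 5 := by gcongr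
      _ = _ := by ring
  calc _ ≤ ∑ r ∈ R, ∑ r' ∈ R, (2 * n * (m r * m r') + 1) := by
        refine Finset.sum_le_sum fun r _ => ?_
        refine (Finset.sum_le_sum fun r' hr' => card_cubicsWithRoot_inter_le n
          (Finset.ne_of_mem_erase hr').symm).trans ?_
        refine Finset.sum_le_sum_of_subset_of_nonneg (Finset.erase_subset _ _) fun _ _ _ => ?_
        positivity
    _ = 2 * n * (∑ r ∈ R, m r) ^ 2 + (R.card : ℝ) ^ 2 := by
        rw [sq, Finset.sum_mul_sum, Finset.mul_sum]
        simp only [Finset.sum_add_distrib, Finset.mul_sum, Finset.sum_const, nsmul_eq_mul, mul_one]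
        ring
    _ ≤ 2 * n * (15 * s) + (3 * s) ^ 2 := by gcongr
    _ = _ := by ring

/-- The number of reducible cubics in a box. -/
lemma abs_card_cubicsWithSomeRoot_sub_le {n : ℕ} (hn : 1 ≤ n) :
    |((cubicsWithSomeRoot n).card : ℝ) - 8 * (π ^ 2 / 6 + 1 / 4) * (n : ℝ) ^ 2| ≤
      2000 * (n * √n) := by
  have hn' : (1 : ℝ) ≤ n := by exact_mod_cast hn
  have hs1 : 1 ≤ √(n : ℝ) := Real.one_le_sqrt.2 hn'
  have hss : √(n : ℝ) ^ 2 = n := Real.sq_sqrt (by linarith)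
  have hpi := Real.pi_lt_d2
  have hpi0 := Real.pi_pos
  rcases lt_or_ge n 16 with h16 | h16
  · have h16' : (n : ℝ) ≤ 16 := by exact_mod_cast h16.le
    have hs4 : √(n : ℝ) ≤ 4 := by
      rw [Real.sqrt_le_left (by norm_num)]; linarith
    have hcard : ((cubicsWithSomeRoot n).card : ℝ) ≤ (2 * n + 1) ^ 3 := by
      have h1 : cubicsWithSomeRoot n ⊆ cubeBox n := fun t ht =>
        mem_cubeBox.2 (mem_cubicsWithSomeRoot.1 ht).1
      have h2 := Finset.card_le_card h1
      have h3 : ((n : ℤ) + 1 - -n).toNat = 2 * n + 1 := by omega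
      rw [cubeBox, Finset.card_product, Finset.card_product, Int.card_Icc, h3] at h2
      calc ((cubicsWithSomeRoot n).card : ℝ) ≤
          (((2 * n + 1) * ((2 * n + 1) * (2 * n + 1)) : ℕ) : ℝ) := by exact_mod_cast h2
        _ = _ := by push_cast; ring
    have hn2 : (n : ℝ) ^ 2 ≤ 4 * (n * √n) := by
      calc (n : ℝ) ^ 2 = n * √n * √n := by rw [mul_assoc, ← sq, hss, sq]
        _ ≤ n * √n * 4 := by gcongr
        _ = _ := by ring
    have hn3 : (2 * (n : ℝ) + 1) ^ 3 ≤ 27 * (16 * n ^ 2) := by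
      calc (2 * (n : ℝ) + 1) ^ 3 ≤ (3 * (n : ℝ)) ^ 3 := by gcongr; linarith
        _ = 27 * ((n : ℝ) * (n : ℝ) ^ 2) := by ring
        _ ≤ _ := by gcongr
    have hpi2 : π ^ 2 / 6 + 1 / 4 ≤ 2 := by nlinarith
    have h8 : 8 * (π ^ 2 / 6 + 1 / 4) * (n : ℝ) ^ 2 ≤ 16 * (n : ℝ) ^ 2 := by
      gcongr; linarith
    have h80 : 0 ≤ 8 * (π ^ 2 / 6 + 1 / 4) * (n : ℝ) ^ 2 := by positivity
    have h0 : (0 : ℝ) ≤ (cubicsWithSomeRoot n).card := Nat.cast_nonneg _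
    rw [abs_le]
    constructor <;> linarith
  obtain ⟨s, hs⟩ : ∃ s, s = Nat.sqrt n := ⟨_, rfl⟩
  have hsn : s ^ 2 ≤ n := by rw [hs, sq]; exact Nat.sqrt_le n
  have hsn2 : n < (s + 1) ^ 2 := by rw [hs, sq]; exact Nat.lt_succ_sqrt n
  have hs0 : 1 ≤ s := by
    by_contra! h
    have : s = 0 := by omega
    rw [this] at hsn2; omega
  have hs' : (1 : ℝ) ≤ s := by exact_mod_cast hs0
  have hsle : (s : ℝ) ≤ √n := Real.le_sqrt_of_sq_le (by exact_mod_cast hsn)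
  have hsge : √(n : ℝ) ≤ 2 * s := by
    rw [Real.sqrt_le_left (by positivity)]
    have : (n : ℝ) ≤ (s + 1) ^ 2 := by exact_mod_cast hsn2.le
    nlinarith
  have hsn1 : s ≤ n + 1 := by nlinarith
  have hn2s : (n : ℝ) ^ 2 / s ≤ 2 * (n * √n) := by
    rw [div_le_iff₀ (by linarith)]
    calc (n : ℝ) ^ 2 = n * √n * √n := by rw [mul_assoc, ← sq, hss, sq]
      _ ≤ n * √n * (2 * s) := by gcongr
      _ = _ := by ring
  have hns : (n : ℝ) * s ≤ n * √n := by gcongr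
  have hnn : (n : ℝ) ≤ n * √n := le_mul_of_one_le_right (by linarith) hs1
  have hs2n : (s : ℝ) ^ 2 ≤ n := by exact_mod_cast hsn
  have hmain := abs_le.1 (abs_rootCount_sub_le h16 hs0 hsn)
  have htail := rootCount_sub_le hn hs0 hsn1
  have hupper : ((cubicsWithSomeRoot n).card : ℝ) ≤ rootCount n (n + 1) := by
    rw [rootCount, cubicsWithSomeRoot]
    exact_mod_cast Finset.card_biUnion_le
  have hlower : rootCount n s ≤ (cubicsWithSomeRoot n).card + (30 * (n * s) + 9 * (s : ℝ) ^ 2) := by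
    have h1 := Finset.sum_card_le_card_biUnion_add (Finset.Icc (-(s : ℤ)) s) (cubicsWithRoot n)
    have h2 : ((Finset.Icc (-(s : ℤ)) s).biUnion (cubicsWithRoot n)).card ≤
        (cubicsWithSomeRoot n).card := by
      refine Finset.card_le_card (Finset.biUnion_subset_biUnion_of_subset_left _ ?_)
      exact Finset.Icc_subset_Icc (by omega) (by omega)
    have h3 := sum_inter_le (n := n) hs0
    have h4 : rootCount n s ≤ (cubicsWithSomeRoot n).card +
        ∑ r ∈ Finset.Icc (-(s : ℤ)) s, ∑ r' ∈ (Finset.Icc (-(s : ℤ)) s).erase r,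
          ((cubicsWithRoot n r ∩ cubicsWithRoot n r').card : ℝ) := by
      rw [rootCount]
      exact_mod_cast h1.trans (Nat.add_le_add_right h2 _)
    linarith
  have h8 : 8 * (n : ℝ) ^ 2 / s = 8 * (n ^ 2 / s) := by ring
  rw [h8] at hmain
  rw [abs_le]
  constructor <;> linarith

lemma abs_int_cast_le_iff {H : ℝ} (hH : 0 ≤ H) (z : ℤ) : |(z : ℝ)| ≤ H ↔ |z| ≤ (⌊H⌋₊ : ℤ) := by
  rw [← Int.cast_abs, Int.abs_eq_natAbs, Int.cast_natCast, Nat.cast_le, Nat.le_floor_iff hH]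

/-- Van der Waerden's conjecture for cubics: asymptotic for the number of monic cubics
with integer coefficients bounded by `H` whose Galois group is not `S₃`. -/
theorem cubic_vdW :
    ∀ ε : ℝ, 0 < ε → ∃ K : ℝ, 0 < K ∧ ∀ H : ℝ, 2 ≤ H →
      |(Set.ncard {p : ℤ × ℤ × ℤ |
          |(p.1 : ℝ)| ≤ H ∧ |(p.2.1 : ℝ)| ≤ H ∧ |(p.2.2 : ℝ)| ≤ H ∧
          ¬ Nonempty
            ((X ^ 3 + C (p.1 : ℚ) * X ^ 2 + C (p.2.1 : ℚ) * X + C (p.2.2 : ℚ)).Gal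
              ≃* Equiv.Perm (Fin 3))} : ℝ)
        - 8 * (π ^ 2 / 6 + 1 / 4) * H ^ 2| ≤ K * H ^ ((3 : ℝ) / 2 + ε) := by
  classical
  intro ε hε
  obtain ⟨K, hK, hlog⟩ := exists_log_sq_le hε
  refine ⟨10000000 * K + 2040, by positivity, fun H hH => ?_⟩
  obtain ⟨n, hn⟩ : ∃ n, n = ⌊H⌋₊ := ⟨_, rfl⟩
  have hH0 : 0 ≤ H := by linarith
  have hn1 : 1 ≤ n := by rw [hn]; exact Nat.le_floor (by push_cast; linarith)
  have hnH : (n : ℝ) ≤ H := by rw [hn]; exact Nat.floor_le hH0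
  have hHn : H < n + 1 := by rw [hn]; exact Nat.lt_floor_add_one H
  set S : Set (ℤ × ℤ × ℤ) := {p | |(p.1 : ℝ)| ≤ H ∧ |(p.2.1 : ℝ)| ≤ H ∧ |(p.2.2 : ℝ)| ≤ H ∧
    ¬ Nonempty ((X ^ 3 + C (p.1 : ℚ) * X ^ 2 + C (p.2.1 : ℚ) * X + C (p.2.2 : ℚ)).Gal
      ≃* Equiv.Perm (Fin 3))} with hS
  have hbox : ∀ p ∈ S, |p.1| ≤ n ∧ |p.2.1| ≤ n ∧ |p.2.2| ≤ n := by
    rintro p ⟨h1, h2, h3, -⟩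
    rw [hn]
    exact ⟨(abs_int_cast_le_iff hH0 _).1 h1, (abs_int_cast_le_iff hH0 _).1 h2,
      (abs_int_cast_le_iff hH0 _).1 h3⟩
  have hfin : S.Finite := (cubeBox n).finite_toSet.subset fun p hp =>
    Finset.mem_coe.2 (mem_cubeBox.2 (hbox p hp))
  have hred : (cubicsWithSomeRoot n : Set (ℤ × ℤ × ℤ)) ⊆ S := by
    intro p hp
    obtain ⟨⟨h1, h2, h3⟩, r, hr⟩ := mem_cubicsWithSomeRoot.1 (Finset.mem_coe.1 hp)
    rw [hn] at h1 h2 h3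
    exact ⟨(abs_int_cast_le_iff hH0 _).2 h1, (abs_int_cast_le_iff hH0 _).2 h2,
      (abs_int_cast_le_iff hH0 _).2 h3, not_nonempty_gal_equiv_of_root hr⟩
  set T := hfin.toFinset \ cubicsWithSomeRoot n with hT
  have hTmem : ∀ t ∈ T, t ∈ S ∧ t ∉ cubicsWithSomeRoot n := by
    intro t ht
    rw [hT, Finset.mem_sdiff, Set.Finite.mem_toFinset] at ht
    exact ht
  have hroot : ∀ t ∈ T, ∀ r : ℤ, r ^ 3 + t.1 * r ^ 2 + t.2.1 * r + t.2.2 ≠ 0 := fun t ht r hr =>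
    (hTmem t ht).2 (mem_cubicsWithSomeRoot.2 ⟨hbox t (hTmem t ht).1, r, hr⟩)
  have hTcard := Eisenstein.card_le_of_disc_sq T hn1
    (fun t ht => by
      obtain ⟨h1, h2, h3⟩ := hbox t (hTmem t ht).1
      exact ⟨by exact_mod_cast h1, by exact_mod_cast h2, by exact_mod_cast h3⟩)
    hroot (fun t ht => exists_cubicDisc_eq_sq (hroot t ht) (hTmem t ht).1.2.2.2)
  have hcard : (S.ncard : ℝ) = (cubicsWithSomeRoot n).card + T.card := by
    rw [Set.ncard_eq_toFinset_card S hfin, hT, add_comm, ← Nat.cast_add,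
      Finset.card_sdiff_add_card_eq_card]
    intro p hp
    exact hfin.mem_toFinset.2 (hred hp)
  have hredcard := abs_card_cubicsWithSomeRoot_sub_le hn1
  have hn0 : (0 : ℝ) ≤ n := Nat.cast_nonneg n
  have hHpos : 0 < H := by linarith
  have hH1 : 1 ≤ H := by linarith
  have hsqrt : (n : ℝ) * √n ≤ H ^ ((3 : ℝ) / 2) := by
    have h1 : H ^ ((3 : ℝ) / 2) = H * √H := by
      rw [Real.sqrt_eq_rpow, ← Real.rpow_one_add' hH0 (by norm_num)]; norm_num
    rw [h1]; gcongr
  have hpow : H ^ ((3 : ℝ) / 2 + ε) = H ^ ((3 : ℝ) / 2) * H ^ ε := Real.rpow_add hHpos _ _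
  have hHε : 1 ≤ H ^ ε := Real.one_le_rpow hH1 hε.le
  have hH32 : H ≤ H ^ ((3 : ℝ) / 2) := Real.self_le_rpow_of_one_le hH1 (by norm_num)
  have hle : H ^ ((3 : ℝ) / 2) ≤ H ^ ((3 : ℝ) / 2 + ε) := by
    rw [hpow]; exact le_mul_of_one_le_right (by positivity) hHε
  have hTle : (T.card : ℝ) ≤ 10000000 * K * H ^ ((3 : ℝ) / 2 + ε) := by
    calc (T.card : ℝ) ≤ _ := hTcard
      _ ≤ (K * (n : ℝ) ^ ε) * (10000000 * H ^ ((3 : ℝ) / 2)) := by gcongr; exact hlog n hn1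
      _ ≤ (K * H ^ ε) * (10000000 * H ^ ((3 : ℝ) / 2)) := by gcongr
      _ = _ := by rw [hpow]; ring
  have hT0 : (0 : ℝ) ≤ T.card := Nat.cast_nonneg _
  have hc : 8 * (π ^ 2 / 6 + 1 / 4) ≤ 16 := by
    have := Real.pi_lt_d2
    have := Real.pi_pos
    nlinarith
  have hc0 : 0 ≤ 8 * (π ^ 2 / 6 + 1 / 4) := by positivity
  have hdiff : 8 * (π ^ 2 / 6 + 1 / 4) * H ^ 2 - 8 * (π ^ 2 / 6 + 1 / 4) * (n : ℝ) ^ 2 ≤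
      32 * H := by
    have h1 : H ^ 2 - (n : ℝ) ^ 2 ≤ 2 * H := by nlinarith
    have h2 : 0 ≤ H ^ 2 - (n : ℝ) ^ 2 := by nlinarith
    nlinarith
  have hdiff0 : 8 * (π ^ 2 / 6 + 1 / 4) * (n : ℝ) ^ 2 ≤ 8 * (π ^ 2 / 6 + 1 / 4) * H ^ 2 := by
    gcongr
  rw [hcard]
  rw [abs_le] at hredcard ⊢
  constructor <;> nlinarith
end

section
/- For every ε > 0 there exists a constant C > 0 such that for all real H ≥ 2, the number of triples (a,b,c) of integers with |a|,|b|,|c| ≤ H such that f(X) = X³ + aX² + bX + c is irreducible over ℚ and the Galois group of its splitting field over ℚ is not isomorphic to the symmetric group S₃ (equivalently, is cyclic of order 3) is at most C·H^{3/2+ε}. -/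
open Polynomial

/-- The ring `ℤ[ω]` of Eisenstein integers, where `ω² = -1 - ω`. -/
abbrev EisensteinInt : Type := QuadraticAlgebra ℤ (-1) (-1)

namespace EisensteinInt

open QuadraticAlgebra

theorem norm_eq (z : EisensteinInt) : z.norm = z.re ^ 2 - z.re * z.im + z.im ^ 2 := by
  rw [norm_def]; ring

theorem norm_nonneg (z : EisensteinInt) : 0 ≤ z.norm := by
  rw [norm_eq]; nlinarith [sq_nonneg (z.re - z.im), sq_nonneg (z.re + z.im)]

theorem norm_eq_zero {z : EisensteinInt} : z.norm = 0 ↔ z = 0 := by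
  refine ⟨fun h => ?_, fun h => by simp [h]⟩
  rw [norm_eq] at h
  have h1 : z.re = 0 := by
    have : 3 * z.re ^ 2 + (2 * z.im - z.re) ^ 2 = 0 := by linarith
    exact pow_eq_zero_iff two_ne_zero |>.1 (by nlinarith [sq_nonneg (2 * z.im - z.re)])
  have h2 : z.im = 0 := by simpa [h1] using h
  ext <;> simp [h1, h2]

theorem norm_pos {z : EisensteinInt} (hz : z ≠ 0) : 0 < z.norm :=
  lt_of_le_of_ne (norm_nonneg z) (Ne.symm (mt norm_eq_zero.1 hz))

instance : NoZeroDivisors EisensteinInt where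
  eq_zero_or_eq_zero_of_mul_eq_zero {x y} h := by
    have := congrArg QuadraticAlgebra.norm h
    rw [map_mul, QuadraticAlgebra.norm_zero, mul_eq_zero] at this
    exact this.imp norm_eq_zero.1 norm_eq_zero.1

instance : IsDomain EisensteinInt := NoZeroDivisors.to_isDomain _

theorem mul_star_self (z : EisensteinInt) : z * star z = (z.norm : EisensteinInt) := by
  rw [← algebraMap_norm_eq_mul_star]; simp

theorem isUnit_iff_norm_eq_one {z : EisensteinInt} : IsUnit z ↔ z.norm = 1 := by
  rw [isUnit_iff_norm_isUnit, Int.isUnit_iff]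
  have := norm_nonneg z
  omega

theorem exists_norm_sub_mul_lt (x : EisensteinInt) {y : EisensteinInt} (hy : y ≠ 0) :
    ∃ q : EisensteinInt, (x - y * q).norm < y.norm := by
  have hN := norm_pos hy
  set N := y.norm with hNdef
  have key : ∀ A : ℤ, ∃ k : ℤ, |2 * (A - N * k)| ≤ N := by
    intro A
    refine ⟨round ((A : ℚ) / N), ?_⟩
    have h := abs_sub_round ((A : ℚ) / N)
    have hNq : (0 : ℚ) < N := by exact_mod_cast hN
    have h2 : |2 * ((A : ℚ) - N * round ((A : ℚ) / N))| ≤ N := by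
      have : 2 * ((A : ℚ) - N * round ((A : ℚ) / N))
          = (2 * N) * ((A : ℚ) / N - round ((A : ℚ) / N)) := by field_simp
      rw [this, abs_mul, abs_of_pos (by positivity)]
      nlinarith
    exact_mod_cast h2
  obtain ⟨k, hk⟩ := key (x * star y).re
  obtain ⟨l, hl⟩ := key (x * star y).im
  refine ⟨⟨k, l⟩, ?_⟩
  have h1 : (x - y * ⟨k, l⟩).norm * N
      = ((x * star y).re - N * k) ^ 2 - ((x * star y).re - N * k) * ((x * star y).im - N * l)
        + ((x * star y).im - N * l) ^ 2 := by
    rw [hNdef, ← norm_star y, ← map_mul, sub_mul, mul_right_comm, mul_star_self, norm_eq]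
    simp
  set u := (x * star y).re - N * k
  set v := (x * star y).im - N * l
  rw [abs_le] at hk hl
  have hb : 4 * (u ^ 2 - u * v + v ^ 2) ≤ 3 * N ^ 2 := by
    nlinarith [mul_nonneg (by linarith [hk.1] : 0 ≤ 2 * u + N) (by linarith [hk.2] : 0 ≤ N - 2 * u),
      mul_nonneg (by linarith [hl.1] : 0 ≤ 2 * v + N) (by linarith [hl.2] : 0 ≤ N - 2 * v),
      mul_nonneg (by linarith [hk.1] : 0 ≤ 2 * u + N) (by linarith [hl.2] : 0 ≤ N - 2 * v),
      mul_nonneg (by linarith [hl.1] : 0 ≤ 2 * v + N) (by linarith [hk.2] : 0 ≤ N - 2 * u),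
      mul_nonneg (by linarith [hk.1] : 0 ≤ 2 * u + N) (by linarith [hl.1] : 0 ≤ N + 2 * v),
      mul_nonneg (by linarith [hl.2] : 0 ≤ N - 2 * v) (by linarith [hk.2] : 0 ≤ N - 2 * u)]
  nlinarith

instance : IsPrincipalIdealRing EisensteinInt where
  principal I := by
    by_cases hI : I = ⊥
    · exact hI ▸ ⟨⟨0, by simp⟩⟩
    obtain ⟨x, hxI, hx0⟩ := Submodule.exists_mem_ne_zero_of_ne_bot hI
    have hne : {y : EisensteinInt | y ∈ I ∧ y ≠ 0}.Nonempty := ⟨x, hxI, hx0⟩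
    obtain ⟨y, ⟨hyI, hy0⟩, hmin⟩ :=
      (measure fun y : EisensteinInt => y.norm.natAbs).wf.has_min _ hne
    refine ⟨⟨y, le_antisymm (fun z hz => ?_) ((Submodule.span_singleton_le_iff_mem _ _).2 hyI)⟩⟩
    obtain ⟨q, hq⟩ := exists_norm_sub_mul_lt z hy0
    have hmem : z - y * q ∈ I := I.sub_mem hz (I.mul_mem_right q hyI)
    by_cases h0 : z - y * q = 0
    · exact Ideal.mem_span_singleton.2 ⟨q, sub_eq_zero.1 h0⟩
    · refine absurd ?_ (hmin _ ⟨hmem, h0⟩)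
      have := norm_nonneg (z - y * q)
      have := norm_nonneg y
      change (z - y * q).norm.natAbs < y.norm.natAbs
      omega

theorem star_dvd_star {x y : EisensteinInt} (h : x ∣ y) : star x ∣ star y := by
  obtain ⟨k, rfl⟩ := h
  exact ⟨star k, by rw [star_mul']⟩

theorem prime_star {x : EisensteinInt} (h : Prime x) : Prime (star x) := by
  have := (MulEquiv.prime_iff (starMulAut (R := EisensteinInt)) (p := x)).2 h
  simpa using this

/-- If the norm of `z` is a cube, then every prime divisor `π` of `z` satisfies one of
`π³ ∣ z`, `π² π̄ ∣ z`, `π π̄² ∣ z`, where one may interchange `π` and `π̄`. -/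
theorem dvd_of_prime_dvd {z p : EisensteinInt} {n : ℤ} (hp : Prime p) (hz : z ≠ 0)
    (hn : z.norm = n ^ 3) (hpz : p ∣ z) :
    ∃ q : EisensteinInt, Prime q ∧ (q ^ 3 ∣ z ∨ q ^ 2 * star q ∣ z) := by
  have hzn : z * star z = (n : EisensteinInt) ^ 3 := by
    rw [mul_star_self, hn]; simp
  have hpn : p ∣ (n : EisensteinInt) := hp.dvd_of_dvd_pow (hzn ▸ hpz.mul_right _)
  have hst : ∀ k : ℕ, p ^ k ∣ star z → star p ^ k ∣ z := fun k h => by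
    simpa using star_dvd_star h
  have hst' : ∀ k : ℕ, star p ^ k ∣ z → p ^ k ∣ star z := fun k h => by
    simpa using star_dvd_star h
  have hsp := prime_star hp
  have hz' : star z ≠ 0 := by simpa using hz
  have h3 : p ^ 3 ∣ z * star z := hzn ▸ pow_dvd_pow_of_dvd hpn 3
  have hfz : FiniteMultiplicity p z := FiniteMultiplicity.of_prime_left hp hz
  have hfz' : FiniteMultiplicity p (star z) := FiniteMultiplicity.of_prime_left hp hz'
  have hf := FiniteMultiplicity.of_prime_left hp (mul_ne_zero hz hz')
  have hm := multiplicity_mul hp hf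
  by_cases hass : Associated p (star p)
  · have hmm : multiplicity p z = multiplicity p (star z) := by
      rw [← multiplicity_map_eq (starMulAut (R := EisensteinInt)) (a := p), starMulAut_apply,
        starMulAut_apply]
      exact multiplicity_eq_of_associated_left hass
    have hn0 : (n : EisensteinInt) ≠ 0 := by
      intro h; rw [h] at hzn; simp [hz] at hzn
    have hfn : FiniteMultiplicity p (n : EisensteinInt) := FiniteMultiplicity.of_prime_left hp hn0
    have h33 : multiplicity p ((n : EisensteinInt) ^ 3) = 3 * multiplicity p (n : EisensteinInt) :=
      hfn.multiplicity_pow hp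
    have hpos : 1 ≤ multiplicity p z := hfz.pow_dvd_iff_le_multiplicity.1 (by simpa using hpz)
    exact ⟨p, hp, Or.inl (hfz.pow_dvd_iff_le_multiplicity.2 (by rw [hzn] at hm; omega))⟩
  · have hco : ∀ i j : ℕ, p ^ i ∣ z → star p ^ j ∣ z → p ^ i * star p ^ j ∣ z := by
      intro i j hi hj
      refine IsCoprime.mul_dvd (IsCoprime.pow ?_) hi hj
      exact (hp.irreducible.coprime_iff_not_dvd).2 fun h =>
        hass (hp.irreducible.associated_of_dvd hsp.irreducible h)
    have hle : 3 ≤ multiplicity p z + multiplicity p (star z) := by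
      rw [← hm]; exact hf.pow_dvd_iff_le_multiplicity.1 h3
    have hi : p ^ multiplicity p z ∣ z := pow_multiplicity_dvd _ _
    have hj := hst _ (pow_multiplicity_dvd p (star z))
    have h' := hco _ _ hi hj
    generalize multiplicity p z = i at *
    generalize multiplicity p (star z) = j at *
    have hd : ∀ k l : ℕ, k ≤ i → l ≤ j → p ^ k * star p ^ l ∣ z := fun k l hk hl =>
      (mul_dvd_mul (pow_dvd_pow _ hk) (pow_dvd_pow _ hl)).trans h'
    rcases (by omega : 3 ≤ i ∨ (2 ≤ i ∧ 1 ≤ j) ∨ (2 ≤ j ∧ 1 ≤ i) ∨ 3 ≤ j) with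
      h | ⟨h, k⟩ | ⟨h, k⟩ | h
    · exact ⟨p, hp, Or.inl (by simpa using hd 3 0 h (by simp))⟩
    · exact ⟨p, hp, Or.inr (by simpa using hd 2 1 h k)⟩
    · exact ⟨star p, hsp, Or.inr (by simpa [mul_comm] using hd 1 2 k h)⟩
    · exact ⟨star p, hsp, Or.inl (by simpa using hd 0 3 (by simp) h)⟩

/-- An Eisenstein integer whose norm is a cube has the form `β² β̄ r³`. -/
theorem exists_eq_sq_mul_star_mul_cube (z : EisensteinInt) (n : ℤ) (hz : z ≠ 0)
    (hn : z.norm = n ^ 3) : ∃ β r : EisensteinInt, z = β ^ 2 * star β * r ^ 3 := by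
  induction hk : z.norm.natAbs using Nat.strong_induction_on generalizing z n with
  | _ k ih =>
    by_cases hu : IsUnit z
    · refine ⟨z, 1, ?_⟩
      rw [pow_two, mul_assoc z, mul_star_self, isUnit_iff_norm_eq_one.1 hu]
      simp
    · obtain ⟨p, hp, hpz⟩ := WfDvdMonoid.exists_irreducible_factor hu hz
      obtain ⟨q, hq, hqz⟩ := dvd_of_prime_dvd hp.prime hz hn hpz
      have hq1 : 1 < q.norm := by
        have := norm_pos hq.ne_zero
        have := mt isUnit_iff_norm_eq_one.2 hq.not_isUnit
        omega
      have descend : ∀ w t : EisensteinInt, w.norm = q.norm ^ 3 → z = w * t →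
          ∃ β r : EisensteinInt, t = β ^ 2 * star β * r ^ 3 := by
        intro w t hw hzt
        have hmul : q.norm ^ 3 * t.norm = n ^ 3 := by rw [← hw, ← map_mul, ← hzt, hn]
        obtain ⟨m, rfl⟩ := (Int.pow_dvd_pow_iff three_ne_zero).1 ⟨_, hmul.symm⟩
        have ht0 : t ≠ 0 := by rintro rfl; simp [hz] at hzt
        have htm : t.norm = m ^ 3 := by
          have h0 : q.norm ^ 3 ≠ 0 := by positivity
          exact mul_left_cancel₀ h0 (by rw [hmul]; ring)
        refine ih t.norm.natAbs ?_ t m ht0 htm rfl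
        have h1 : z.norm = q.norm ^ 3 * t.norm := by rw [hzt, map_mul, hw]
        have h2 := norm_pos ht0
        have h3 : t.norm < z.norm := by
          rw [h1]; nlinarith [one_lt_pow₀ hq1 three_ne_zero]
        omega
      rcases hqz with ⟨t, ht⟩ | ⟨t, ht⟩
      · obtain ⟨β, r, rfl⟩ := descend _ t (by simp) ht
        exact ⟨β, q * r, by rw [ht]; ring⟩
      · obtain ⟨β, r, rfl⟩ := descend _ t (by simp [QuadraticAlgebra.norm_star]; ring) ht
        exact ⟨q * β, r, by rw [ht, star_mul']; ring⟩

theorem norm_mul_norm_eq_of_eq_sq_mul_star_mul_cube {β r : EisensteinInt} {n : ℤ}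
    (h : (β ^ 2 * star β * r ^ 3).norm = n ^ 3) : β.norm * r.norm = n := by
  have : (β.norm * r.norm) ^ 3 = n ^ 3 := by
    rw [← h]; simp [QuadraticAlgebra.norm_star]; ring
  exact (Odd.strictMono_pow (by decide : Odd 3)).injective this

end EisensteinInt

theorem Polynomial.Gal.card_eq_three_of_not_equiv_perm {K : Type*} [Field K] [CharZero K]
    {p : K[X]} (hp : Irreducible p)
    (hdeg : p.natDegree = 3) (h : ¬ Nonempty (p.Gal ≃* Equiv.Perm (Fin 3))) :
    Nat.card p.Gal = 3 := by
  classical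
  have : Fact ((p.map (algebraMap K p.SplittingField)).Splits) := ⟨SplittingField.splits p⟩
  have h3 : 3 ∣ Nat.card p.Gal := by
    rw [← hdeg]; exact Gal.prime_degree_dvd_card hp (by rw [hdeg]; exact Nat.prime_three)
  have hcard : Nat.card (p.rootSet p.SplittingField) = 3 := by
    rw [Nat.card_eq_fintype_card, ← hdeg]
    exact card_rootSet_eq_natDegree hp.separable (SplittingField.splits p)
  let e : p.rootSet p.SplittingField ≃ Fin 3 := Finite.equivFinOfCardEq hcard
  let φ : p.Gal →* Equiv.Perm (Fin 3) :=
    e.permCongrHom.toMonoidHom.comp (Gal.galActionHom p p.SplittingField)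
  have hφ : Function.Injective φ :=
    e.permCongrHom.injective.comp (Gal.galActionHom_injective p p.SplittingField)
  have h6 : Nat.card (Equiv.Perm (Fin 3)) = 6 := by
    rw [Nat.card_eq_fintype_card]; rfl
  have hdvd : Nat.card p.Gal ∣ 6 := h6 ▸ Subgroup.card_dvd_of_injective φ hφ
  have hne : Nat.card p.Gal ≠ 6 := fun h' =>
    h ⟨MulEquiv.ofBijective φ
      ((Nat.bijective_iff_injective_and_card φ).2 ⟨hφ, by rw [h', h6]⟩)⟩
  have hle := Nat.le_of_dvd (by norm_num) hdvd
  interval_cases Nat.card p.Gal <;> omega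

theorem AlgEquiv.apply_eq_self_of_pow_three_eq_one {K E : Type*} [Field K] [Field E] [CharZero E]
    [Algebra K E] {σ : E ≃ₐ[K] E} (hσ : σ ^ 3 = 1) {x : E} {d : K}
    (hx : algebraMap K E d = x ^ 2) : σ x = x := by
  have hsq : σ x ^ 2 = x ^ 2 := by rw [← map_pow, ← hx, AlgEquiv.commutes]
  rcases sq_eq_sq_iff_eq_or_eq_neg.1 hsq with h | h
  · exact h
  · have h2 : (σ ^ 3) x = -x := by
      rw [pow_succ, pow_two]
      simp [h]
    rw [hσ] at h2
    rw [h]; exact h2.symm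

theorem Cubic.isSquare_discr_of_not_equiv_perm {K : Type*} [Field K] [CharZero K]
    {P : Cubic K} (ha : P.a ≠ 0) (hP : Irreducible P.toPoly)
    (h : ¬ Nonempty (P.toPoly.Gal ≃* Equiv.Perm (Fin 3))) :
    IsSquare P.discr ∧ P.discr ≠ 0 := by
  have hdeg : P.toPoly.natDegree = 3 := Cubic.natDegree_of_a_ne_zero ha
  have hcard := Polynomial.Gal.card_eq_three_of_not_equiv_perm hP hdeg h
  have : IsGalois K P.toPoly.SplittingField :=
    IsGalois.of_separable_splitting_field hP.separable
  have hsplit : (P.toPoly.map (algebraMap K P.toPoly.SplittingField)).Splits :=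
    SplittingField.splits _
  obtain ⟨x, y, z, h3⟩ := (Cubic.splits_iff_roots_eq_three ha).1 hsplit
  have hD := Cubic.discr_eq_prod_three_roots ha h3
  set δ : P.toPoly.SplittingField := algebraMap K P.toPoly.SplittingField P.a *
    algebraMap K P.toPoly.SplittingField P.a * (x - y) * (x - z) * (y - z)
  refine ⟨?_, ?_⟩
  · have := charZero_of_injective_algebraMap
      (algebraMap K P.toPoly.SplittingField).injective
    have hfix : ∀ σ : P.toPoly.Gal, σ δ = δ := by
      intro σ
      exact AlgEquiv.apply_eq_self_of_pow_three_eq_one (hcard ▸ pow_card_eq_one') hD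
    obtain ⟨q, hq⟩ := (IsGalois.mem_range_algebraMap_iff_fixed δ).2 hfix
    refine ⟨q, (algebraMap K P.toPoly.SplittingField).injective ?_⟩
    rw [hD, map_mul, hq, pow_two]
  · rw [Cubic.discr_ne_zero_iff_roots_nodup ha hsplit, Cubic.map_roots]
    exact nodup_roots (hP.separable.map)

theorem isSquare_discr_of_not_equiv_perm {K : Type*} [Field K] [CharZero K] {a b c : K}
    (hirr : Irreducible (X ^ 3 + C a * X ^ 2 + C b * X + C c))
    (h : ¬ Nonempty ((X ^ 3 + C a * X ^ 2 + C b * X + C c).Gal ≃* Equiv.Perm (Fin 3))) :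
    IsSquare (a ^ 2 * b ^ 2 - 4 * b ^ 3 - 4 * a ^ 3 * c - 27 * c ^ 2 + 18 * a * b * c) ∧
      a ^ 2 * b ^ 2 - 4 * b ^ 3 - 4 * a ^ 3 * c - 27 * c ^ 2 + 18 * a * b * c ≠ 0 := by
  have hP : X ^ 3 + C a * X ^ 2 + C b * X + C c = (⟨1, a, b, c⟩ : Cubic K).toPoly := by
    simp [Cubic.toPoly]
  have hd : a ^ 2 * b ^ 2 - 4 * b ^ 3 - 4 * a ^ 3 * c - 27 * c ^ 2 + 18 * a * b * c
      = (⟨1, a, b, c⟩ : Cubic K).discr := by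
    simp only [Cubic.discr]; ring
  rw [hP] at hirr h
  rw [hd]
  exact Cubic.isSquare_discr_of_not_equiv_perm one_ne_zero hirr h

theorem exists_sq_eq_discr {a b c : ℤ}
    (hirr : Irreducible (X ^ 3 + C (a : ℚ) * X ^ 2 + C (b : ℚ) * X + C (c : ℚ)))
    (h : ¬ Nonempty ((X ^ 3 + C (a : ℚ) * X ^ 2 + C (b : ℚ) * X + C (c : ℚ)).Gal
      ≃* Equiv.Perm (Fin 3))) :
    ∃ y : ℤ, y ≠ 0 ∧
      y ^ 2 = a ^ 2 * b ^ 2 - 4 * b ^ 3 - 4 * a ^ 3 * c - 27 * c ^ 2 + 18 * a * b * c := by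
  obtain ⟨h1, h2⟩ := isSquare_discr_of_not_equiv_perm hirr h
  have hd : (a ^ 2 * b ^ 2 - 4 * b ^ 3 - 4 * a ^ 3 * c - 27 * c ^ 2 + 18 * a * b * c : ℚ)
      = ((a ^ 2 * b ^ 2 - 4 * b ^ 3 - 4 * a ^ 3 * c - 27 * c ^ 2 + 18 * a * b * c : ℤ) : ℚ) := by
    push_cast; ring
  rw [hd] at h1 h2
  obtain ⟨y, hy⟩ := Rat.isSquare_intCast_iff.1 h1
  refine ⟨y, ?_, by rw [hy, pow_two]⟩
  rintro rfl
  exact h2 (by rw [hy]; simp)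

namespace EisensteinInt

open Complex ComplexConjugate

/-- The primitive cube root of unity `(-1 + √3 i) / 2`. -/
noncomputable def zeta : ℂ := ⟨-1 / 2, √3 / 2⟩

theorem zeta_mul_zeta : zeta * zeta = -1 - zeta := by
  have h3 : √3 * √3 = 3 := Real.mul_self_sqrt (by norm_num)
  apply Complex.ext
  · simp [zeta]; nlinarith
  · simp [zeta]; ring

theorem zeta_cube : zeta ^ 3 = 1 := by
  rw [pow_succ, pow_two, zeta_mul_zeta, sub_mul, zeta_mul_zeta]; ring

theorem norm_zeta : ‖zeta‖ = 1 :=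
  (pow_eq_one_iff_of_nonneg (_root_.norm_nonneg _) three_ne_zero).1
    (by rw [← norm_pow, zeta_cube, norm_one])

/-- The embedding of the Eisenstein integers into `ℂ`. -/
noncomputable def toComplex : EisensteinInt →ₐ[ℤ] ℂ :=
  QuadraticAlgebra.lift ⟨zeta, by rw [zeta_mul_zeta]; simp [sub_eq_add_neg]⟩

theorem toComplex_apply (z : EisensteinInt) : toComplex z = z.re + z.im * zeta := by
  simp [toComplex, QuadraticAlgebra.lift]

theorem toComplex_im (z : EisensteinInt) : (toComplex z).im = √3 / 2 * z.im := by
  simp [toComplex_apply, zeta]; ring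

theorem toComplex_star (z : EisensteinInt) : toComplex (star z) = conj (toComplex z) := by
  apply Complex.ext
  · simp [toComplex_apply, zeta]; ring
  · simp [toComplex_apply, zeta]

theorem normSq_toComplex (z : EisensteinInt) :
    normSq (toComplex z) = (QuadraticAlgebra.norm z : ℤ) := by
  have h3 : √3 * √3 = 3 := Real.mul_self_sqrt (by norm_num)
  rw [norm_eq]
  simp [toComplex_apply, zeta, normSq_apply]
  linear_combination (z.im ^ 2 / 4 : ℝ) * h3

/-- The imaginary part of `ξ γ`, for a fixed complex number `ξ` of modulus one, is a linear form
in the coordinates of `γ` whose coefficients are not both small. -/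
theorem exists_linear_form {ξ : ℂ} (hξ : ‖ξ‖ = 1) :
    ∃ p q : ℝ, (1 / 2 ≤ |p| ∨ 1 / 2 ≤ |q|) ∧
      ∀ γ : EisensteinInt, (ξ * toComplex γ).im = p * γ.re + q * γ.im := by
  refine ⟨ξ.im, (ξ * zeta).im, ?_, fun γ => ?_⟩
  · by_contra! h
    obtain ⟨h1, h2⟩ := h
    have h3 : √3 * √3 = 3 := Real.mul_self_sqrt (by norm_num)
    have hn : ξ.re * ξ.re + ξ.im * ξ.im = 1 := by
      rw [← normSq_apply, normSq_eq_norm_sq, hξ]; norm_num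
    simp only [mul_im, zeta] at h2
    rw [← sq_lt_sq₀ (abs_nonneg _) (by norm_num), sq_abs] at h1 h2
    set x := ξ.re
    set y := ξ.im
    have hx : (√3 * x) ^ 2 = 3 * x ^ 2 := by nlinarith
    have e1 : (√3 * x - y) ^ 2 < 1 := by nlinarith
    nlinarith [sq_nonneg (√3 * x - 2 * y), sq_nonneg (√3 * x - 3 * y)]
  · simp [toComplex_apply]; ring

theorem im_sq_mul_normSq_sq_le {s : ℂ} (hs : 3 * s.im ^ 2 ≤ s.re ^ 2) :
    s.im ^ 2 * normSq s ^ 2 ≤ (s ^ 3).im ^ 2 := by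
  have : (s ^ 3).im = s.im * (3 * s.re ^ 2 - s.im ^ 2) := by
    simp [pow_succ]; ring
  rw [this, normSq_apply, mul_pow]
  refine mul_le_mul_of_nonneg_left ?_ (sq_nonneg _)
  exact pow_le_pow_left₀ (by nlinarith [sq_nonneg s.re, sq_nonneg s.im])
    (by nlinarith [sq_nonneg s.im]) 2

theorem exists_im_sq_mul_normSq_sq_le (s : ℂ) :
    ∃ j : Fin 3, (zeta ^ (j : ℕ) * s).im ^ 2 * normSq s ^ 2 ≤ (s ^ 3).im ^ 2 := by
  suffices h : ∃ j : Fin 3,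
      3 * (zeta ^ (j : ℕ) * s).im ^ 2 ≤ (zeta ^ (j : ℕ) * s).re ^ 2 by
    obtain ⟨j, hj⟩ := h
    refine ⟨j, ?_⟩
    have := im_sq_mul_normSq_sq_le hj
    rwa [mul_pow, ← pow_mul, mul_comm (j : ℕ), pow_mul, zeta_cube, one_pow, one_mul, normSq_mul,
      normSq_eq_norm_sq (zeta ^ _), norm_pow, norm_zeta, one_pow, one_pow, one_mul] at this
  by_contra! h
  have h3 : √3 * √3 = 3 := Real.mul_self_sqrt (by norm_num)
  have h0 := h 0
  have h1 := h 1
  have h2 := h 2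
  simp [pow_two, zeta_mul_zeta] at h0 h1 h2
  simp [zeta] at h0 h1 h2
  set x := s.re
  set y := s.im
  have e1 : 0 < x ^ 2 - √3 * x * y := by nlinarith
  have e2 : 0 < x ^ 2 + √3 * x * y := by nlinarith
  have e3 : (x ^ 2 - √3 * x * y) * (x ^ 2 + √3 * x * y) = x ^ 2 * (x ^ 2 - 3 * y ^ 2) := by
    linear_combination (-x ^ 2 * y ^ 2) * h3
  nlinarith [mul_pos e1 e2, sq_nonneg x]

theorem exists_linear_form_le_of_cube {δ : EisensteinInt} (hδ : δ ≠ 0) :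
    ∃ p q : ℝ, (1 / 2 ≤ |p| ∨ 1 / 2 ≤ |q|) ∧ ∀ γ : EisensteinInt,
      (p * γ.re + q * γ.im) ^ 2 * (QuadraticAlgebra.norm δ : ℤ) ^ 3
          * (QuadraticAlgebra.norm γ : ℤ) ^ 2
        ≤ 3 / 4 * (γ ^ 2 * star γ * δ ^ 3).im ^ 2 := by
  have hD : toComplex δ ≠ 0 := by
    rw [← normSq_pos, normSq_toComplex]; exact_mod_cast norm_pos hδ
  have hD' : (‖toComplex δ‖ : ℂ) ≠ 0 := by simpa using hD
  obtain ⟨p, q, hpq, h⟩ := exists_linear_form (ξ := (toComplex δ / ‖toComplex δ‖) ^ 3)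
    (by simp [hD])
  refine ⟨p, q, hpq, fun γ => le_of_eq ?_⟩
  have h3 : √3 ^ 2 = 3 := Real.sq_sqrt (by norm_num)
  have e1 : (γ ^ 2 * star γ * δ ^ 3).im ^ 2 * (3 / 4 : ℝ)
      = (toComplex (γ ^ 2 * star γ * δ ^ 3)).im ^ 2 := by
    rw [toComplex_im, mul_pow, div_pow, h3]; ring
  have e2 : toComplex (γ ^ 2 * star γ * δ ^ 3)
      = ((normSq (toComplex γ) * ‖toComplex δ‖ ^ 3 : ℝ) : ℂ)
        * ((toComplex δ / ‖toComplex δ‖) ^ 3 * toComplex γ) := by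
    push_cast
    rw [← mul_conj, map_mul, map_mul, map_pow, map_pow, toComplex_star]
    field_simp
  rw [← h, mul_comm (3 / 4 : ℝ), e1, e2, im_ofReal_mul, ← normSq_toComplex, ← normSq_toComplex,
    normSq_eq_norm_sq (toComplex δ)]
  ring

theorem exists_linear_forms_le_of_sq_mul_star {δ : EisensteinInt} (hδ : δ ≠ 0) :
    ∃ p q : Fin 3 → ℝ, (∀ j, 1 / 2 ≤ |p j| ∨ 1 / 2 ≤ |q j|) ∧ ∀ γ : EisensteinInt, ∃ j,
      (p j * γ.re + q j * γ.im) ^ 2 * (QuadraticAlgebra.norm δ : ℤ) ^ 3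
          * (QuadraticAlgebra.norm γ : ℤ) ^ 2
        ≤ 3 / 4 * (δ ^ 2 * star δ * γ ^ 3).im ^ 2 := by
  have hD : toComplex δ ≠ 0 := by
    rw [← normSq_pos, normSq_toComplex]; exact_mod_cast norm_pos hδ
  have hD' : (‖toComplex δ‖ : ℂ) ≠ 0 := by simpa using hD
  obtain ⟨ρ, hρ⟩ := IsAlgClosed.exists_pow_nat_eq (toComplex δ / ‖toComplex δ‖) three_pos
  have hρ1 : ‖ρ‖ = 1 :=
    (pow_eq_one_iff_of_nonneg (_root_.norm_nonneg _) three_ne_zero).1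
      (by rw [← norm_pow, hρ]; simp [hD])
  choose p q hpq h using fun j : Fin 3 =>
    exists_linear_form (ξ := zeta ^ (j : ℕ) * ρ) (by simp [hρ1, norm_zeta])
  refine ⟨p, q, hpq, fun γ => ?_⟩
  obtain ⟨j, hj⟩ := exists_im_sq_mul_normSq_sq_le (ρ * toComplex γ)
  refine ⟨j, ?_⟩
  have h3 : √3 ^ 2 = 3 := Real.sq_sqrt (by norm_num)
  have e1 : (δ ^ 2 * star δ * γ ^ 3).im ^ 2 * (3 / 4 : ℝ)
      = (toComplex (δ ^ 2 * star δ * γ ^ 3)).im ^ 2 := by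
    rw [toComplex_im, mul_pow, div_pow, h3]; ring
  have e2 : toComplex (δ ^ 2 * star δ * γ ^ 3)
      = ((‖toComplex δ‖ ^ 3 : ℝ) : ℂ) * (ρ * toComplex γ) ^ 3 := by
    rw [mul_pow, hρ, map_mul, map_mul, map_pow, map_pow, toComplex_star, pow_two,
      mul_assoc (toComplex δ), mul_conj,
      normSq_eq_norm_sq]
    push_cast
    field_simp
  rw [← h, mul_comm (3 / 4 : ℝ), e1, e2, im_ofReal_mul, ← normSq_toComplex, ← normSq_toComplex,
    normSq_eq_norm_sq (toComplex δ), mul_assoc (zeta ^ _)]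
  rw [normSq_mul, normSq_eq_norm_sq ρ, hρ1, one_pow, one_mul] at hj
  nlinarith [mul_le_mul_of_nonneg_left hj (by positivity : 0 ≤ ‖toComplex δ‖ ^ 6)]

end EisensteinInt

/-- The parametrization of monic integral cubics with square discriminant by pairs of Eisenstein
integers and the coefficient of `X²`. -/
theorem exists_eisensteinInt_of_sq_eq_discr {a b c y : ℤ} (hy0 : y ≠ 0)
    (hy : y ^ 2 = a ^ 2 * b ^ 2 - 4 * b ^ 3 - 4 * a ^ 3 * c - 27 * c ^ 2 + 18 * a * b * c) :
    ∃ β r : EisensteinInt, β ≠ 0 ∧ r ≠ 0 ∧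
      QuadraticAlgebra.norm β * QuadraticAlgebra.norm r = a ^ 2 - 3 * b ∧
      (β ^ 2 * star β * r ^ 3).im = 3 * y ∧
      2 * (β ^ 2 * star β * r ^ 3).re - (β ^ 2 * star β * r ^ 3).im
        = -2 * a ^ 3 + 9 * a * b - 27 * c := by
  set J := -2 * a ^ 3 + 9 * a * b - 27 * c with hJ
  have hIJ : 4 * (a ^ 2 - 3 * b) ^ 3 = J ^ 2 + 27 * y ^ 2 := by rw [hy, hJ]; ring
  have hpar : Even (J + 3 * y) := by
    have h4 : Even (J ^ 2 + 27 * y ^ 2) := by rw [← hIJ]; exact ⟨2 * (a ^ 2 - 3 * b) ^ 3, by ring⟩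
    simp only [Int.even_add, Int.even_pow, Int.even_mul] at h4 ⊢
    have h27 : ¬ Even (27 : ℤ) := by decide
    have h3 : ¬ Even (3 : ℤ) := by decide
    tauto
  obtain ⟨m, hm⟩ := hpar
  set z : EisensteinInt := ⟨m, 3 * y⟩
  have hz0 : z ≠ 0 := by
    intro h
    have := congrArg QuadraticAlgebra.im h
    simp [z, hy0] at this
  have hzn : QuadraticAlgebra.norm z = (a ^ 2 - 3 * b) ^ 3 := by
    rw [EisensteinInt.norm_eq]
    have : J = 2 * m - 3 * y := by linarith
    rw [this] at hIJ
    simp only [z]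
    linarith
  obtain ⟨β, r, hz⟩ := EisensteinInt.exists_eq_sq_mul_star_mul_cube z _ hz0 hzn
  refine ⟨β, r, ?_, ?_, ?_, ?_, ?_⟩
  · rintro rfl; simp [hz0] at hz
  · rintro rfl; simp [hz0] at hz
  · rw [hz] at hzn
    exact EisensteinInt.norm_mul_norm_eq_of_eq_sq_mul_star_mul_cube hzn
  · rw [← hz]
  · rw [← hz]; simp only [z]; linarith

theorem discr_le_of_abs_le {a b c : ℤ} {H : ℝ} (hH : 2 ≤ H) (ha : |(a : ℝ)| ≤ H)
    (hb : |(b : ℝ)| ≤ H) (hc : |(c : ℝ)| ≤ H) (hI : H ≤ (a ^ 2 - 3 * b : ℝ)) :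
    (a ^ 2 * b ^ 2 - 4 * b ^ 3 - 4 * a ^ 3 * c - 27 * c ^ 2 + 18 * a * b * c : ℝ)
      ≤ 100 * (a ^ 2 - 3 * b) * H ^ 2 := by
  set I : ℝ := a ^ 2 - 3 * b with hIdef
  have haa : |(a : ℝ)| ≤ (a : ℝ) ^ 2 := by
    have : |a| ≤ a ^ 2 := by
      rw [← sq_abs]; nlinarith [Int.le_self_sq |a|]
    exact_mod_cast this
  have hb' := abs_le.1 hb
  have ha4 : (a : ℝ) ^ 2 ≤ 4 * I := by linarith [hb'.1, hb'.2]
  have hI0 : 0 ≤ I := by linarith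
  have hb2 : (b : ℝ) ^ 2 ≤ H ^ 2 := sq_le_sq' hb'.1 hb'.2
  have t1 : (a : ℝ) ^ 2 * b ^ 2 ≤ 4 * I * H ^ 2 := by gcongr
  have t2 : -(4 * (b : ℝ) ^ 3) ≤ 4 * I * H ^ 2 := by
    have : -(b : ℝ) ^ 3 ≤ |(b : ℝ)| ^ 3 := by rw [← abs_pow]; exact neg_le_abs _
    have h2 : |(b : ℝ)| ^ 3 ≤ H * H ^ 2 := by
      rw [← pow_succ']; gcongr
    nlinarith [sq_nonneg H]
  have t3 : -(4 * (a : ℝ) ^ 3 * c) ≤ 16 * I * H ^ 2 := by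
    have : -((a : ℝ) ^ 3 * c) ≤ |(a : ℝ)| ^ 2 * (|(a : ℝ)| * |(c : ℝ)|) := by
      rw [← mul_assoc, ← pow_succ, ← abs_pow, ← abs_mul]; exact neg_le_abs _
    have h2 : |(a : ℝ)| ^ 2 * (|(a : ℝ)| * |(c : ℝ)|) ≤ (4 * I) * (H * H) := by
      rw [sq_abs]; gcongr
    nlinarith
  have t4 : 18 * (a : ℝ) * b * c ≤ 72 * I * H ^ 2 := by
    have : (a : ℝ) * b * c ≤ |(a : ℝ)| * (|(b : ℝ)| * |(c : ℝ)|) := by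
      rw [← mul_assoc, ← abs_mul, ← abs_mul]; exact le_abs_self _
    have h2 : |(a : ℝ)| * (|(b : ℝ)| * |(c : ℝ)|) ≤ (4 * I) * (H * H) := by
      gcongr; linarith
    nlinarith
  nlinarith [sq_nonneg (c : ℝ), mul_nonneg hI0 (sq_nonneg H)]

theorem Finset.card_le_of_forall_sub_le {s : Finset ℤ} {L : ℝ} (hL : 0 ≤ L)
    (h : ∀ x ∈ s, ∀ y ∈ s, (x : ℝ) - y ≤ L) : (s.card : ℝ) ≤ L + 1 := by
  rcases s.eq_empty_or_nonempty with rfl | hs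
  · simp; linarith
  have hsub : s ⊆ Finset.Icc (s.min' hs) (s.max' hs) := fun x hx =>
    Finset.mem_Icc.2 ⟨s.min'_le x hx, s.le_max' x hx⟩
  have hc := Finset.card_le_card hsub
  rw [Int.card_Icc] at hc
  have hle := s.min'_le _ (s.max'_mem hs)
  have hc' : (s.card : ℤ) ≤ s.max' hs + 1 - s.min' hs := by omega
  have hc'' : (s.card : ℝ) ≤ s.max' hs + 1 - s.min' hs := by exact_mod_cast hc'
  linarith [h _ (s.max'_mem hs) _ (s.min'_mem hs)]

theorem Finset.card_le_of_abs_sq_sub_sq_le {s : Finset ℤ} {h t : ℝ} (ht : 0 < t)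
    (hth : t ≤ 2 * h ^ 2) (hs : ∀ x ∈ s, |(x : ℝ) ^ 2 - t ^ 2| ≤ 3 * h ^ 2) :
    (s.card : ℝ) ≤ 28 * h ^ 2 / t := by
  have key : ∀ x y : ℝ, 0 ≤ x → 0 ≤ y → |x ^ 2 - t ^ 2| ≤ 3 * h ^ 2 → |y ^ 2 - t ^ 2| ≤ 3 * h ^ 2 →
      x - y ≤ 12 * h ^ 2 / t := by
    intro x y hx hy hxt hyt
    rw [abs_le] at hxt hyt
    rw [le_div_iff₀ ht]
    rcases le_total x y with hxy | hxy
    · nlinarith [sq_nonneg h]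
    rcases le_total (t / 2) x with h1 | h1
    · have : (x - y) * (t / 2) ≤ (x - y) * (x + y) :=
        mul_le_mul_of_nonneg_left (by linarith) (by linarith)
      nlinarith
    · nlinarith
  have hpos : ∀ u : Finset ℤ, (∀ x ∈ u, 0 ≤ (x : ℝ) ∧ |(x : ℝ) ^ 2 - t ^ 2| ≤ 3 * h ^ 2) →
      (u.card : ℝ) ≤ 14 * h ^ 2 / t := by
    intro u hu
    have h1 := Finset.card_le_of_forall_sub_le (s := u) (L := 12 * h ^ 2 / t) (by positivity)
      fun x hx y hy => key x y (hu x hx).1 (hu y hy).1 (hu x hx).2 (hu y hy).2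
    have h2 : 1 ≤ 2 * h ^ 2 / t := (one_le_div ht).2 hth
    calc (u.card : ℝ) ≤ 12 * h ^ 2 / t + 2 * h ^ 2 / t := by linarith
      _ = 14 * h ^ 2 / t := by ring
  have hA := hpos (s.filter (0 ≤ ·)) fun x hx => by
    rw [Finset.mem_filter] at hx; exact ⟨by exact_mod_cast hx.2, hs x hx.1⟩
  have hB := hpos ((s.filter (¬ 0 ≤ ·)).image (- ·)) fun x hx => by
    obtain ⟨y, hy, rfl⟩ := Finset.mem_image.1 hx
    rw [Finset.mem_filter] at hy
    have hy' : y ≤ 0 := by omega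
    refine ⟨by exact_mod_cast neg_nonneg.2 hy', ?_⟩
    push_cast
    rw [neg_sq]; exact hs y hy.1
  rw [Finset.card_image_of_injective _ neg_injective] at hB
  have hsplit := Finset.card_filter_add_card_filter_not (s := s) (0 ≤ ·)
  rw [← hsplit]
  push_cast
  calc _ ≤ 14 * h ^ 2 / t + 14 * h ^ 2 / t := add_le_add hA hB
    _ = 28 * h ^ 2 / t := by ring

/-- Bound for the fibre product: a finite set of pairs whose first coordinates satisfy a counting
bound and whose fibres are uniformly bounded. -/
theorem Finset.card_le_mul_of_fiber_le {α β : Type*} [DecidableEq α] [DecidableEq β]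
    (s : Finset (α × β)) {A B : ℝ} (hB : 0 ≤ B) (hA : ((s.image Prod.fst).card : ℝ) ≤ A)
    (hfib : ∀ x : α, ∀ t : Finset β, (∀ y ∈ t, (x, y) ∈ s) → (t.card : ℝ) ≤ B) :
    (s.card : ℝ) ≤ A * B := by
  have h1 : ∀ x, ((s.filter (·.1 = x)).card : ℝ) ≤ B := by
    intro x
    have hinj : Set.InjOn Prod.snd (s.filter (·.1 = x) : Set (α × β)) := by
      rintro ⟨u, v⟩ hu ⟨u', v'⟩ hu' h
      simp only [Finset.coe_filter, Set.mem_ofPred_eq] at hu hu' h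
      rw [hu.2, hu'.2, h]
    rw [← Finset.card_image_of_injOn hinj]
    refine hfib x _ fun y hy => ?_
    obtain ⟨⟨u, v⟩, hu, rfl⟩ := Finset.mem_image.1 hy
    rw [Finset.mem_filter] at hu
    obtain ⟨hu1, rfl⟩ := hu
    exact hu1
  rw [Finset.card_eq_sum_card_image Prod.fst s]
  push_cast
  calc _ ≤ ∑ _x ∈ s.image Prod.fst, B := Finset.sum_le_sum fun x _ => h1 x
    _ = ((s.image Prod.fst).card : ℝ) * B := by simp
    _ ≤ A * B := mul_le_mul_of_nonneg_right hA hB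

section Counting

variable {h D : ℝ} {m : ℤ} {s : Finset (ℤ × ℤ)}

theorem max_one_abs_le_two_mul {m n : ℤ} {w : ℝ} (hw : 0 ≤ w)
    (hQ : (m ^ 2 - m * n + n ^ 2 : ℝ) = w ^ 2) (h1 : 1 ≤ w ^ 2) : max 1 |(m : ℝ)| ≤ 2 * w := by
  refine max_le (by nlinarith) (abs_le_of_sq_le_sq ?_ (by linarith))
  nlinarith [sq_nonneg ((m : ℝ) - 2 * n)]

theorem card_le_of_norm_mul_le (hh : 1 ≤ h) (hD : 1 ≤ D) (hDh : D ≤ 2 * h)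
    (hs1 : ∀ x ∈ s, (1 : ℝ) ≤ m ^ 2 - m * x.1 + x.1 ^ 2)
    (hs2 : ∀ x ∈ s, |(x.2 : ℝ) ^ 2 - (m ^ 2 - m * x.1 + x.1 ^ 2) * D ^ 2| ≤ 3 * h ^ 2)
    (hs3 : ∀ x ∈ s, ((m ^ 2 - m * x.1 + x.1 ^ 2 : ℝ)) * D ^ 2 ≤ h ^ 2) :
    (s.card : ℝ) ≤ 60 * h ^ 3 / (D ^ 2 * max 1 |(m : ℝ)|) := by
  have hD0 : 0 < D := by linarith
  have hh0 : 0 < h := by linarith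
  rcases s.eq_empty_or_nonempty with rfl | ⟨x₀, hx₀⟩
  · simp; positivity
  have hone : 1 ≤ 2 * h / D := (one_le_div hD0).2 hDh
  have hmu : max 1 |(m : ℝ)| ≤ 2 * h / D := by
    refine max_le hone (abs_le_of_sq_le_sq ?_ (by positivity))
    rw [div_pow, le_div_iff₀ (by positivity)]
    have := hs3 x₀ hx₀
    nlinarith [mul_nonneg (sq_nonneg ((m : ℝ) - 2 * x₀.1)) (sq_nonneg D)]
  have hn : ∀ x ∈ s, |(x.1 : ℝ)| ≤ 2 * h / D := by
    intro x hx
    refine abs_le_of_sq_le_sq ?_ (by positivity)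
    rw [div_pow, le_div_iff₀ (by positivity)]
    have := hs3 x hx
    nlinarith [mul_nonneg (sq_nonneg (2 * (m : ℝ) - x.1)) (sq_nonneg D)]
  have hA : ((s.image Prod.fst).card : ℝ) ≤ 6 * h / D := by
    have := Finset.card_le_of_forall_sub_le (s := s.image Prod.fst) (L := 4 * h / D) (by positivity)
      (by
        intro u hu v hv
        obtain ⟨x, hx, rfl⟩ := Finset.mem_image.1 hu
        obtain ⟨y, hy, rfl⟩ := Finset.mem_image.1 hv
        have h1 := abs_le.1 (hn x hx)
        have h2 := abs_le.1 (hn y hy)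
        have : 4 * h / D = 2 * h / D + 2 * h / D := by ring
        linarith [h1.2, h2.1])
    have e : 6 * h / D = 4 * h / D + 2 * h / D := by ring
    linarith
  have hcard := Finset.card_le_mul_of_fiber_le s (B := 5 * h) (by positivity) hA (by
    intro n t ht
    have := Finset.card_le_of_forall_sub_le (s := t) (L := 4 * h) (by positivity) (by
      have hb : ∀ a ∈ t, |(a : ℝ)| ≤ 2 * h := fun a ha => by
        refine abs_le_of_sq_le_sq ?_ (by positivity)
        have h1 := abs_le.1 (hs2 _ (ht a ha))
        have h2 := hs3 _ (ht a ha)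
        nlinarith [h1.2]
      intro x hx y hy
      linarith [(abs_le.1 (hb x hx)).2, (abs_le.1 (hb y hy)).1])
    linarith)
  have hmu0 : 0 < max 1 |(m : ℝ)| := by positivity
  calc (s.card : ℝ) ≤ 6 * h / D * (5 * h) := hcard
    _ ≤ 60 * h ^ 3 / (D ^ 2 * max 1 |(m : ℝ)|) := by
      rw [le_div_iff₀ (by positivity)]
      calc 6 * h / D * (5 * h) * (D ^ 2 * max 1 |(m : ℝ)|)
          = 30 * h ^ 2 * (D * max 1 |(m : ℝ)|) := by field_simp; ring
        _ ≤ 30 * h ^ 2 * (D * (2 * h / D)) := by gcongr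
        _ = 60 * h ^ 3 := by field_simp; ring

theorem card_le_of_lt_norm_mul (hh : 1 ≤ h) (hD : 1 ≤ D) (hDh : D ≤ 2 * h)
    {p q : ℝ} (hq : 1 / 2 ≤ |q|)
    (hs1 : ∀ x ∈ s, (1 : ℝ) ≤ m ^ 2 - m * x.1 + x.1 ^ 2)
    (hs2 : ∀ x ∈ s, |(x.2 : ℝ) ^ 2 - (m ^ 2 - m * x.1 + x.1 ^ 2) * D ^ 2| ≤ 3 * h ^ 2)
    (hs3 : ∀ x ∈ s, h ^ 2 ≤ (m ^ 2 - m * x.1 + x.1 ^ 2 : ℝ) * D ^ 2)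
    (hs4 : ∀ x ∈ s, (m ^ 2 - m * x.1 + x.1 ^ 2 : ℝ) * D ^ 2 ≤ 4 * h ^ 4)
    (hs5 : ∀ x ∈ s, (p * m + q * x.1) ^ 2 * D ^ 4 * (m ^ 2 - m * x.1 + x.1 ^ 2 : ℝ) ≤ 675 * h ^ 4) :
    (s.card : ℝ) ≤ 5936 * h ^ 3 / (D ^ 2 * max 1 |(m : ℝ)|) := by
  have hD0 : 0 < D := by linarith
  have hh0 : 0 < h := by linarith
  set μ := max 1 |(m : ℝ)| with hμ
  have hμ0 : 0 < μ := by positivity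
  set T := max (h / D) (μ / 2) with hT
  have hT0 : 0 < T := lt_max_of_lt_right (by positivity)
  have hw : ∀ x ∈ s, ∃ w : ℝ, T ≤ w ∧ (m ^ 2 - m * x.1 + x.1 ^ 2 : ℝ) = w ^ 2 := by
    intro x hx
    have h1 := hs1 x hx
    have hsq : (m ^ 2 - m * x.1 + x.1 ^ 2 : ℝ) = √(m ^ 2 - m * x.1 + x.1 ^ 2 : ℝ) ^ 2 :=
      (Real.sq_sqrt (by linarith)).symm
    refine ⟨_, max_le ?_ ?_, hsq⟩
    · rw [div_le_iff₀ hD0]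
      refine (sq_le_sq₀ hh0.le (mul_nonneg (Real.sqrt_nonneg _) hD0.le)).1 ?_
      rw [mul_pow, ← hsq]; exact hs3 x hx
    · have := max_one_abs_le_two_mul (Real.sqrt_nonneg _) hsq (by rw [← hsq]; exact h1)
      linarith
  have hlin : ∀ x ∈ s, |p * m + q * x.1| ≤ 26 * h ^ 2 / (D ^ 2 * T) := by
    intro x hx
    obtain ⟨w, hTw, hQ⟩ := hw x hx
    have h5 := hs5 x hx
    rw [hQ] at h5
    have hw0 : 0 < w := hT0.trans_le hTw
    rw [le_div_iff₀ (by positivity)]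
    calc |p * m + q * x.1| * (D ^ 2 * T) ≤ |p * m + q * x.1| * (D ^ 2 * w) := by gcongr
      _ ≤ 26 * h ^ 2 := by
        refine (sq_le_sq₀ (by positivity) (by positivity)).1 ?_
        rw [mul_pow, sq_abs]
        nlinarith [pow_pos hh0 4]
  have hA : ((s.image Prod.fst).card : ℝ) ≤ 104 * h ^ 2 / (D ^ 2 * T) + 1 := by
    refine Finset.card_le_of_forall_sub_le (by positivity) fun u hu v hv => ?_
    obtain ⟨x, hx, rfl⟩ := Finset.mem_image.1 hu
    obtain ⟨y, hy, rfl⟩ := Finset.mem_image.1 hv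
    have h1 := hlin x hx
    have h2 := hlin y hy
    have h3 : |q| * |(x.1 : ℝ) - y.1| ≤ 52 * h ^ 2 / (D ^ 2 * T) := by
      rw [← abs_mul]
      calc |q * ((x.1 : ℝ) - y.1)| = |(p * m + q * x.1) - (p * m + q * y.1)| := by congr 1; ring
        _ ≤ |p * m + q * x.1| + |p * m + q * y.1| := abs_sub _ _
        _ ≤ 26 * h ^ 2 / (D ^ 2 * T) + 26 * h ^ 2 / (D ^ 2 * T) := add_le_add h1 h2
        _ = _ := by ring
    have h4 : 1 / 2 * |(x.1 : ℝ) - y.1| ≤ |q| * |(x.1 : ℝ) - y.1| := by gcongr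
    calc (x.1 : ℝ) - y.1 ≤ |(x.1 : ℝ) - y.1| := le_abs_self _
      _ ≤ 2 * (52 * h ^ 2 / (D ^ 2 * T)) := by linarith
      _ = _ := by ring
  have hcard := Finset.card_le_mul_of_fiber_le s (B := 28 * h ^ 2 / (T * D)) (by positivity) hA (by
    intro n t ht
    rcases t.eq_empty_or_nonempty with rfl | ⟨a₀, ha₀⟩
    · simp; positivity
    obtain ⟨w, hTw, hQ⟩ := hw _ (ht a₀ ha₀)
    have hw0 : 0 < w := hT0.trans_le hTw
    simp only at hQ
    have h4 := hs4 _ (ht a₀ ha₀)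
    simp only [hQ] at h4
    have := Finset.card_le_of_abs_sq_sub_sq_le (s := t) (h := h) (t := w * D) (by positivity)
      ((sq_le_sq₀ (mul_nonneg hw0.le hD0.le) (by positivity)).1 (by nlinarith)) (fun a ha => by
        have := hs2 _ (ht a ha)
        simp only [hQ] at this
        rwa [mul_pow])
    refine this.trans ?_
    gcongr)
  have hTμ : 1 / T ≤ 2 / μ := by
    rw [div_le_div_iff₀ hT0 hμ0]; linarith [le_max_right (h / D) (μ / 2)]
  have hTh : 1 / T ≤ D / h := by
    rw [div_le_div_iff₀ hT0 hh0]
    have := le_max_left (h / D) (μ / 2)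
    rw [div_le_iff₀ hD0] at this
    linarith
  calc (s.card : ℝ) ≤ (104 * h ^ 2 / (D ^ 2 * T) + 1) * (28 * h ^ 2 / (T * D)) := hcard
    _ = 2912 * h ^ 4 / D ^ 3 * (1 / T * (1 / T)) + 28 * h ^ 2 / D ^ 2 * D * (1 / T) := by
      field_simp; ring
    _ ≤ 2912 * h ^ 4 / D ^ 3 * (2 / μ * (D / h)) + 28 * h ^ 2 / D ^ 2 * (2 * h) * (2 / μ) := by
      gcongr
    _ = 5936 * h ^ 3 / (D ^ 2 * μ) := by field_simp; ring

/-- The main counting estimate on a line: the number of pairs `(n, a)` for which `m + nω` is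
attached to a cubic of height at most `h²` with `X²`-coefficient `a`. -/
theorem card_line_le (hh : 1 ≤ h) (hD : 1 ≤ D) (hDh : D ≤ 2 * h) {p q : ℝ} (hq : 1 / 2 ≤ |q|)
    (hs1 : ∀ x ∈ s, (1 : ℝ) ≤ m ^ 2 - m * x.1 + x.1 ^ 2)
    (hs2 : ∀ x ∈ s, |(x.2 : ℝ) ^ 2 - (m ^ 2 - m * x.1 + x.1 ^ 2) * D ^ 2| ≤ 3 * h ^ 2)
    (hs3 : ∀ x ∈ s, (m ^ 2 - m * x.1 + x.1 ^ 2 : ℝ) * D ^ 2 ≤ 4 * h ^ 4)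
    (hs4 : ∀ x ∈ s, h ^ 2 ≤ (m ^ 2 - m * x.1 + x.1 ^ 2 : ℝ) * D ^ 2 →
      (p * m + q * x.1) ^ 2 * D ^ 4 * (m ^ 2 - m * x.1 + x.1 ^ 2 : ℝ) ≤ 675 * h ^ 4) :
    (s.card : ℝ) ≤ 6000 * h ^ 3 / (D ^ 2 * max 1 |(m : ℝ)|) := by
  classical
  have hD0 : 0 < D := by linarith
  have hh0 : 0 < h := by linarith
  have hA := card_le_of_norm_mul_le (m := m)
    (s := s.filter fun x => (m ^ 2 - m * x.1 + x.1 ^ 2 : ℝ) * D ^ 2 ≤ h ^ 2) hh hD hDh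
    (fun x hx => hs1 x (Finset.mem_filter.1 hx).1) (fun x hx => hs2 x (Finset.mem_filter.1 hx).1)
    (fun x hx => (Finset.mem_filter.1 hx).2)
  have hB := card_le_of_lt_norm_mul (m := m) (p := p)
    (s := s.filter fun x => ¬ (m ^ 2 - m * x.1 + x.1 ^ 2 : ℝ) * D ^ 2 ≤ h ^ 2) hh hD hDh hq
    (fun x hx => hs1 x (Finset.mem_filter.1 hx).1) (fun x hx => hs2 x (Finset.mem_filter.1 hx).1)
    (fun x hx => (not_le.1 (Finset.mem_filter.1 hx).2).le)
    (fun x hx => hs3 x (Finset.mem_filter.1 hx).1)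
    (fun x hx => hs4 x (Finset.mem_filter.1 hx).1 (not_le.1 (Finset.mem_filter.1 hx).2).le)
  rw [← Finset.card_filter_add_card_filter_not (s := s)
    (fun x => (m ^ 2 - m * x.1 + x.1 ^ 2 : ℝ) * D ^ 2 ≤ h ^ 2)]
  push_cast
  calc _ ≤ 60 * h ^ 3 / (D ^ 2 * max 1 |(m : ℝ)|) + 5936 * h ^ 3 / (D ^ 2 * max 1 |(m : ℝ)|) :=
        add_le_add hA hB
    _ = 5996 * h ^ 3 / (D ^ 2 * max 1 |(m : ℝ)|) := by ring
    _ ≤ 6000 * h ^ 3 / (D ^ 2 * max 1 |(m : ℝ)|) := by gcongr; norm_num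

end Counting

/-- The truncated sum `∑_{|m| ≤ M} 1 / max(1, |m|)`. -/
noncomputable def absHarmonic (M : ℕ) : ℝ := ∑ m ∈ Finset.Icc (-M : ℤ) M, 1 / max 1 |(m : ℝ)|

theorem absHarmonic_nonneg (M : ℕ) : 0 ≤ absHarmonic M :=
  Finset.sum_nonneg fun _ _ => by positivity

theorem absHarmonic_le (M : ℕ) : absHarmonic M ≤ 3 + 2 * Real.log M := by
  have h : absHarmonic M = 1 + 2 * (harmonic M : ℝ) := by
    induction M with
    | zero => simp [absHarmonic]
    | succ n ih =>
      have hI : Finset.Icc (-((n + 1 : ℕ) : ℤ)) ((n + 1 : ℕ) : ℤ)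
          = insert (-(n + 1 : ℤ)) (insert (n + 1 : ℤ) (Finset.Icc (-n : ℤ) n)) := by
        ext x; simp only [Finset.mem_Icc, Finset.mem_insert]; omega
      have e : max 1 |(n : ℝ) + 1| = n + 1 := by
        rw [abs_of_nonneg (by positivity)]
        exact max_eq_right (by linarith [n.cast_nonneg (α := ℝ)])
      rw [absHarmonic] at ih ⊢
      rw [hI, Finset.sum_insert, Finset.sum_insert, ih, harmonic_succ]
      · push_cast
        rw [abs_neg, e]; ring
      · simp
      · simp only [Finset.mem_Icc, Finset.mem_insert]; omega
  rw [h]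
  linarith [harmonic_le_one_add_log M]

theorem card_le_mul_absHarmonic_of_half_le {h D : ℝ} (hh : 1 ≤ h) (hD : 1 ≤ D) (hDh : D ≤ 2 * h)
    {p q : ℝ} (hq : 1 / 2 ≤ |q|) {M : ℕ} {s : Finset (ℤ × ℤ × ℤ)}
    (hs0 : ∀ x ∈ s, x.1 ∈ Finset.Icc (-M : ℤ) M)
    (hs1 : ∀ x ∈ s, (1 : ℝ) ≤ x.1 ^ 2 - x.1 * x.2.1 + x.2.1 ^ 2)
    (hs2 : ∀ x ∈ s, |(x.2.2 : ℝ) ^ 2 - (x.1 ^ 2 - x.1 * x.2.1 + x.2.1 ^ 2) * D ^ 2| ≤ 3 * h ^ 2)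
    (hs3 : ∀ x ∈ s, (x.1 ^ 2 - x.1 * x.2.1 + x.2.1 ^ 2 : ℝ) * D ^ 2 ≤ 4 * h ^ 4)
    (hs4 : ∀ x ∈ s, h ^ 2 ≤ (x.1 ^ 2 - x.1 * x.2.1 + x.2.1 ^ 2 : ℝ) * D ^ 2 →
      (p * x.1 + q * x.2.1) ^ 2 * D ^ 4 * (x.1 ^ 2 - x.1 * x.2.1 + x.2.1 ^ 2 : ℝ)
        ≤ 675 * h ^ 4) :
    (s.card : ℝ) ≤ 6000 * h ^ 3 / D ^ 2 * absHarmonic M := by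
  classical
  rw [Finset.card_eq_sum_card_fiberwise (f := Prod.fst) (t := Finset.Icc (-M : ℤ) M) hs0,
    absHarmonic, Finset.mul_sum]
  push_cast
  refine Finset.sum_le_sum fun m _ => ?_
  have hinj : Set.InjOn Prod.snd (s.filter (·.1 = m) : Set (ℤ × ℤ × ℤ)) := by
    intro x hx y hy hxy
    exact Prod.ext (by rw [(Finset.mem_filter.1 hx).2, (Finset.mem_filter.1 hy).2]) hxy
  rw [← Finset.card_image_of_injOn hinj, div_mul_div_comm, mul_one]
  have hmem : ∀ x ∈ (s.filter (·.1 = m)).image Prod.snd, (m, x) ∈ s := by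
    intro x hx
    obtain ⟨y, hy, rfl⟩ := Finset.mem_image.1 hx
    obtain ⟨hys, rfl⟩ := Finset.mem_filter.1 hy
    exact hys
  exact card_line_le (p := p) hh hD hDh hq (fun x hx => hs1 (m, x) (hmem x hx))
    (fun x hx => hs2 (m, x) (hmem x hx)) (fun x hx => hs3 (m, x) (hmem x hx))
    (fun x hx => hs4 (m, x) (hmem x hx))

theorem card_le_mul_absHarmonic {h D : ℝ} (hh : 1 ≤ h) (hD : 1 ≤ D) (hDh : D ≤ 2 * h)
    {p q : ℝ} (hpq : 1 / 2 ≤ |p| ∨ 1 / 2 ≤ |q|) {M : ℕ} {s : Finset (ℤ × ℤ × ℤ)}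
    (hs0 : ∀ x ∈ s, x.1 ∈ Finset.Icc (-M : ℤ) M ∧ x.2.1 ∈ Finset.Icc (-M : ℤ) M)
    (hs1 : ∀ x ∈ s, (1 : ℝ) ≤ x.1 ^ 2 - x.1 * x.2.1 + x.2.1 ^ 2)
    (hs2 : ∀ x ∈ s, |(x.2.2 : ℝ) ^ 2 - (x.1 ^ 2 - x.1 * x.2.1 + x.2.1 ^ 2) * D ^ 2| ≤ 3 * h ^ 2)
    (hs3 : ∀ x ∈ s, (x.1 ^ 2 - x.1 * x.2.1 + x.2.1 ^ 2 : ℝ) * D ^ 2 ≤ 4 * h ^ 4)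
    (hs4 : ∀ x ∈ s, h ^ 2 ≤ (x.1 ^ 2 - x.1 * x.2.1 + x.2.1 ^ 2 : ℝ) * D ^ 2 →
      (p * x.1 + q * x.2.1) ^ 2 * D ^ 4 * (x.1 ^ 2 - x.1 * x.2.1 + x.2.1 ^ 2 : ℝ)
        ≤ 675 * h ^ 4) :
    (s.card : ℝ) ≤ 6000 * h ^ 3 / D ^ 2 * absHarmonic M := by
  classical
  rcases hpq with hp | hq
  · have hinj : Function.Injective fun x : ℤ × ℤ × ℤ => (x.2.1, x.1, x.2.2) := by
      rintro ⟨x, y, z⟩ ⟨x', y', z'⟩ h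
      simp only [Prod.mk.injEq] at h ⊢
      tauto
    have hQ : ∀ x y : ℝ, x ^ 2 - x * y + y ^ 2 = y ^ 2 - y * x + x ^ 2 := fun x y => by ring
    rw [← Finset.card_image_of_injective s hinj]
    refine card_le_mul_absHarmonic_of_half_le (p := q) hh hD hDh hp ?_ ?_ ?_ ?_ ?_ <;>
      simp only [Finset.forall_mem_image]
    · exact fun x hx => (hs0 x hx).2
    · intro x hx; rw [hQ]; exact hs1 x hx
    · intro x hx; rw [hQ]; exact hs2 x hx
    · intro x hx; rw [hQ]; exact hs3 x hx
    · intro x hx; rw [hQ, add_comm (q * _)]; exact hs4 x hx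
  · exact card_le_mul_absHarmonic_of_half_le hh hD hDh hq (fun x hx => (hs0 x hx).1) hs1 hs2 hs3 hs4

theorem max_one_abs_mul_max_one_abs_le_norm {δ : EisensteinInt} (hδ : δ ≠ 0) :
    max 1 |(δ.re : ℝ)| * max 1 |(δ.im : ℝ)| ≤ (δ.norm : ℤ) := by
  suffices h : max 1 |δ.re| * max 1 |δ.im| ≤ δ.norm by exact_mod_cast h
  have hN := EisensteinInt.norm_pos hδ
  rw [EisensteinInt.norm_eq] at hN ⊢
  generalize δ.re = m at *
  generalize δ.im = n at *
  rcases eq_or_ne m 0 with rfl | hm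
  · have h1 : 1 ≤ |n| := Int.one_le_abs (by rintro rfl; simp at hN)
    rw [abs_zero, max_eq_left zero_le_one, max_eq_right h1, ← sq_abs n]
    nlinarith
  rcases eq_or_ne n 0 with rfl | hn
  · have h1 : 1 ≤ |m| := Int.one_le_abs hm
    rw [abs_zero, max_eq_left zero_le_one, max_eq_right h1, ← sq_abs m]
    nlinarith
  · rw [max_eq_right (Int.one_le_abs hm), max_eq_right (Int.one_le_abs hn), ← abs_mul]
    refine abs_le'.2 ⟨?_, ?_⟩ <;> nlinarith [sq_nonneg (m - n), sq_nonneg m, sq_nonneg n]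

theorem sum_one_div_norm_le (M : ℕ) {s : Finset EisensteinInt}
    (hs0 : ∀ δ ∈ s, δ ≠ 0)
    (hs : ∀ δ ∈ s, δ.re ∈ Finset.Icc (-M : ℤ) M ∧ δ.im ∈ Finset.Icc (-M : ℤ) M) :
    ∑ δ ∈ s, 1 / ((δ.norm : ℤ) : ℝ) ≤ absHarmonic M ^ 2 := by
  classical
  have hinj : Function.Injective fun δ : EisensteinInt => (δ.re, δ.im) := fun x y h =>
    QuadraticAlgebra.ext (congrArg Prod.fst h) (congrArg Prod.snd h)
  calc ∑ δ ∈ s, 1 / ((δ.norm : ℤ) : ℝ)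
      ≤ ∑ δ ∈ s, 1 / max 1 |(δ.re : ℝ)| * (1 / max 1 |(δ.im : ℝ)|) := by
        refine Finset.sum_le_sum fun δ hδ => ?_
        rw [div_mul_div_comm, mul_one]
        exact one_div_le_one_div_of_le (by positivity)
          (max_one_abs_mul_max_one_abs_le_norm (hs0 δ hδ))
    _ = ∑ x ∈ s.image fun δ : EisensteinInt => ((δ.re, δ.im) : ℤ × ℤ),
          1 / max 1 |(x.1 : ℝ)| * (1 / max 1 |(x.2 : ℝ)|) := by
        rw [Finset.sum_image hinj.injOn]
    _ ≤ ∑ x ∈ Finset.Icc (-M : ℤ) M ×ˢ Finset.Icc (-M : ℤ) M,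
          1 / max 1 |(x.1 : ℝ)| * (1 / max 1 |(x.2 : ℝ)|) := by
        refine Finset.sum_le_sum_of_subset_of_nonneg ?_ fun _ _ _ => by positivity
        intro x hx
        obtain ⟨δ, hδ, rfl⟩ := Finset.mem_image.1 hx
        exact Finset.mem_product.2 (hs δ hδ)
    _ = absHarmonic M ^ 2 := by
        rw [sq, absHarmonic, Finset.sum_mul_sum, Finset.sum_product]

theorem re_mem_Icc_of_norm_le {z : EisensteinInt} {M : ℕ} {B : ℝ} (hB : 0 ≤ B)
    (hM : ∀ k : ℤ, |(k : ℝ)| ≤ B → k ∈ Finset.Icc (-M : ℤ) M)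
    (hz : 4 * ((z.norm : ℤ) : ℝ) ≤ 3 * B ^ 2) :
    z.re ∈ Finset.Icc (-M : ℤ) M ∧ z.im ∈ Finset.Icc (-M : ℤ) M := by
  rw [EisensteinInt.norm_eq] at hz
  push_cast at hz
  constructor <;> refine hM _ (abs_le_of_sq_le_sq ?_ hB)
  · nlinarith [sq_nonneg ((z.re : ℝ) - 2 * z.im)]
  · nlinarith [sq_nonneg (2 * (z.re : ℝ) - z.im)]

theorem ncard_le_of_parametrization {ι : Type*} [Fintype ι] {H : ℝ} (hH : 2 ≤ H)
    {p q : EisensteinInt → ι → ℝ} (hpq : ∀ δ ≠ 0, ∀ i, 1 / 2 ≤ |p δ i| ∨ 1 / 2 ≤ |q δ i|)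
    {α : Type*} (φ : ι → EisensteinInt → EisensteinInt → ℤ → α) {T : Set α}
    (hT : ∀ t ∈ T, ∃ i δ γ, ∃ a : ℤ, δ ≠ 0 ∧ γ ≠ 0 ∧ δ.norm ≤ γ.norm ∧ |(a : ℝ)| ≤ H ∧
      |(a : ℝ) ^ 2 - (γ.norm : ℤ) * (δ.norm : ℤ)| ≤ 3 * H ∧
      (H ≤ (γ.norm : ℤ) * (δ.norm : ℤ) →
        (p δ i * γ.re + q δ i * γ.im) ^ 2 * ((δ.norm : ℤ) : ℝ) ^ 2 * (γ.norm : ℤ)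
          ≤ 675 * H ^ 2) ∧ φ i δ γ a = t) :
    (T.ncard : ℝ) ≤ Fintype.card ι * (6000 * √H ^ 3 * absHarmonic ⌊3 * H⌋₊ ^ 3) := by
  classical
  set M := ⌊3 * H⌋₊ with hMdef
  set h := √H with hh
  have hh2 : h ^ 2 = H := Real.sq_sqrt (by linarith)
  have hh1 : 1 ≤ h := Real.one_le_sqrt.2 (by linarith)
  have hM : ∀ k : ℤ, |(k : ℝ)| ≤ 3 * H → k ∈ Finset.Icc (-M : ℤ) M := by
    intro k hk
    have h1 : k.natAbs ≤ M := Nat.le_floor (by rw [Nat.cast_natAbs]; exact_mod_cast hk)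
    exact Finset.mem_Icc.2 (by omega)
  set I := Finset.Icc (-M : ℤ) M with hI
  set B : Finset EisensteinInt := ((I ×ˢ I).image fun x => ⟨x.1, x.2⟩).filter
    fun δ => δ ≠ 0 ∧ ((δ.norm : ℤ) : ℝ) ≤ 2 * H with hBdef
  have hB : ∀ δ ∈ B, (δ.re ∈ I ∧ δ.im ∈ I) ∧ δ ≠ 0 ∧ ((δ.norm : ℤ) : ℝ) ≤ 2 * H := by
    intro δ hδ
    obtain ⟨h1, h2⟩ := Finset.mem_filter.1 hδ
    obtain ⟨x, hx, rfl⟩ := Finset.mem_image.1 h1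
    exact ⟨Finset.mem_product.1 hx, h2⟩
  set S : ι → EisensteinInt → Finset (ℤ × ℤ × ℤ) := fun i δ => (I ×ˢ I ×ˢ I).filter fun x =>
    (1 : ℝ) ≤ x.1 ^ 2 - x.1 * x.2.1 + x.2.1 ^ 2 ∧
    |(x.2.2 : ℝ) ^ 2 - (x.1 ^ 2 - x.1 * x.2.1 + x.2.1 ^ 2) * √(δ.norm : ℤ) ^ 2| ≤ 3 * h ^ 2 ∧
    (x.1 ^ 2 - x.1 * x.2.1 + x.2.1 ^ 2 : ℝ) * √(δ.norm : ℤ) ^ 2 ≤ 4 * h ^ 4 ∧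
    (h ^ 2 ≤ (x.1 ^ 2 - x.1 * x.2.1 + x.2.1 ^ 2 : ℝ) * √(δ.norm : ℤ) ^ 2 →
      (p δ i * x.1 + q δ i * x.2.1) ^ 2 * √(δ.norm : ℤ) ^ 4
        * (x.1 ^ 2 - x.1 * x.2.1 + x.2.1 ^ 2 : ℝ) ≤ 675 * h ^ 4) with hS
  have hScard : ∀ i, ∀ δ ∈ B,
      ((S i δ).card : ℝ) ≤ 6000 * h ^ 3 * absHarmonic M * (1 / ((δ.norm : ℤ) : ℝ)) := by
    intro i δ hδ
    obtain ⟨-, hδ0, hδN⟩ := hB δ hδ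
    have hN1 : (1 : ℝ) ≤ (δ.norm : ℤ) := by exact_mod_cast EisensteinInt.norm_pos hδ0
    have hS' : ∀ x ∈ S i δ, _ := fun x hx => (Finset.mem_filter.1 hx).2
    have := card_le_mul_absHarmonic (s := S i δ) (M := M) hh1 (Real.one_le_sqrt.2 hN1)
      (Real.sqrt_le_iff.2 ⟨by positivity, by nlinarith⟩) (hpq δ hδ0 i)
      (fun x hx => by
        have h1 := Finset.mem_product.1 (Finset.mem_filter.1 hx).1
        exact ⟨h1.1, (Finset.mem_product.1 h1.2).1⟩)
      (fun x hx => (hS' x hx).1) (fun x hx => (hS' x hx).2.1) (fun x hx => (hS' x hx).2.2.1)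
      (fun x hx => (hS' x hx).2.2.2)
    rw [Real.sq_sqrt (by linarith)] at this
    calc _ ≤ _ := this
      _ = _ := by ring
  have hcover : T ⊆ ((Finset.univ.biUnion fun i => B.biUnion fun δ =>
      (S i δ).image fun x => φ i δ ⟨x.1, x.2.1⟩ x.2.2 : Finset α) : Set α) := by
    intro t ht
    obtain ⟨i, δ, γ, a, hδ, hγ, hle, ha, hab, hlin, rfl⟩ := hT t ht
    have hδ1 : (1 : ℝ) ≤ (δ.norm : ℤ) := by exact_mod_cast EisensteinInt.norm_pos hδ
    have hγ1 : (1 : ℝ) ≤ (γ.norm : ℤ) := by exact_mod_cast EisensteinInt.norm_pos hγ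
    have hle' : ((δ.norm : ℤ) : ℝ) ≤ (γ.norm : ℤ) := by exact_mod_cast hle
    have hNN : ((γ.norm : ℤ) : ℝ) * (δ.norm : ℤ) ≤ 4 * H ^ 2 := by
      have h1 := (abs_le.1 hab).1
      have h2 : (a : ℝ) ^ 2 ≤ H ^ 2 := sq_le_sq.2 (by rwa [abs_of_pos (by linarith : 0 < H)])
      nlinarith
    have hδH : ((δ.norm : ℤ) : ℝ) ≤ 2 * H := by nlinarith
    have hγH : ((γ.norm : ℤ) : ℝ) ≤ 4 * H ^ 2 := by nlinarith
    have hδI := re_mem_Icc_of_norm_le (B := 3 * H) (z := δ) (by linarith) hM (by nlinarith)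
    have hγI := re_mem_Icc_of_norm_le (B := 3 * H) (z := γ) (by linarith) hM (by nlinarith)
    have hγe : ((γ.norm : ℤ) : ℝ) = γ.re ^ 2 - γ.re * γ.im + γ.im ^ 2 := by
      rw [EisensteinInt.norm_eq]; push_cast; ring
    have hs : √((δ.norm : ℤ) : ℝ) ^ 2 = (δ.norm : ℤ) := Real.sq_sqrt (by linarith)
    have hs4 : √((δ.norm : ℤ) : ℝ) ^ 4 = ((δ.norm : ℤ) : ℝ) ^ 2 := by
      rw [show 4 = 2 * 2 from rfl, pow_mul, hs]
    have hh4 : h ^ 4 = H ^ 2 := by rw [← hh2]; ring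
    simp only [Finset.coe_biUnion, Set.mem_iUnion, Finset.mem_coe, Finset.mem_univ, exists_prop,
      true_and, Finset.mem_image]
    refine ⟨i, δ, ?_, (γ.re, γ.im, a), ?_, rfl⟩
    · exact Finset.mem_filter.2 ⟨Finset.mem_image.2 ⟨(δ.re, δ.im), Finset.mem_product.2 hδI, rfl⟩,
        hδ, hδH⟩
    · refine Finset.mem_filter.2 ⟨Finset.mem_product.2 ⟨hγI.1, Finset.mem_product.2
        ⟨hγI.2, hM a (by linarith)⟩⟩, ?_⟩
      simp only [← hγe, hs, hs4, hh2, hh4]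
      exact ⟨hγ1, hab, hNN, hlin⟩
  have hcard : T.ncard ≤ ∑ i, ∑ δ ∈ B, (S i δ).card := by
    refine (Set.ncard_le_ncard hcover (Finset.finite_toSet _)).trans ?_
    rw [Set.ncard_coe_finset]
    exact Finset.card_biUnion_le.trans (Finset.sum_le_sum fun i _ =>
      Finset.card_biUnion_le.trans (Finset.sum_le_sum fun δ _ => Finset.card_image_le))
  have hΛ := absHarmonic_nonneg M
  calc (T.ncard : ℝ) ≤ ∑ i, ∑ δ ∈ B, ((S i δ).card : ℝ) := by exact_mod_cast hcard
    _ ≤ ∑ i : ι, ∑ δ ∈ B, 6000 * h ^ 3 * absHarmonic M * (1 / ((δ.norm : ℤ) : ℝ)) :=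
      Finset.sum_le_sum fun i _ => Finset.sum_le_sum fun δ hδ => hScard i δ hδ
    _ = Fintype.card ι * (6000 * h ^ 3 * absHarmonic M * ∑ δ ∈ B, 1 / ((δ.norm : ℤ) : ℝ)) := by
      simp only [Finset.sum_const, Finset.card_univ, nsmul_eq_mul, Finset.mul_sum]
    _ ≤ Fintype.card ι * (6000 * h ^ 3 * absHarmonic M * absHarmonic M ^ 2) := by
      gcongr
      exact sum_one_div_norm_le M (fun δ hδ => (hB δ hδ).2.1) (fun δ hδ => (hB δ hδ).1)
    _ = _ := by ring

/-- The coefficients of the cubic with `X²`-coefficient `a` attached to the Eisenstein integer `z`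
and `N = a² - 3 b`. -/
def EisensteinInt.toCubic (z : EisensteinInt) (N a : ℤ) : ℤ × ℤ × ℤ :=
  (a, (a ^ 2 - N) / 3, (-2 * a ^ 3 + 9 * a * ((a ^ 2 - N) / 3) - (2 * z.re - z.im)) / 27)

theorem EisensteinInt.toCubic_eq {z : EisensteinInt} {N a b c : ℤ} (hN : N = a ^ 2 - 3 * b)
    (hz : 2 * z.re - z.im = -2 * a ^ 3 + 9 * a * b - 27 * c) : z.toCubic N a = (a, b, c) := by
  have hb : (a ^ 2 - N) / 3 = b := by omega
  rw [toCubic, hb, hz]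
  have hc : (-2 * a ^ 3 + 9 * a * b - (-2 * a ^ 3 + 9 * a * b - 27 * c)) / 27 = c := by
    rw [sub_sub_cancel]; omega
  rw [hc]

theorem linear_form_sq_mul_le {L A B H N y : ℝ} (hA : 0 < A) (hB : 0 < B) (hN : B * A = N)
    (hy : y ^ 2 ≤ 100 * N * H ^ 2) (h : L ^ 2 * A ^ 3 * B ^ 2 ≤ 3 / 4 * (3 * y) ^ 2) :
    L ^ 2 * A ^ 2 * B ≤ 675 * H ^ 2 := by
  have hAB := mul_pos hB hA
  refine le_of_mul_le_mul_right ?_ hAB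
  calc L ^ 2 * A ^ 2 * B * (B * A) = L ^ 2 * A ^ 3 * B ^ 2 := by ring
    _ ≤ 3 / 4 * (3 * y) ^ 2 := h
    _ ≤ 675 * H ^ 2 * (B * A) := by rw [hN]; linarith

theorem ncard_square_discr_le {H : ℝ} (hH : 2 ≤ H) :
    (Set.ncard {t : ℤ × ℤ × ℤ | |(t.1 : ℝ)| ≤ H ∧ |(t.2.1 : ℝ)| ≤ H ∧ |(t.2.2 : ℝ)| ≤ H ∧
      ∃ y : ℤ, y ≠ 0 ∧ y ^ 2 = t.1 ^ 2 * t.2.1 ^ 2 - 4 * t.2.1 ^ 3 - 4 * t.1 ^ 3 * t.2.2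
        - 27 * t.2.2 ^ 2 + 18 * t.1 * t.2.1 * t.2.2} : ℝ)
      ≤ 24000 * √H ^ 3 * absHarmonic ⌊3 * H⌋₊ ^ 3 := by
  classical
  choose! p₁ q₁ hpq₁ hlin₁ using
    fun δ : EisensteinInt => EisensteinInt.exists_linear_form_le_of_cube (δ := δ)
  choose! p₂ q₂ hpq₂ hlin₂ using
    fun δ : EisensteinInt => EisensteinInt.exists_linear_forms_le_of_sq_mul_star (δ := δ)
  refine (ncard_le_of_parametrization (ι := Option (Fin 3)) hH
    (p := fun δ i => i.elim (p₁ δ) (p₂ δ)) (q := fun δ i => i.elim (q₁ δ) (q₂ δ)) ?_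
    (fun i δ γ a => i.elim ((γ ^ 2 * star γ * δ ^ 3).toCubic (γ.norm * δ.norm) a)
      fun _ => (δ ^ 2 * star δ * γ ^ 3).toCubic (δ.norm * γ.norm) a) ?_).trans_eq ?_
  · rintro δ hδ (_ | j)
    · exact hpq₁ δ hδ
    · exact hpq₂ δ hδ j
  · rintro ⟨a, b, c⟩ ⟨ha, hb, hc, y, hy0, hy⟩
    simp only at ha hb hc hy
    obtain ⟨β, r, hβ, hr, hN, him, hre⟩ := exists_eisensteinInt_of_sq_eq_discr hy0 hy
    have hNr : ((β.norm : ℤ) : ℝ) * (r.norm : ℤ) = a ^ 2 - 3 * b := by exact_mod_cast hN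
    have hβ0 : (0 : ℝ) < (β.norm : ℤ) := by exact_mod_cast EisensteinInt.norm_pos hβ
    have hr0 : (0 : ℝ) < (r.norm : ℤ) := by exact_mod_cast EisensteinInt.norm_pos hr
    have hab : |(a : ℝ) ^ 2 - (β.norm : ℤ) * (r.norm : ℤ)| ≤ 3 * H := by
      rw [hNr, sub_sub_cancel, abs_mul, abs_of_pos (by norm_num : (0 : ℝ) < 3)]; linarith
    have hyH : H ≤ (β.norm : ℤ) * (r.norm : ℤ) → (y : ℝ) ^ 2 ≤ 100 * (a ^ 2 - 3 * b) * H ^ 2 := by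
      intro h
      rw [hNr] at h
      refine le_trans (le_of_eq ?_) (discr_le_of_abs_le hH ha hb hc h)
      exact_mod_cast hy
    have himr : ((β ^ 2 * star β * r ^ 3).im : ℝ) = 3 * y := by exact_mod_cast him
    rcases le_total r.norm β.norm with hle | hle
    · refine ⟨none, r, β, a, hr, hβ, hle, ha, hab, fun h => ?_,
        EisensteinInt.toCubic_eq hN hre⟩
      have := hlin₁ r hr β
      rw [himr] at this
      exact linear_form_sq_mul_le hr0 hβ0 hNr (hyH h) this
    · obtain ⟨j, hj⟩ := hlin₂ β hβ r
      refine ⟨some j, β, r, a, hβ, hr, hle, ha, by rwa [mul_comm ((r.norm : ℤ) : ℝ)], fun h => ?_,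
        EisensteinInt.toCubic_eq hN hre⟩
      rw [himr] at hj
      rw [mul_comm] at h hNr
      exact linear_form_sq_mul_le hβ0 hr0 hNr (hyH h) hj
  · simp only [Fintype.card_option, Fintype.card_fin]
    push_cast
    ring

theorem exists_absHarmonic_floor_le {ε : ℝ} (hε : 0 < ε) :
    ∃ K : ℝ, 0 < K ∧ ∀ H : ℝ, 2 ≤ H → absHarmonic ⌊3 * H⌋₊ ≤ K * H ^ ε := by
  refine ⟨3 + 2 * (3 ^ ε / ε), by positivity, fun H hH => ?_⟩
  have hM : (0 : ℝ) < ⌊3 * H⌋₊ := by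
    exact_mod_cast Nat.floor_pos.2 (by linarith)
  have h1 : Real.log ⌊3 * H⌋₊ ≤ 3 ^ ε / ε * H ^ ε := by
    calc Real.log ⌊3 * H⌋₊ ≤ Real.log (3 * H) :=
          Real.log_le_log hM (Nat.floor_le (by linarith))
      _ ≤ (3 * H) ^ ε / ε := Real.log_le_rpow_div (by linarith) hε
      _ = _ := by rw [Real.mul_rpow (by norm_num) (by linarith)]; ring
  have h2 : 1 ≤ H ^ ε := Real.one_le_rpow (by linarith) hε.le
  linarith [absHarmonic_le ⌊3 * H⌋₊]

/-- The number of monic, irreducible, non-`S₃` cubic polynomials with integer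
coefficients bounded by `H` is `O_ε(H^{3/2+ε})`. -/
theorem cubic_nonS3_count :
    ∀ ε : ℝ, 0 < ε → ∃ K : ℝ, 0 < K ∧ ∀ H : ℝ, 2 ≤ H →
      (Set.ncard {p : ℤ × ℤ × ℤ |
          |(p.1 : ℝ)| ≤ H ∧ |(p.2.1 : ℝ)| ≤ H ∧ |(p.2.2 : ℝ)| ≤ H ∧
          Irreducible (X ^ 3 + C (p.1 : ℚ) * X ^ 2 + C (p.2.1 : ℚ) * X + C (p.2.2 : ℚ)) ∧
          ¬ Nonempty
            ((X ^ 3 + C (p.1 : ℚ) * X ^ 2 + C (p.2.1 : ℚ) * X + C (p.2.2 : ℚ)).Gal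
              ≃* Equiv.Perm (Fin 3))} : ℝ)
        ≤ K * H ^ ((3 : ℝ) / 2 + ε) := by
  intro ε hε
  obtain ⟨K, hK, hKle⟩ := exists_absHarmonic_floor_le (ε := ε / 3) (by positivity)
  refine ⟨24000 * K ^ 3, by positivity, fun H hH => ?_⟩
  have hH0 : 0 < H := by linarith
  have hfin : {t : ℤ × ℤ × ℤ | |(t.1 : ℝ)| ≤ H ∧ |(t.2.1 : ℝ)| ≤ H ∧ |(t.2.2 : ℝ)| ≤ H ∧
      ∃ y : ℤ, y ≠ 0 ∧ y ^ 2 = t.1 ^ 2 * t.2.1 ^ 2 - 4 * t.2.1 ^ 3 - 4 * t.1 ^ 3 * t.2.2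
        - 27 * t.2.2 ^ 2 + 18 * t.1 * t.2.1 * t.2.2}.Finite := by
    have hZ : {k : ℤ | |(k : ℝ)| ≤ H}.Finite := by
      refine (Set.finite_Icc (-⌊H⌋) ⌊H⌋).subset fun k hk => ?_
      have h : |k| ≤ ⌊H⌋ := Int.le_floor.2 (by exact_mod_cast hk)
      exact abs_le.1 h
    exact (hZ.prod (hZ.prod hZ)).subset fun t ht => ⟨ht.1, ht.2.1, ht.2.2.1⟩
  have hpow : √H ^ 3 * (H ^ (ε / 3)) ^ 3 = H ^ ((3 : ℝ) / 2 + ε) := by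
    rw [Real.sqrt_eq_rpow, ← Real.rpow_mul_natCast hH0.le, ← Real.rpow_mul_natCast hH0.le,
      ← Real.rpow_add hH0]
    congr 1
    push_cast
    ring
  refine (Nat.cast_le.2 (Set.ncard_le_ncard ?_ hfin)).trans
    ((ncard_square_discr_le hH).trans ?_)
  · exact fun t ht => ⟨ht.1, ht.2.1, ht.2.2.1, exists_sq_eq_discr ht.2.2.2.1 ht.2.2.2.2⟩
  · calc 24000 * √H ^ 3 * absHarmonic ⌊3 * H⌋₊ ^ 3
        ≤ 24000 * √H ^ 3 * (K * H ^ (ε / 3)) ^ 3 := by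
          have := absHarmonic_nonneg ⌊3 * H⌋₊
          gcongr
          exact hKle H hH
      _ = 24000 * K ^ 3 * (√H ^ 3 * (H ^ (ε / 3)) ^ 3) := by ring
      _ = _ := by rw [hpow]
end
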